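/- Let (M,0) and (M',0) be two germs at 0 in ℂ^N of real-analytic submanifolds of the same dimension which are k-equivalent for every integer k > 1. Denote by r_j(0) and r'_j(0), j = 1,2,3, the excess codimension, degeneracy, and orbit codimension at 0 of M and M' respectively. Then: (i) r_1(0) = r'_1(0), and M is CR at 0 if and only if M' is CR at 0; (ii) if M is CR at 0 then r_2(0) = r'_2(0), and M is of minimum degeneracy at 0 if and only if M' is of minimum degeneracy at 0; (iii) if M is CR at 0 then r_3(0) = r'_3(0), and M is of minimum orbit codimension at 0 if and only if M' is of minimum orbit codimension at 0. -/

import Mathlib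

open scoped BigOperators
open Complex

noncomputable section

abbrev Cn (N : ℕ) : Type := Fin N → ℂ
abbrev Rn (m : ℕ) : Type := Fin m → ℝ

/-- A local defining function for `M` near `p`. -/
def IsDefiningFun (N d : ℕ) (M : Set (Cn N)) (p : Cn N)
    (U : Set (Cn N)) (ρ : Cn N → Rn d) : Prop :=
  IsOpen U ∧ p ∈ U ∧ AnalyticOnNhd ℝ ρ U ∧
  (∀ z ∈ U, (z ∈ M ↔ ρ z = 0)) ∧
  ∀ z ∈ U, Function.Surjective (fderiv ℝ ρ z)

/-- `M` is a real-analytic submanifold of `ℂ^N` of (real) codimension `d`. -/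
def IsRASubmanifold (N d : ℕ) (M : Set (Cn N)) : Prop :=
  ∀ p ∈ M, ∃ U ρ, IsDefiningFun N d M p U ρ

/-- A real-analytic local parametrization of `M` (of codimension `d`) at `p`. -/
def IsLocalParam (N d : ℕ) (M : Set (Cn N)) (p : Cn N)
    (Ω : Set (Rn (2*N - d))) (Z : Rn (2*N - d) → Cn N) : Prop :=
  IsOpen Ω ∧ (0 : Rn (2*N-d)) ∈ Ω ∧ Z 0 = p ∧ AnalyticOnNhd ℝ Z Ω ∧
  Set.InjOn Z Ω ∧ (∀ x ∈ Ω, Function.Injective (fderiv ℝ Z x)) ∧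
  ∃ U : Set (Cn N), IsOpen U ∧ p ∈ U ∧ Z '' Ω = M ∩ U

/-- `H` is a `k`-equivalence between `(M,p)` and `(M',p')`. -/
def IsKEquivalence (N d : ℕ) (M M' : Set (Cn N)) (p p' : Cn N) (k : ℕ)
    (H : Cn N → Cn N) : Prop :=
  AnalyticAt ℂ H p ∧ H p = p' ∧ Function.Bijective (fderiv ℂ H p) ∧
  ∃ Ω Z, IsLocalParam N d M p Ω Z ∧
    ∀ U' ρ', IsDefiningFun N d M' p' U' ρ' →
      ∃ C ε : ℝ, 0 < ε ∧ ∀ x : Rn (2*N - d), ‖x‖ < ε →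
        ‖ρ' (H (Z x))‖ ≤ C * ‖x‖ ^ k

/-- `H` is a biholomorphic equivalence between `(M,p)` and `(M',p')`. -/
def IsBiholEquivalence (N : ℕ) (M M' : Set (Cn N)) (p p' : Cn N)
    (H : Cn N → Cn N) : Prop :=
  ∃ (U U' : Set (Cn N)) (Hinv : Cn N → Cn N),
    IsOpen U ∧ IsOpen U' ∧ p ∈ U ∧ p' ∈ U' ∧ H p = p' ∧
    AnalyticOnNhd ℂ H U ∧ AnalyticOnNhd ℂ Hinv U' ∧
    Set.BijOn H U U' ∧ (∀ z ∈ U, Hinv (H z) = z) ∧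
    H '' (M ∩ U) = M' ∩ U'

/-- `V` is a real-analytic subvariety of `M`: closed in `M` and locally the common zero
set of finitely many real-valued real-analytic functions. -/
def IsRASubvarietyOf (N : ℕ) (M V : Set (Cn N)) : Prop :=
  V ⊆ M ∧ (∃ C : Set (Cn N), IsClosed C ∧ V = M ∩ C) ∧
  ∀ p ∈ M, ∃ (U : Set (Cn N)) (m : ℕ) (f : Fin m → (Cn N → ℝ)),
    IsOpen U ∧ p ∈ U ∧ (∀ i, AnalyticOnNhd ℝ (f i) U) ∧
    V ∩ U = {z ∈ M ∩ U | ∀ i, f i z = 0}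

/-- The Wirtinger derivative `∂g/∂Z_i` (with respect to the underlying real structure)
of a complex-valued function at `z`. -/
def wirtD (N : ℕ) (g : Cn N → ℂ) (z : Cn N) (i : Fin N) : ℂ :=
  (1/2) * (fderiv ℝ g z (Pi.single i 1) - Complex.I * fderiv ℝ g z (Pi.single i Complex.I))

/-- The conjugate Wirtinger derivative `∂g/∂Z̄_i` of a complex-valued function at `z`. -/
def wirtDbar (N : ℕ) (g : Cn N → ℂ) (z : Cn N) (i : Fin N) : ℂ :=
  (1/2) * (fderiv ℝ g z (Pi.single i 1) + Complex.I * fderiv ℝ g z (Pi.single i Complex.I))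

/-- The complex gradient `ρ^j_Z(p,p̄)` of a real-valued component of a defining function. -/
def cxGrad (N : ℕ) (f : Cn N → ℝ) (p : Cn N) : Cn N :=
  fun i => wirtD N (fun z => (f z : ℂ)) p i

/-- The span of all complex gradients of components of local defining functions of `M` at `p`. -/
def gradSpace (N d : ℕ) (M : Set (Cn N)) (p : Cn N) : Submodule ℂ (Cn N) :=
  Submodule.span ℂ {v : Cn N | ∃ (U : Set (Cn N)) (ρ : Cn N → Rn d) (j : Fin d),
    IsDefiningFun N d M p U ρ ∧ v = cxGrad N (fun z => ρ z j) p}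

/-- The excess codimension `r₁(p)` of `M` at `p`. -/
def excessCodim (N d : ℕ) (M : Set (Cn N)) (p : Cn N) : ℕ :=
  d - Module.finrank ℂ (gradSpace N d M p)

/-- `M` is CR at `p` if the excess codimension is constant near `p` in `M`. -/
def IsCRAt (N d : ℕ) (M : Set (Cn N)) (p : Cn N) : Prop :=
  ∃ U : Set (Cn N), IsOpen U ∧ p ∈ U ∧
    ∀ q ∈ M ∩ U, excessCodim N d M q = excessCodim N d M p

/-- `a` (given on the open ambient neighborhood `W` of `p`) is (the coefficient vector of) a
germ at `p` of a `(0,1)` vector field `L = Σ aⱼ ∂/∂Z̄ⱼ` on `M`: it is real-analytic and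
annihilates every local defining function of `M` at points of `M`. -/
def IsCR01At (N d : ℕ) (M : Set (Cn N)) (p : Cn N) (W : Set (Cn N))
    (a : Cn N → Cn N) : Prop :=
  IsOpen W ∧ p ∈ W ∧ AnalyticOnNhd ℝ a W ∧
  ∀ (q : Cn N) (U : Set (Cn N)) (ρ : Cn N → Rn d), q ∈ M → IsDefiningFun N d M q U ρ →
    ∀ z ∈ M ∩ W ∩ U, ∀ j : Fin d,
      (∑ i, a z i * wirtDbar N (fun y => ((ρ y j : ℝ) : ℂ)) z i) = 0

/-- Application of the `(0,1)` vector field with coefficients `a` to a function `g`. -/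
def applyL (N : ℕ) (a : Cn N → Cn N) (g : Cn N → ℂ) : Cn N → ℂ :=
  fun z => ∑ i, a z i * wirtDbar N g z i

/-- Iterated application `L₁ ⋯ L_s g` of `(0,1)` vector fields. -/
def iterL (N : ℕ) : List (Cn N → Cn N) → (Cn N → ℂ) → (Cn N → ℂ)
  | [], g => g
  | a :: ls, g => applyL N a (iterL N ls g)

/-- The space `E_l(p)` spanned by `(𝓛₁⋯𝓛_s ρ^j_Z)(p,p̄)` for `s ≤ l`; `Espace` with no
bound is obtained by taking `l` arbitrary. -/
def EspaceUpTo (N d : ℕ) (M : Set (Cn N)) (p : Cn N) (l : ℕ) : Submodule ℂ (Cn N) :=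
  Submodule.span ℂ {v : Cn N | ∃ (U : Set (Cn N)) (ρ : Cn N → Rn d) (j : Fin d)
    (ls : List (Cn N → Cn N)), ls.length ≤ l ∧ IsDefiningFun N d M p U ρ ∧
    (∀ a ∈ ls, ∃ W, IsCR01At N d M p W a) ∧
    v = fun i => iterL N ls (fun z => wirtD N (fun y => ((ρ y j : ℝ) : ℂ)) z i) p}

/-- The space `E(p)`. -/
def Espace (N d : ℕ) (M : Set (Cn N)) (p : Cn N) : Submodule ℂ (Cn N) :=
  Submodule.span ℂ {v : Cn N | ∃ (U : Set (Cn N)) (ρ : Cn N → Rn d) (j : Fin d)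
    (ls : List (Cn N → Cn N)), IsDefiningFun N d M p U ρ ∧
    (∀ a ∈ ls, ∃ W, IsCR01At N d M p W a) ∧
    v = fun i => iterL N ls (fun z => wirtD N (fun y => ((ρ y j : ℝ) : ℂ)) z i) p}

/-- The degeneracy `r₂(p) = N - dim E(p)` of `M` at `p`. -/
def degeneracy (N d : ℕ) (M : Set (Cn N)) (p : Cn N) : ℕ :=
  N - Module.finrank ℂ (Espace N d M p)

/-- `M` is of minimum degeneracy at `p`. -/
def IsMinDegeneracyAt (N d : ℕ) (M : Set (Cn N)) (p : Cn N) : Prop :=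
  ∃ U : Set (Cn N), IsOpen U ∧ p ∈ U ∧
    ∀ q ∈ M ∩ U, degeneracy N d M p ≤ degeneracy N d M q

/-- `M` is finitely nondegenerate at `p`. -/
def IsFinNondegAt (N d : ℕ) (M : Set (Cn N)) (p : Cn N) : Prop :=
  Espace N d M p = ⊤

/-- A complex vector field `Σ bᵢ ∂/∂Zᵢ + Σ cᵢ ∂/∂Z̄ᵢ` on (an open set of) `ℂ^N`,
recorded by its pair of coefficient vectors. -/
abbrev CVF (N : ℕ) : Type := (Cn N → Cn N) × (Cn N → Cn N)

/-- Application of a complex vector field to a function. -/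
def applyVF (N : ℕ) (X : CVF N) (g : Cn N → ℂ) : Cn N → ℂ :=
  fun z => (∑ i, X.1 z i * wirtD N g z i) + ∑ i, X.2 z i * wirtDbar N g z i

/-- The commutator of two complex vector fields. -/
def bracketVF (N : ℕ) (X Y : CVF N) : CVF N :=
  (fun z i => applyVF N X (fun w => Y.1 w i) z - applyVF N Y (fun w => X.1 w i) z,
   fun z i => applyVF N X (fun w => Y.2 w i) z - applyVF N Y (fun w => X.2 w i) z)

/-- The vector fields generated (under iterated commutators) by germs at `p` of `(0,1)`
vector fields on `M` and their complex conjugates. -/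
inductive InGenLie (N d : ℕ) (M : Set (Cn N)) (p : Cn N) : CVF N → Prop
  | of01 (W : Set (Cn N)) (a : Cn N → Cn N) (h : IsCR01At N d M p W a) :
      InGenLie N d M p (fun _ _ => 0, a)
  | conj01 (W : Set (Cn N)) (a : Cn N → Cn N) (h : IsCR01At N d M p W a) :
      InGenLie N d M p (fun z i => (starRingEnd ℂ) (a z i), fun _ _ => 0)
  | bracket (X Y : CVF N) (hX : InGenLie N d M p X) (hY : InGenLie N d M p Y) :
      InGenLie N d M p (bracketVF N X Y)

/-- The space `𝔤_M(p)`, recorded inside `ℂ^N × ℂ^N` via the values of the coefficient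
vectors at `p` (the coordinates in the frame `∂/∂Zᵢ, ∂/∂Z̄ᵢ` of `ℂ ⊗ T_pℂ^N`). -/
def orbitSpace (N d : ℕ) (M : Set (Cn N)) (p : Cn N) : Submodule ℂ (Cn N × Cn N) :=
  Submodule.span ℂ {v : Cn N × Cn N | ∃ X : CVF N, InGenLie N d M p X ∧
    v = (X.1 p, X.2 p)}

/-- The orbit codimension `r₃(p) = dim_ℝ M - dim_ℂ 𝔤_M(p)` of `M` at `p`. -/
def orbitCodim (N d : ℕ) (M : Set (Cn N)) (p : Cn N) : ℕ :=
  (2 * N - d) - Module.finrank ℂ (orbitSpace N d M p)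

/-- `M` is of minimum orbit codimension at `p`. -/
def IsMinOrbitCodimAt (N d : ℕ) (M : Set (Cn N)) (p : Cn N) : Prop :=
  ∃ U : Set (Cn N), IsOpen U ∧ p ∈ U ∧
    ∀ q ∈ M ∩ U, orbitCodim N d M p ≤ orbitCodim N d M q

section VanishingOrder

open Filter Topology Asymptotics

variable {E F : Type*} [NormedAddCommGroup E] [NormedAddCommGroup F]

/-- `f` vanishes to order `k` at the origin. -/
def VanishesToOrder (k : ℕ) (f : E → F) : Prop := f =O[𝓝 0] fun x => ‖x‖ ^ k

theorem VanishesToOrder.mono {k j : ℕ} {f : E → F} (h : VanishesToOrder k f) (hj : j ≤ k) :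
    VanishesToOrder j f := by
  refine h.trans (IsBigO.of_bound 1 ?_)
  filter_upwards [Metric.ball_mem_nhds (0 : E) one_pos] with x hx
  have hx' : ‖x‖ ≤ 1 := by simpa using (mem_ball_zero_iff.1 hx).le
  rw [one_mul, norm_pow, norm_pow, norm_norm]
  exact pow_le_pow_of_le_one (norm_nonneg _) hx' hj

theorem VanishesToOrder.apply_zero {k : ℕ} {f : E → F} (h : VanishesToOrder k f) (hk : 0 < k) :
    f 0 = 0 := by
  obtain ⟨C, hC⟩ := IsBigO.bound h
  have := hC.self_of_nhds
  simpa [hk.ne'] using this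

theorem VanishesToOrder.add {k : ℕ} {f g : E → F} (hf : VanishesToOrder k f)
    (hg : VanishesToOrder k g) : VanishesToOrder k fun x => f x + g x := IsBigO.add hf hg

theorem VanishesToOrder.mul_sub_mul {k : ℕ} {f f' g g' : E → ℂ} (hf : ContinuousAt f 0)
    (hg' : ContinuousAt g' 0) (h1 : VanishesToOrder k fun x => f x - f' x)
    (h2 : VanishesToOrder k fun x => g x - g' x) :
    VanishesToOrder k fun x => f x * g x - f' x * g' x := by
  have e : (fun x => f x * g x - f' x * g' x)
      = fun x => f x * (g x - g' x) + (f x - f' x) * g' x := by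
    funext x; ring
  rw [e]
  refine IsBigO.add ?_ ?_
  · simpa using (hf.isBigO_one ℝ).mul h2
  · simpa using IsBigO.mul h1 (hg'.isBigO_one ℝ)

variable [NormedSpace ℝ F]

theorem VanishesToOrder.continuousLinearMap_comp {G : Type*} [NormedAddCommGroup G]
    [NormedSpace ℝ G] {k : ℕ} {f : E → F} (h : VanishesToOrder k f) (T : F →L[ℝ] G) :
    VanishesToOrder k fun x => T (f x) :=
  (T.isBigO_comp f (𝓝 0)).trans h

variable [NormedSpace ℝ E]

/-- An analytic map vanishing to order `k` has a power series expansion without terms of degree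
less than `k`. -/
theorem VanishesToOrder.exists_hasFPowerSeriesAt {k : ℕ} {f : E → F} (hf : AnalyticAt ℝ f 0)
    (h : VanishesToOrder k f) :
    ∃ q : FormalMultilinearSeries ℝ E F, HasFPowerSeriesAt f q 0 ∧ ∀ n < k, q n = 0 := by
  obtain ⟨p, r, hp⟩ := hf
  have hdiag : ∀ n < k, ∀ y : E, (p n fun _ => y) = 0 := by
    intro n
    induction n using Nat.strong_induction_on with
    | _ n ih =>
      intro hn
      refine IsBigO.continuousMultilinearMap_apply_eq_zero (p := p n) ?_
      have h1 := HasFPowerSeriesAt.isBigO_sub_partialSum_pow ⟨r, hp⟩ (n + 1)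
      have h2 : (fun y => f y - (p n fun _ => y)) =O[𝓝 0] fun y : E => ‖y‖ ^ (n + 1) := by
        refine h1.congr_left fun y => ?_
        rw [zero_add, FormalMultilinearSeries.partialSum, Finset.sum_range_succ,
          Finset.sum_eq_zero fun i hi => ih i (Finset.mem_range.1 hi)
            ((Finset.mem_range.1 hi).trans hn) y, zero_add]
      have h3 : f =O[𝓝 0] fun y : E => ‖y‖ ^ (n + 1) := h.mono hn
      simpa using h3.sub h2
  refine ⟨fun n => if n < k then 0 else p n, ⟨r, ?_⟩, fun n hn => if_pos hn⟩
  refine ⟨?_, hp.r_pos, fun {y} hy => ?_⟩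
  · refine hp.r_le.trans (ENNReal.le_of_forall_nnreal_lt fun s hs => ?_)
    obtain ⟨C, hC, hpC⟩ := p.norm_mul_pow_le_of_lt_radius hs
    refine FormalMultilinearSeries.le_radius_of_bound _ C fun n => ?_
    by_cases hn : n < k
    · rw [if_pos hn]; simpa using hC.le
    · rw [if_neg hn]; exact hpC n
  · convert hp.hasSum hy using 2 with n
    split_ifs with hn
    · simp [hdiag n hn y]
    · rfl

protected theorem VanishesToOrder.fderiv [CompleteSpace F] {k : ℕ} {f : E → F}
    (hf : AnalyticAt ℝ f 0) (h : VanishesToOrder (k + 1) f) : VanishesToOrder k (fderiv ℝ f) := by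
  obtain ⟨q, ⟨r, hq⟩, hq0⟩ := h.exists_hasFPowerSeriesAt hf
  have h1 := HasFPowerSeriesAt.isBigO_sub_partialSum_pow ⟨r, hq.fderiv⟩ k
  refine h1.congr_left fun y => ?_
  rw [zero_add, FormalMultilinearSeries.partialSum, Finset.sum_eq_zero, sub_zero]
  intro i hi
  have : q.derivSeries i = 0 := by
    have hc : q.changeOriginSeries 1 i = 0 := by
      unfold FormalMultilinearSeries.changeOriginSeries
      refine Finset.sum_eq_zero fun s _ => ?_
      unfold FormalMultilinearSeries.changeOriginSeriesTerm
      rw [hq0 (1 + i) (by have := Finset.mem_range.1 hi; omega)]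
      exact LinearIsometryEquiv.map_zero _
    unfold FormalMultilinearSeries.derivSeries
    ext v w
    simp [ContinuousLinearMap.compFormalMultilinearSeries_apply, hc]
  rw [this]; rfl

/-- An analytic map vanishing to infinite order vanishes near the origin. -/
theorem eventually_eq_zero_of_vanishesToOrder {f : E → F} (hf : AnalyticAt ℝ f 0)
    (h : ∀ k, VanishesToOrder k f) : ∀ᶠ x in 𝓝 0, f x = 0 := by
  obtain ⟨p, r, hp⟩ := hf
  have hdiag : ∀ n, ∀ y : E, (p n fun _ => y) = 0 := by
    intro n
    induction n using Nat.strong_induction_on with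
    | _ n ih =>
      refine IsBigO.continuousMultilinearMap_apply_eq_zero (p := p n) ?_
      have h1 := HasFPowerSeriesAt.isBigO_sub_partialSum_pow ⟨r, hp⟩ (n + 1)
      have h2 : (fun y => f y - (p n fun _ => y)) =O[𝓝 0] fun y : E => ‖y‖ ^ (n + 1) := by
        refine h1.congr_left fun y => ?_
        rw [zero_add, FormalMultilinearSeries.partialSum, Finset.sum_range_succ,
          Finset.sum_eq_zero fun i hi => ih i (Finset.mem_range.1 hi) y, zero_add]
      simpa using IsBigO.sub (h (n + 1)) h2
  filter_upwards [Metric.eball_mem_nhds (0 : E) hp.r_pos] with y hy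
  have := hp.hasSum (by simpa using hy : y ∈ Metric.eball (0 : E) r)
  simp only [hdiag, zero_add] at this
  exact this.unique hasSum_zero

end VanishingOrder

section WirtingerCalculus

open Filter Topology

variable {N : ℕ}

/-- The Wirtinger derivatives as functionals on real differentials; the left summand indexes
`∂/∂Z_i`, the right one `∂/∂Z̄_i`. -/
def pdFunctional (N : ℕ) : Fin N ⊕ Fin N → (Cn N →L[ℝ] ℂ) →L[ℝ] ℂ
  | .inl i => (1 / 2 : ℂ) • (ContinuousLinearMap.apply ℝ ℂ (Pi.single i 1 : Cn N)
      - Complex.I • ContinuousLinearMap.apply ℝ ℂ (Pi.single i Complex.I : Cn N))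
  | .inr i => (1 / 2 : ℂ) • (ContinuousLinearMap.apply ℝ ℂ (Pi.single i 1 : Cn N)
      + Complex.I • ContinuousLinearMap.apply ℝ ℂ (Pi.single i Complex.I : Cn N))

/-- All Wirtinger derivatives, indexed by `Fin N ⊕ Fin N`. -/
def pd (s : Fin N ⊕ Fin N) (g : Cn N → ℂ) (z : Cn N) : ℂ := pdFunctional N s (fderiv ℝ g z)

theorem pd_inl (i : Fin N) (g : Cn N → ℂ) (z : Cn N) : pd (.inl i) g z = wirtD N g z i := by
  simp [pd, pdFunctional, wirtD]

theorem pd_inr (i : Fin N) (g : Cn N → ℂ) (z : Cn N) : pd (.inr i) g z = wirtDbar N g z i := by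
  simp [pd, pdFunctional, wirtDbar, mul_add]

/-- The coordinate functions `Z_i` and `Z̄_i`. -/
def coordFn : Fin N ⊕ Fin N → Cn N → ℂ
  | .inl i, z => z i
  | .inr i, z => (starRingEnd ℂ) (z i)

/-- The components of a complex vector field. -/
def coef (X : CVF N) : Fin N ⊕ Fin N → Cn N → ℂ
  | .inl i, z => X.1 z i
  | .inr i, z => X.2 z i

theorem applyVF_eq_sum (X : CVF N) (g : Cn N → ℂ) (z : Cn N) :
    applyVF N X g z = ∑ s, coef X s z * pd s g z := by
  simp [applyVF, Fintype.sum_sum_type, coef, pd_inl, pd_inr]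

theorem coef_bracketVF (X Y : CVF N) (s : Fin N ⊕ Fin N) (z : Cn N) :
    coef (bracketVF N X Y) s z
      = applyVF N X (coef Y s) z - applyVF N Y (coef X s) z := by
  cases s <;> rfl

theorem applyL_eq_applyVF (a : Cn N → Cn N) (g : Cn N → ℂ) :
    applyL N a g = applyVF N (fun _ _ => 0, a) g := by
  funext z; simp [applyL, applyVF]

theorem pdFunctional_smul (s : Fin N ⊕ Fin N) (c : ℂ) (T : Cn N →L[ℝ] ℂ) :
    pdFunctional N s (c • T) = c * pdFunctional N s T := by
  cases s <;> simp [pdFunctional] <;> ring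

theorem apply_eq_sum_pdFunctional (T : Cn N →L[ℝ] ℂ) (v : Cn N) :
    T v = ∑ s, pdFunctional N s T * coordFn s v := by
  have hv : v = ∑ i, ((v i).re • (Pi.single i 1 : Cn N)
      + (v i).im • (Pi.single i Complex.I : Cn N)) := by
    funext j
    simp only [Finset.sum_apply, Pi.add_apply, Pi.smul_apply, Pi.single_apply]
    rw [Finset.sum_eq_single j]
    · simp
    · intro i _ hi; simp [Ne.symm hi]
    · simp
  conv_lhs => rw [hv]
  rw [map_sum, Fintype.sum_sum_type, ← Finset.sum_add_distrib]
  refine Finset.sum_congr rfl fun i _ => ?_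
  rw [map_add, map_smul, map_smul]
  simp only [pdFunctional, coordFn]
  obtain ⟨x, y, h⟩ : ∃ x y : ℝ, v i = x + y * Complex.I :=
    ⟨(v i).re, (v i).im, (re_add_im _).symm⟩
  simp only [h, _root_.smul_apply, _root_.sub_apply,
    _root_.add_apply, ContinuousLinearMap.apply_apply, smul_eq_mul, real_smul,
    map_add, map_mul, conj_ofReal, conj_I]
  simp only [add_re, ofReal_re, mul_re, I_re, I_im, ofReal_im, add_im, mul_im]
  push_cast
  ring_nf
  simp only [I_sq]
  ring

theorem fderiv_apply_eq_sum_pd (g : Cn N → ℂ) (z v : Cn N) :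
    fderiv ℝ g z v = ∑ s, pd s g z * coordFn s v :=
  apply_eq_sum_pdFunctional _ v

theorem pd_congr {g g' : Cn N → ℂ} {z : Cn N} (h : g =ᶠ[𝓝 z] g') (s : Fin N ⊕ Fin N) :
    pd s g z = pd s g' z := by
  rw [pd, pd, h.fderiv_eq]

theorem pd_add {g g' : Cn N → ℂ} {z : Cn N} (hg : AnalyticAt ℝ g z) (hg' : AnalyticAt ℝ g' z)
    (s : Fin N ⊕ Fin N) : pd s (fun y => g y + g' y) z = pd s g z + pd s g' z := by
  rw [pd, fderiv_fun_add hg.differentiableAt hg'.differentiableAt, map_add]; rfl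

theorem pd_sub {g g' : Cn N → ℂ} {z : Cn N} (hg : AnalyticAt ℝ g z) (hg' : AnalyticAt ℝ g' z)
    (s : Fin N ⊕ Fin N) : pd s (fun y => g y - g' y) z = pd s g z - pd s g' z := by
  rw [pd, fderiv_fun_sub hg.differentiableAt hg'.differentiableAt, map_sub]; rfl

theorem pd_mul {g g' : Cn N → ℂ} {z : Cn N} (hg : AnalyticAt ℝ g z) (hg' : AnalyticAt ℝ g' z)
    (s : Fin N ⊕ Fin N) :
    pd s (fun y => g y * g' y) z = pd s g z * g' z + g z * pd s g' z := by
  rw [pd, fderiv_fun_mul hg.differentiableAt hg'.differentiableAt, map_add, pdFunctional_smul,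
    pdFunctional_smul, add_comm, mul_comm (g' z)]; rfl

theorem pd_sum {ι : Type*} {g : ι → Cn N → ℂ} {z : Cn N} {t : Finset ι}
    (hg : ∀ i ∈ t, AnalyticAt ℝ (g i) z) (s : Fin N ⊕ Fin N) :
    pd s (fun y => ∑ i ∈ t, g i y) z = ∑ i ∈ t, pd s (g i) z := by
  rw [pd, fderiv_fun_sum fun i hi => (hg i hi).differentiableAt, map_sum]; rfl

theorem pd_zero (s : Fin N ⊕ Fin N) (z : Cn N) : pd s (fun _ : Cn N => (0 : ℂ)) z = 0 := by
  simp [pd]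

theorem analyticAt_pd {g : Cn N → ℂ} {z : Cn N} (hg : AnalyticAt ℝ g z) (s : Fin N ⊕ Fin N) :
    AnalyticAt ℝ (pd s g) z :=
  ((pdFunctional N s).analyticAt _).comp hg.fderiv

theorem pd_comm {g : Cn N → ℂ} {z : Cn N} (hg : AnalyticAt ℝ g z) (s t : Fin N ⊕ Fin N) :
    pd s (pd t g) z = pd t (pd s g) z := by
  have hsym : IsSymmSndFDerivAt ℝ g z := hg.contDiffAt.isSymmSndFDerivAt_of_omega
  have hd : ∀ t, fderiv ℝ (pd t g) z = (pdFunctional N t).comp (fderiv ℝ (fderiv ℝ g) z) :=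
    fun t => ((pdFunctional N t).hasFDerivAt.comp z hg.fderiv.differentiableAt.hasFDerivAt).fderiv
  rw [pd, pd, hd, hd]
  cases s <;> cases t <;>
    simp only [pdFunctional, _root_.smul_apply, _root_.sub_apply,
      _root_.add_apply, ContinuousLinearMap.apply_apply, smul_eq_mul,
      ContinuousLinearMap.comp_apply] <;>
    (rename_i i j
     rw [hsym (Pi.single i 1) (Pi.single j 1), hsym (Pi.single i 1) (Pi.single j Complex.I),
      hsym (Pi.single i Complex.I) (Pi.single j 1),
      hsym (Pi.single i Complex.I) (Pi.single j Complex.I)]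
     ring)

theorem VanishesToOrder.pd_sub {k : ℕ} {g g' : Cn N → ℂ} (hg : AnalyticAt ℝ g 0)
    (hg' : AnalyticAt ℝ g' 0) (h : VanishesToOrder (k + 1) fun z => g z - g' z)
    (s : Fin N ⊕ Fin N) : VanishesToOrder k fun z => pd s g z - pd s g' z := by
  refine ((h.fderiv (hg.sub hg')).continuousLinearMap_comp (pdFunctional N s)).congr' ?_ .rfl
  filter_upwards [hg.eventually_analyticAt, hg'.eventually_analyticAt] with z h1 h2
  exact _root_.pd_sub h1 h2 s

theorem analyticAt_coordFn (s : Fin N ⊕ Fin N) (z : Cn N) :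
    AnalyticAt ℝ (coordFn s : Cn N → ℂ) z := by
  cases s with
  | inl i => exact (ContinuousLinearMap.proj (R := ℝ) (φ := fun _ : Fin N => ℂ) i).analyticAt z
  | inr i =>
    exact (conjCLE.toContinuousLinearMap.comp
      (ContinuousLinearMap.proj (R := ℝ) (φ := fun _ : Fin N => ℂ) i)).analyticAt z

/-- The chain rule for Wirtinger derivatives. -/
theorem pd_comp {H : Cn N → Cn N} {g : Cn N → ℂ} {z : Cn N} (hg : AnalyticAt ℝ g (H z))
    (hH : AnalyticAt ℝ H z) (t : Fin N ⊕ Fin N) :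
    pd t (fun y => g (H y)) z = ∑ s, pd s g (H z) * pd t (fun y => coordFn s (H y)) z := by
  have hc : ∀ s : Fin N ⊕ Fin N, ∀ v, fderiv ℝ (fun y => coordFn s (H y)) z v
      = coordFn s (fderiv ℝ H z v) := by
    intro s v
    cases s with
    | inl i =>
      have := ((ContinuousLinearMap.proj (R := ℝ) (φ := fun _ : Fin N => ℂ) i).hasFDerivAt.comp z
        hH.differentiableAt.hasFDerivAt).fderiv
      exact congrArg (fun T => T v) this
    | inr i =>
      have := ((conjCLE.toContinuousLinearMap.comp
        (ContinuousLinearMap.proj (R := ℝ) (φ := fun _ : Fin N => ℂ) i)).hasFDerivAt.comp z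
        hH.differentiableAt.hasFDerivAt).fderiv
      exact congrArg (fun T => T v) this
  have : fderiv ℝ (fun y => g (H y)) z
      = ∑ s, pd s g (H z) • fderiv ℝ (fun y => coordFn s (H y)) z := by
    ext v
    have h1 := (hg.differentiableAt.hasFDerivAt.comp z hH.differentiableAt.hasFDerivAt).fderiv
    change fderiv ℝ (g ∘ H) z v = _
    rw [h1, ContinuousLinearMap.comp_apply, fderiv_apply_eq_sum_pd]
    simp only [_root_.sum_apply, _root_.smul_apply, smul_eq_mul, hc]
  rw [pd, this, map_sum]
  exact Finset.sum_congr rfl fun s _ => pdFunctional_smul _ _ _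

theorem analyticAt_applyVF {X : CVF N} {g : Cn N → ℂ} {z : Cn N}
    (hX : ∀ s, AnalyticAt ℝ (coef X s) z) (hg : AnalyticAt ℝ g z) :
    AnalyticAt ℝ (applyVF N X g) z := by
  have : applyVF N X g = fun z => ∑ s, coef X s z * pd s g z := funext (applyVF_eq_sum X g)
  rw [this]
  exact Finset.analyticAt_fun_sum _ fun s _ => (hX s).mul (analyticAt_pd hg s)

theorem analyticAt_coef_bracketVF {X Y : CVF N} {z : Cn N}
    (hX : ∀ s, AnalyticAt ℝ (coef X s) z) (hY : ∀ s, AnalyticAt ℝ (coef Y s) z)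
    (s : Fin N ⊕ Fin N) : AnalyticAt ℝ (coef (bracketVF N X Y) s) z := by
  have : coef (bracketVF N X Y) s
      = fun z => applyVF N X (coef Y s) z - applyVF N Y (coef X s) z :=
    funext (coef_bracketVF X Y s)
  rw [this]
  exact (analyticAt_applyVF hX (hY s)).sub (analyticAt_applyVF hY (hX s))

theorem applyVF_congr {X : CVF N} {g g' : Cn N → ℂ} {z : Cn N} (h : g =ᶠ[𝓝 z] g') :
    applyVF N X g z = applyVF N X g' z := by
  simp only [applyVF_eq_sum, pd_congr h]

theorem applyVF_mul {X : CVF N} {g g' : Cn N → ℂ} {z : Cn N} (hg : AnalyticAt ℝ g z)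
    (hg' : AnalyticAt ℝ g' z) :
    applyVF N X (fun y => g y * g' y) z
      = applyVF N X g z * g' z + g z * applyVF N X g' z := by
  simp only [applyVF_eq_sum, pd_mul hg hg', Finset.sum_mul, Finset.mul_sum,
    ← Finset.sum_add_distrib]
  exact Finset.sum_congr rfl fun s _ => by ring

theorem applyVF_sum {ι : Type*} {X : CVF N} {g : ι → Cn N → ℂ} {z : Cn N} {t : Finset ι}
    (hg : ∀ i ∈ t, AnalyticAt ℝ (g i) z) :
    applyVF N X (fun y => ∑ i ∈ t, g i y) z = ∑ i ∈ t, applyVF N X (g i) z := by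
  simp only [applyVF_eq_sum, pd_sum hg, Finset.mul_sum]
  exact Finset.sum_comm

/-- The commutator acts on functions as the commutator of derivations. -/
theorem applyVF_bracketVF {X Y : CVF N} {g : Cn N → ℂ} {z : Cn N}
    (hX : ∀ s, AnalyticAt ℝ (coef X s) z) (hY : ∀ s, AnalyticAt ℝ (coef Y s) z)
    (hg : AnalyticAt ℝ g z) :
    applyVF N (bracketVF N X Y) g z
      = applyVF N X (applyVF N Y g) z - applyVF N Y (applyVF N X g) z := by
  have key : ∀ X Y : CVF N, (∀ s, AnalyticAt ℝ (coef Y s) z) → applyVF N X (applyVF N Y g) z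
      = ∑ s, applyVF N X (coef Y s) z * pd s g z
        + ∑ s, ∑ t, coef Y s z * (coef X t z * pd t (pd s g) z) := by
    intro X Y hY
    have : applyVF N Y g = fun z => ∑ s, coef Y s z * pd s g z := funext (applyVF_eq_sum Y g)
    rw [this, applyVF_sum (g := fun s z => coef Y s z * pd s g z)
      fun s _ => (hY s).mul (analyticAt_pd hg s), ← Finset.sum_add_distrib]
    refine Finset.sum_congr rfl fun s _ => ?_
    rw [applyVF_mul (hY s) (analyticAt_pd hg s), applyVF_eq_sum X (pd s g), Finset.mul_sum]
  rw [key X Y hY, key Y X hX, applyVF_eq_sum]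
  have hswap : ∑ s, ∑ t, coef Y s z * (coef X t z * pd t (pd s g) z)
      = ∑ s, ∑ t, coef X s z * (coef Y t z * pd t (pd s g) z) := by
    rw [Finset.sum_comm]
    refine Finset.sum_congr rfl fun s _ => Finset.sum_congr rfl fun t _ => ?_
    rw [pd_comm hg s t]; ring
  rw [hswap, add_sub_add_right_eq_sub, ← Finset.sum_sub_distrib]
  exact Finset.sum_congr rfl fun s _ => by rw [coef_bracketVF, sub_mul]

theorem wirtD_ofReal_eq_conj (f : Cn N → ℝ) (z : Cn N) (hf : AnalyticAt ℝ f z) (i : Fin N) :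
    wirtD N (fun y => (f y : ℂ)) z i
      = (starRingEnd ℂ) (wirtDbar N (fun y => (f y : ℂ)) z i) := by
  have : fderiv ℝ (fun y => (f y : ℂ)) z = ofRealCLM.comp (fderiv ℝ f z) :=
    (ofRealCLM.hasFDerivAt.comp z hf.differentiableAt.hasFDerivAt).fderiv
  have h2 : (starRingEnd ℂ) 2 = 2 := map_ofNat _ 2
  simp [wirtD, wirtDbar, this, h2]
  ring

end WirtingerCalculus

section Multipliers

open Filter Topology

variable {N d : ℕ} {M : Set (Cn N)} {p q : Cn N} {U : Set (Cn N)} {ρ : Cn N → Rn d}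

/-- The `j`-th component of `ρ` as a complex-valued function. -/
def cpt (ρ : Cn N → Rn d) (j : Fin d) : Cn N → ℂ := fun y => ((ρ y j : ℝ) : ℂ)

theorem analyticAt_cpt {z : Cn N} (h : AnalyticAt ℝ ρ z) (j : Fin d) :
    AnalyticAt ℝ (cpt ρ j) z := by
  have h1 : AnalyticAt ℝ (fun y => ρ y j) z :=
    (ContinuousLinearMap.proj (R := ℝ) (φ := fun _ : Fin d => ℝ) j).analyticAt _ |>.comp h
  exact (ofRealCLM.analyticAt _).comp h1

theorem IsDefiningFun.of_mem (h : IsDefiningFun N d M p U ρ) (hq : q ∈ U) :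
    IsDefiningFun N d M q U ρ := ⟨h.1, hq, h.2.2.1, h.2.2.2.1, h.2.2.2.2⟩

theorem exists_real_multiplier (h : IsDefiningFun N d M q U ρ) (hq : q ∈ M) {g : Cn N → ℝ}
    (hg : AnalyticAt ℝ g q) (h0 : ∀ᶠ z in 𝓝 q, z ∈ M → g z = 0) :
    ∃ c : Fin d → ℝ, ∀ v, fderiv ℝ g q v = ∑ j, c j * fderiv ℝ ρ q v j := by
  obtain ⟨hU, hqU, ha, hM, hs⟩ := h
  have hρq : ρ q = 0 := (hM q hqU).1 hq
  have hgq : g q = 0 := h0.self_of_nhds hq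
  have hext : IsLocalExtrOn g {x | ρ x = ρ q} q := by
    refine Or.inl ?_
    rw [IsMinFilter, eventually_nhdsWithin_iff]
    filter_upwards [h0, hU.mem_nhds hqU] with z hz hzU hz'
    rw [hgq, hz ((hM z hzU).2 (by rw [← hρq]; exact hz'))]
  obtain ⟨Λ, Λ₀, hne, hsum⟩ := hext.exists_linear_map_of_hasStrictFDerivAt
    (ha q hqU).hasStrictFDerivAt hg.hasStrictFDerivAt
  have hΛ0 : Λ₀ ≠ 0 := by
    rintro rfl
    refine hne (Prod.ext (LinearMap.ext fun y => ?_) rfl)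
    obtain ⟨x, rfl⟩ := hs q hqU y
    simpa using hsum x
  refine ⟨fun j => -Λ₀⁻¹ * Λ (Pi.single j 1), fun v => ?_⟩
  have e : Λ (fderiv ℝ ρ q v) = ∑ j, fderiv ℝ ρ q v j * Λ (Pi.single j 1) := by
    conv_lhs => rw [← Finset.univ_sum_single (fderiv ℝ ρ q v)]
    rw [map_sum]
    refine Finset.sum_congr rfl fun j _ => ?_
    rw [← smul_eq_mul, ← map_smul]
    congr 1
    rw [← Pi.single_smul]; simp
  have h1 := hsum v
  rw [e, smul_eq_mul] at h1
  have : fderiv ℝ g q v = -Λ₀⁻¹ * ∑ j, fderiv ℝ ρ q v j * Λ (Pi.single j 1) := by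
    field_simp; linarith
  rw [this, Finset.mul_sum]
  exact Finset.sum_congr rfl fun j _ => by ring

theorem fderiv_cpt {z : Cn N} (h : AnalyticAt ℝ ρ z) (j : Fin d) (v : Cn N) :
    fderiv ℝ (cpt ρ j) z v = ((fderiv ℝ ρ z v j : ℝ) : ℂ) := by
  have h1 : HasFDerivAt (cpt ρ j) (ofRealCLM.comp
      ((ContinuousLinearMap.proj (R := ℝ) (φ := fun _ : Fin d => ℝ) j).comp (fderiv ℝ ρ z))) z :=
    ofRealCLM.hasFDerivAt.comp z ((ContinuousLinearMap.proj (R := ℝ)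
      (φ := fun _ : Fin d => ℝ) j).hasFDerivAt.comp z h.differentiableAt.hasFDerivAt)
  rw [h1.fderiv]; rfl

/-- The differential at `q ∈ M` of a function vanishing on `M` is a combination of the
differentials of the components of a defining function. -/
theorem exists_multiplier (h : IsDefiningFun N d M q U ρ) (hq : q ∈ M) {g : Cn N → ℂ}
    (hg : AnalyticAt ℝ g q) (h0 : ∀ᶠ z in 𝓝 q, z ∈ M → g z = 0) :
    ∃ c : Fin d → ℂ, (∀ s, pd s g q = ∑ j, c j * pd s (cpt ρ j) q) ∧
      ∀ v, fderiv ℝ g q v = ∑ j, c j * (fderiv ℝ ρ q v j : ℝ) := by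
  have hre : AnalyticAt ℝ (fun z => (g z).re) q := (reCLM.analyticAt _).comp hg
  have him : AnalyticAt ℝ (fun z => (g z).im) q := (imCLM.analyticAt _).comp hg
  have ere : fderiv ℝ (fun z => (g z).re) q = reCLM.comp (fderiv ℝ g q) :=
    (reCLM.hasFDerivAt.comp q hg.differentiableAt.hasFDerivAt).fderiv
  have eim : fderiv ℝ (fun z => (g z).im) q = imCLM.comp (fderiv ℝ g q) :=
    (imCLM.hasFDerivAt.comp q hg.differentiableAt.hasFDerivAt).fderiv
  obtain ⟨a, ha⟩ := exists_real_multiplier h hq hre (h0.mono fun z hz hm => by simp [hz hm])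
  obtain ⟨b, hb⟩ := exists_real_multiplier h hq him (h0.mono fun z hz hm => by simp [hz hm])
  have key : ∀ v, fderiv ℝ g q v
      = ∑ j, ((a j : ℂ) + b j * I) * ((fderiv ℝ ρ q v j : ℝ) : ℂ) := fun v => by
    have h1 := ha v
    have h2 := hb v
    rw [ere] at h1
    rw [eim] at h2
    apply Complex.ext
    · simpa using h1
    · simpa using h2
  refine ⟨fun j => (a j : ℂ) + b j * I, fun s => ?_, key⟩
  have hT : fderiv ℝ g q = ∑ j, ((a j : ℂ) + b j * I) • fderiv ℝ (cpt ρ j) q := by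
    ext1 v
    rw [key v]
    simp [fderiv_cpt (h.2.2.1 q h.2.1)]
  simp only [pd, hT, map_sum, pdFunctional_smul]

/-- The action of a vector field, given by its coefficients, on functions. -/
def applyC (c : Fin N ⊕ Fin N → Cn N → ℂ) (g : Cn N → ℂ) : Cn N → ℂ :=
  fun z => ∑ s, c s z * pd s g z

/-- The vector field with coefficients `c` annihilates every defining function of `M`
along `M`, near `q`. -/
def TangentNear (N d : ℕ) (M : Set (Cn N)) (q : Cn N) (c : Fin N ⊕ Fin N → Cn N → ℂ) : Prop :=
  ∃ (U : Set (Cn N)) (ρ : Cn N → Rn d), IsDefiningFun N d M q U ρ ∧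
    ∀ᶠ z in 𝓝 q, z ∈ M → ∀ j, applyC c (cpt ρ j) z = 0

theorem applyC_eq_zero_of_tangent (h : IsDefiningFun N d M q U ρ) (hq : q ∈ M)
    {c : Fin N ⊕ Fin N → Cn N → ℂ} (hc : ∀ j, applyC c (cpt ρ j) q = 0) {g : Cn N → ℂ}
    (hg : AnalyticAt ℝ g q) (h0 : ∀ᶠ z in 𝓝 q, z ∈ M → g z = 0) : applyC c g q = 0 := by
  obtain ⟨m, hm, -⟩ := exists_multiplier h hq hg h0
  simp only [applyC, hm, Finset.mul_sum] at hc ⊢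
  rw [Finset.sum_comm]
  refine Finset.sum_eq_zero fun j _ => ?_
  rw [← mul_zero (m j), ← hc j, Finset.mul_sum]
  exact Finset.sum_congr rfl fun s _ => by ring

theorem TangentNear.applyC_eq_zero {c : Fin N ⊕ Fin N → Cn N → ℂ} (hc : TangentNear N d M q c)
    {g : Cn N → ℂ} (hg : AnalyticAt ℝ g q) (h0 : ∀ᶠ z in 𝓝 q, z ∈ M → g z = 0) :
    ∀ᶠ z in 𝓝 q, z ∈ M → applyC c g z = 0 := by
  obtain ⟨U, ρ, hρ, ht⟩ := hc
  filter_upwards [ht, hg.eventually_analyticAt, h0.eventually_nhds, hρ.1.mem_nhds hρ.2.1]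
    with z h1 h2 h3 hzU hzM
  exact applyC_eq_zero_of_tangent (hρ.of_mem hzU) hzM (h1 hzM) h2 h3

theorem analyticAt_applyC {c : Fin N ⊕ Fin N → Cn N → ℂ} {g : Cn N → ℂ}
    (hc : ∀ s, AnalyticAt ℝ (c s) q) (hg : AnalyticAt ℝ g q) : AnalyticAt ℝ (applyC c g) q :=
  Finset.analyticAt_fun_sum _ fun s _ => (hc s).mul (analyticAt_pd hg s)

theorem TangentNear.applyC_eq {c : Fin N ⊕ Fin N → Cn N → ℂ} (hc : TangentNear N d M q c)
    {g g' : Cn N → ℂ} (hg : AnalyticAt ℝ g q) (hg' : AnalyticAt ℝ g' q)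
    (h0 : ∀ᶠ z in 𝓝 q, z ∈ M → g z = g' z) :
    ∀ᶠ z in 𝓝 q, z ∈ M → applyC c g z = applyC c g' z := by
  filter_upwards [hc.applyC_eq_zero (hg.fun_sub hg')
    (h0.mono fun z h hz => sub_eq_zero.2 (h hz)), hg.eventually_analyticAt,
    hg'.eventually_analyticAt] with z h h1 h2 hz
  have := h hz
  simp only [applyC, pd_sub h1 h2, mul_sub, Finset.sum_sub_distrib] at this
  exact sub_eq_zero.1 this

theorem TangentNear.applyC_cpt (hU : IsDefiningFun N d M q U ρ)
    {c : Fin N ⊕ Fin N → Cn N → ℂ} (hc : TangentNear N d M q c) :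
    ∀ᶠ z in 𝓝 q, z ∈ M → ∀ j, applyC c (cpt ρ j) z = 0 := by
  have : ∀ j, ∀ᶠ z in 𝓝 q, z ∈ M → applyC c (cpt ρ j) z = 0 := fun j =>
    hc.applyC_eq_zero (analyticAt_cpt (hU.2.2.1 q hU.2.1) j)
      (by filter_upwards [hU.1.mem_nhds hU.2.1] with z hz hm
          simp [cpt, (hU.2.2.2.1 z hz).1 hm])
  filter_upwards [eventually_all.2 this] with z hz hm j using hz j hm

end Multipliers

section Generation

open Filter Topology

variable {N d : ℕ} {M : Set (Cn N)} {q : Cn N} {ι κ : Type*}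

/-- Tuples of functions which, along `M` near `q`, are combinations of the members of a family
`F` with coefficients analytic at `q`. -/
inductive GenOver (M : Set (Cn N)) (q : Cn N) (F : ι → κ → Cn N → ℂ) : (κ → Cn N → ℂ) → Prop
  | mem (i : ι) : GenOver M q F (F i)
  | zero : GenOver M q F fun _ _ => 0
  | add {g g' : κ → Cn N → ℂ} (hg : GenOver M q F g) (hg' : GenOver M q F g') :
      GenOver M q F fun k z => g k z + g' k z
  | smul {c : Cn N → ℂ} {g : κ → Cn N → ℂ} (hc : AnalyticAt ℝ c q) (hg : GenOver M q F g) :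
      GenOver M q F fun k z => c z * g k z
  | congr {g g' : κ → Cn N → ℂ} (hg : GenOver M q F g) (hg' : ∀ k, AnalyticAt ℝ (g' k) q)
      (h : ∀ᶠ z in 𝓝 q, z ∈ M → ∀ k, g k z = g' k z) : GenOver M q F g'

variable {F : ι → κ → Cn N → ℂ}

theorem GenOver.analyticAt (hF : ∀ i k, AnalyticAt ℝ (F i k) q) {g : κ → Cn N → ℂ}
    (hg : GenOver M q F g) (k : κ) : AnalyticAt ℝ (g k) q := by
  induction hg with
  | mem i => exact hF i k
  | zero => exact analyticAt_const
  | add _ _ h1 h2 => exact h1.fun_add h2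
  | smul hc _ h => exact hc.fun_mul h
  | congr _ hg' _ _ => exact hg' k

theorem GenOver.value_mem (hq : q ∈ M) {g : κ → Cn N → ℂ} (hg : GenOver M q F g) :
    (fun k => g k q) ∈ Submodule.span ℂ (Set.range fun i => fun k => F i k q) := by
  induction hg with
  | mem i => exact Submodule.subset_span ⟨i, rfl⟩
  | zero => exact Submodule.zero_mem _
  | add _ _ h1 h2 => exact Submodule.add_mem _ h1 h2
  | @smul c g hc _ h => exact Submodule.smul_mem _ (c q) h
  | congr _ _ h h1 =>
    have : ∀ k, _ := h.self_of_nhds hq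
    simpa only [← this] using h1

theorem GenOver.sum {σ : Type*} (t : Finset σ) {g : σ → κ → Cn N → ℂ}
    (hg : ∀ i ∈ t, GenOver M q F (g i)) : GenOver M q F fun k z => ∑ i ∈ t, g i k z := by
  classical
  induction t using Finset.induction_on with
  | empty => simpa using GenOver.zero
  | insert a t ha ih =>
    simp only [Finset.sum_insert ha]
    exact (hg a (Finset.mem_insert_self a t)).add
      (ih fun i hi => hg i (Finset.mem_insert_of_mem hi))

/-- A first order operator along `M` which maps a family into its span preserves the span. -/
theorem GenOver.derivation [Fintype κ] (hF : ∀ i k, AnalyticAt ℝ (F i k) q)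
    {c : Fin N ⊕ Fin N → Cn N → ℂ} (hc : ∀ s, AnalyticAt ℝ (c s) q) (ht : TangentNear N d M q c)
    {B : κ → κ → Cn N → ℂ} (hB : ∀ k l, AnalyticAt ℝ (B k l) q)
    (hD : ∀ i, GenOver M q F fun k z => applyC c (F i k) z - ∑ l, F i l z * B k l z)
    {g : κ → Cn N → ℂ} (hg : GenOver M q F g) :
    GenOver M q F fun k z => applyC c (g k) z - ∑ l, g l z * B k l z := by
  have han : ∀ g : κ → Cn N → ℂ, (∀ k, AnalyticAt ℝ (g k) q) → ∀ k,
      AnalyticAt ℝ (fun z => applyC c (g k) z - ∑ l, g l z * B k l z) q := fun g hg k =>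
    (analyticAt_applyC hc (hg k)).fun_sub
      (Finset.analyticAt_fun_sum _ fun l _ => (hg l).fun_mul (hB k l))
  induction hg with
  | mem i => exact hD i
  | zero => simpa [applyC, pd_zero] using GenOver.zero
  | @add g g' hg hg' h1 h2 =>
    have a1 := hg.analyticAt hF
    have a2 := hg'.analyticAt hF
    refine (h1.add h2).congr (han _ fun k => (a1 k).fun_add (a2 k)) ?_
    have e1 : ∀ᶠ z in 𝓝 q, ∀ k, AnalyticAt ℝ (g k) z :=
      eventually_all.2 fun k => (a1 k).eventually_analyticAt
    have e2 : ∀ᶠ z in 𝓝 q, ∀ k, AnalyticAt ℝ (g' k) z :=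
      eventually_all.2 fun k => (a2 k).eventually_analyticAt
    filter_upwards [e1, e2] with z z1 z2 _ k
    simp only [applyC, pd_add (z1 k) (z2 k), add_mul, mul_add, Finset.sum_add_distrib]
    ring
  | @smul b g hb hg h1 =>
    have a1 := hg.analyticAt hF
    refine (((hg.smul (analyticAt_applyC hc hb))).add (h1.smul hb)).congr
      (han _ fun k => hb.fun_mul (a1 k)) ?_
    have e1 : ∀ᶠ z in 𝓝 q, ∀ k, AnalyticAt ℝ (g k) z :=
      eventually_all.2 fun k => (a1 k).eventually_analyticAt
    filter_upwards [e1, hb.eventually_analyticAt] with z z1 z2 _ k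
    simp only [applyC, pd_mul z2 (z1 k), mul_sub, Finset.mul_sum, Finset.sum_mul, mul_add,
      Finset.sum_add_distrib]
    rw [← add_sub_assoc]
    congr 1
    · congr 1 <;> exact Finset.sum_congr rfl fun _ _ => by ring
    · exact Finset.sum_congr rfl fun _ _ => by ring
  | @congr g g' hg hg' h h1 =>
    have a1 := hg.analyticAt hF
    refine h1.congr (han _ hg') ?_
    have e1 : ∀ᶠ z in 𝓝 q, ∀ k, z ∈ M → applyC c (g k) z = applyC c (g' k) z :=
      eventually_all.2 fun k => ht.applyC_eq (a1 k) (hg' k) (h.mono fun z hz hm => hz hm k)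
    filter_upwards [e1, h] with z z1 z2 hm k
    simp only [z1 k hm, z2 hm]

/-- The coefficients of the commutator of two vector fields. -/
def commC (c c' : Fin N ⊕ Fin N → Cn N → ℂ) : Fin N ⊕ Fin N → Cn N → ℂ :=
  fun s z => applyC c (c' s) z - applyC c' (c s) z

theorem TangentNear.of_genOver {F : ι → Fin N ⊕ Fin N → Cn N → ℂ} {U : Set (Cn N)}
    {ρ : Cn N → Rn d} (hρ : IsDefiningFun N d M q U ρ) (hF : ∀ i, TangentNear N d M q (F i))
    {c : Fin N ⊕ Fin N → Cn N → ℂ} (hc : GenOver M q F c) : TangentNear N d M q c := by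
  refine ⟨U, ρ, hρ, ?_⟩
  induction hc with
  | mem i => exact (hF i).applyC_cpt hρ
  | zero => simp [applyC]
  | add _ _ h1 h2 =>
    filter_upwards [h1, h2] with z z1 z2 hm j
    have := congrArg₂ (· + ·) (z1 hm j) (z2 hm j)
    simpa [applyC, add_mul, Finset.sum_add_distrib] using this
  | @smul b _ _ _ h1 =>
    filter_upwards [h1] with z z1 hm j
    have := congrArg (b z * ·) (z1 hm j)
    simpa only [applyC, Finset.mul_sum, mul_assoc, mul_zero] using this
  | congr _ _ h h1 =>
    filter_upwards [h1, h] with z z1 z2 hm j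
    have := z1 hm j
    simpa only [applyC, z2 hm] using this

theorem GenOver.commC_of_mem {F : ι → Fin N ⊕ Fin N → Cn N → ℂ}
    (hF : ∀ i s, AnalyticAt ℝ (F i s) q) {c : Fin N ⊕ Fin N → Cn N → ℂ}
    (hc : ∀ s, AnalyticAt ℝ (c s) q) (ht : TangentNear N d M q c)
    (hD : ∀ i, GenOver M q F (commC c (F i))) {g : Fin N ⊕ Fin N → Cn N → ℂ}
    (hg : GenOver M q F g) : GenOver M q F (commC c g) :=
  GenOver.derivation hF hc ht (B := fun k l => pd l (c k))
    (fun k l => analyticAt_pd (hc k) l) hD hg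

/-- If a family of fields tangent to `M` is closed under commutators, so is its span. -/
theorem GenOver.commC {F : ι → Fin N ⊕ Fin N → Cn N → ℂ} {U : Set (Cn N)}
    {ρ : Cn N → Rn d} (hρ : IsDefiningFun N d M q U ρ)
    (hF : ∀ i s, AnalyticAt ℝ (F i s) q) (hT : ∀ i, TangentNear N d M q (F i))
    (hbr : ∀ i i', GenOver M q F (commC (F i) (F i'))) {g g' : Fin N ⊕ Fin N → Cn N → ℂ}
    (hg : GenOver M q F g) (hg' : GenOver M q F g') : GenOver M q F (_root_.commC g g') := by
  refine GenOver.commC_of_mem hF (hg.analyticAt hF) (.of_genOver hρ hT hg) (fun i => ?_) hg'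
  have h1 := GenOver.commC_of_mem hF (hF i) (hT i) (hbr i) hg
  have h2 : GenOver M q F fun s z => (-1 : ℂ) * _root_.commC (F i) g s z :=
    h1.smul analyticAt_const
  convert h2 using 3
  simp [_root_.commC]

end Generation

section Families

open Filter Topology

variable {N d : ℕ} {M : Set (Cn N)} {q : Cn N} {U : Set (Cn N)} {ρ : Cn N → Rn d}
  {frame : Fin N → Cn N → Cn N}

/-- The vector field `∑ a_i ∂/∂Z̄_i`. -/
def antiField (a : Cn N → Cn N) : CVF N := (fun _ _ => 0, a)

/-- The vector field `∑ ā_i ∂/∂Z_i`. -/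
def holoField (a : Cn N → Cn N) : CVF N := (fun z i => (starRingEnd ℂ) (a z i), fun _ _ => 0)

/-- Formal iterated commutators of the members of a frame and their conjugates. -/
inductive LieWord (N : ℕ)
  | anti (i : Fin N) : LieWord N
  | holo (i : Fin N) : LieWord N
  | br (s t : LieWord N) : LieWord N

/-- The vector field represented by a formal iterated commutator. -/
def LieWord.eval (frame : Fin N → Cn N → Cn N) : LieWord N → CVF N
  | .anti i => antiField (frame i)
  | .holo i => holoField (frame i)
  | .br s t => bracketVF N (s.eval frame) (t.eval frame)

/-- The complex gradients of the components of `ρ`. -/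
def gradFamily (ρ : Cn N → Rn d) (j : Fin d) (i : Fin N) : Cn N → ℂ :=
  fun z => wirtD N (cpt ρ j) z i

/-- The complex gradients of the components of `ρ`, differentiated along members of a frame. -/
def iterFamily (ρ : Cn N → Rn d) (frame : Fin N → Cn N → Cn N) (t : List (Fin N) × Fin d)
    (i : Fin N) : Cn N → ℂ :=
  iterL N (t.1.map frame) (gradFamily ρ t.2 i)

/-- The coefficients of the iterated commutators of the members of a frame. -/
def lieFamily (frame : Fin N → Cn N → Cn N) (t : LieWord N) : Fin N ⊕ Fin N → Cn N → ℂ :=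
  coef (t.eval frame)

theorem applyVF_eq_applyC (X : CVF N) (g : Cn N → ℂ) : applyVF N X g = applyC (coef X) g :=
  funext (applyVF_eq_sum X g)

theorem coef_bracketVF_eq_commC (X Y : CVF N) :
    coef (bracketVF N X Y) = commC (coef X) (coef Y) := by
  funext s z
  rw [coef_bracketVF, applyVF_eq_applyC, applyVF_eq_applyC]; rfl

theorem applyL_eq_applyC (a : Cn N → Cn N) (g : Cn N → ℂ) :
    applyL N a g = applyC (coef (antiField a)) g := by
  rw [applyL_eq_applyVF, applyVF_eq_applyC]; rfl

theorem analyticAt_coef_antiField {a : Cn N → Cn N} (ha : AnalyticAt ℝ a q)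
    (s : Fin N ⊕ Fin N) : AnalyticAt ℝ (coef (antiField a) s) q := by
  cases s with
  | inl i => exact analyticAt_const
  | inr i =>
    exact (ContinuousLinearMap.proj (R := ℝ) (φ := fun _ : Fin N => ℂ) i).analyticAt _ |>.comp ha

theorem analyticAt_coef_holoField {a : Cn N → Cn N} (ha : AnalyticAt ℝ a q)
    (s : Fin N ⊕ Fin N) : AnalyticAt ℝ (coef (holoField a) s) q := by
  cases s with
  | inr i => exact analyticAt_const
  | inl i => exact (analyticAt_coordFn (.inr i) (a q)).comp ha

theorem applyC_coef_holoField (hρ : AnalyticAt ℝ ρ q) (a : Cn N → Cn N) (j : Fin d) :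
    applyC (coef (holoField a)) (cpt ρ j) q
      = (starRingEnd ℂ) (applyC (coef (antiField a)) (cpt ρ j) q) := by
  have h1 : AnalyticAt ℝ (fun y => ρ y j) q :=
    (ContinuousLinearMap.proj (R := ℝ) (φ := fun _ : Fin d => ℝ) j).analyticAt _ |>.comp hρ
  simp only [applyC, Fintype.sum_sum_type, coef, antiField, holoField, pd_inl, pd_inr, map_sum,
    map_mul, zero_mul, Finset.sum_const_zero, add_zero, zero_add]
  refine Finset.sum_congr rfl fun i _ => ?_
  exact congrArg (_ * ·) (wirtD_ofReal_eq_conj (fun y => ρ y j) q h1 i)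

theorem IsCR01At.analyticAt {W : Set (Cn N)} {a : Cn N → Cn N} (h : IsCR01At N d M q W a) :
    AnalyticAt ℝ a q := h.2.2.1 q h.2.1

theorem IsCR01At.tangent_anti {W : Set (Cn N)} {a : Cn N → Cn N} (h : IsCR01At N d M q W a)
    (hq : q ∈ M) (hρ : IsDefiningFun N d M q U ρ) :
    ∀ᶠ z in 𝓝 q, z ∈ M → ∀ j, applyC (coef (antiField a)) (cpt ρ j) z = 0 := by
  filter_upwards [h.1.mem_nhds h.2.1, hρ.1.mem_nhds hρ.2.1] with z hW hU hm j
  rw [← applyL_eq_applyC]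
  exact h.2.2.2 q U ρ hq hρ z ⟨⟨hm, hW⟩, hU⟩ j

theorem IsCR01At.tangent_holo {W : Set (Cn N)} {a : Cn N → Cn N} (h : IsCR01At N d M q W a)
    (hq : q ∈ M) (hρ : IsDefiningFun N d M q U ρ) :
    ∀ᶠ z in 𝓝 q, z ∈ M → ∀ j, applyC (coef (holoField a)) (cpt ρ j) z = 0 := by
  filter_upwards [h.tangent_anti hq hρ, (hρ.2.2.1 q hρ.2.1).eventually_analyticAt]
    with z h1 h2 hm j
  rw [applyC_coef_holoField h2, h1 hm j, map_zero]

theorem InGenLie.analyticAt_coef {X : CVF N} (hX : InGenLie N d M q X) (s : Fin N ⊕ Fin N) :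
    AnalyticAt ℝ (coef X s) q := by
  induction hX generalizing s with
  | of01 W a h => exact analyticAt_coef_antiField h.analyticAt s
  | conj01 W a h => exact analyticAt_coef_holoField h.analyticAt s
  | bracket X Y _ _ h1 h2 => exact analyticAt_coef_bracketVF h1 h2 s

/-- A commutator of fields tangent to `M` is tangent to `M`. -/
theorem TangentNear.commC (hρ : IsDefiningFun N d M q U ρ) {c c' : Fin N ⊕ Fin N → Cn N → ℂ}
    (hc : ∀ s, AnalyticAt ℝ (c s) q) (hc' : ∀ s, AnalyticAt ℝ (c' s) q)
    (h : TangentNear N d M q c) (h' : TangentNear N d M q c') :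
    TangentNear N d M q (_root_.commC c c') := by
  refine ⟨U, ρ, hρ, ?_⟩
  have hr : ∀ j, AnalyticAt ℝ (cpt ρ j) q := analyticAt_cpt (hρ.2.2.1 q hρ.2.1)
  have e1 : ∀ᶠ z in 𝓝 q, ∀ j, z ∈ M → applyC c (applyC c' (cpt ρ j)) z = 0 :=
    eventually_all.2 fun j => h.applyC_eq_zero (analyticAt_applyC hc' (hr j))
      ((h'.applyC_cpt hρ).mono fun z hz hm => hz hm j)
  have e2 : ∀ᶠ z in 𝓝 q, ∀ j, z ∈ M → applyC c' (applyC c (cpt ρ j)) z = 0 :=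
    eventually_all.2 fun j => h'.applyC_eq_zero (analyticAt_applyC hc (hr j))
      ((h.applyC_cpt hρ).mono fun z hz hm => hz hm j)
  have e3 : ∀ᶠ z in 𝓝 q, ∀ s, AnalyticAt ℝ (c s) z :=
    eventually_all.2 fun s => (hc s).eventually_analyticAt
  have e4 : ∀ᶠ z in 𝓝 q, ∀ s, AnalyticAt ℝ (c' s) z :=
    eventually_all.2 fun s => (hc' s).eventually_analyticAt
  have e5 : ∀ᶠ z in 𝓝 q, ∀ j, AnalyticAt ℝ (cpt ρ j) z :=
    eventually_all.2 fun j => (hr j).eventually_analyticAt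
  filter_upwards [e1, e2, e3, e4, e5] with z z1 z2 z3 z4 z5 hm j
  let X : CVF N := (fun z i => c (.inl i) z, fun z i => c (.inr i) z)
  let Y : CVF N := (fun z i => c' (.inl i) z, fun z i => c' (.inr i) z)
  have hX : coef X = c := by funext s; cases s <;> rfl
  have hY : coef Y = c' := by funext s; cases s <;> rfl
  have := applyVF_bracketVF (X := X) (Y := Y) (by rwa [hX]) (by rwa [hY]) (z5 j)
  rw [applyVF_eq_applyC, coef_bracketVF_eq_commC, applyVF_eq_applyC, applyVF_eq_applyC,
    applyVF_eq_applyC, applyVF_eq_applyC, hX, hY] at this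
  rw [this, z1 j hm, z2 j hm, sub_zero]

theorem InGenLie.tangentNear (hq : q ∈ M) (hρ : IsDefiningFun N d M q U ρ) {X : CVF N}
    (hX : InGenLie N d M q X) : TangentNear N d M q (coef X) := by
  induction hX with
  | of01 W a h => exact ⟨U, ρ, hρ, h.tangent_anti hq hρ⟩
  | conj01 W a h => exact ⟨U, ρ, hρ, h.tangent_holo hq hρ⟩
  | bracket X Y hX hY h1 h2 =>
    rw [coef_bracketVF_eq_commC]
    exact h1.commC hρ hX.analyticAt_coef hY.analyticAt_coef h2

/-- The members of `frame` are `(0,1)` fields near `q` generating all of them along `M`. -/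
def IsCRFrameAt (N d : ℕ) (M : Set (Cn N)) (q : Cn N) (frame : Fin N → Cn N → Cn N) : Prop :=
  (∀ l, ∃ W, IsCR01At N d M q W (frame l)) ∧
  ∀ W a, IsCR01At N d M q W a → ∃ b : Fin N → Cn N → ℂ, (∀ l, AnalyticAt ℝ (b l) q) ∧
    ∀ᶠ z in 𝓝 q, z ∈ M → ∀ i, a z i = ∑ l, b l z * frame l z i

theorem LieWord.inGenLie (h : ∀ l, ∃ W, IsCR01At N d M q W (frame l)) (t : LieWord N) :
    InGenLie N d M q (t.eval frame) := by
  induction t with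
  | anti i => obtain ⟨W, hW⟩ := h i; exact .of01 W _ hW
  | holo i => obtain ⟨W, hW⟩ := h i; exact .conj01 W _ hW
  | br s t h1 h2 => exact .bracket _ _ h1 h2

theorem analyticAt_lieFamily (h : ∀ l, AnalyticAt ℝ (frame l) q) (t : LieWord N)
    (s : Fin N ⊕ Fin N) : AnalyticAt ℝ (lieFamily frame t s) q := by
  induction t generalizing s with
  | anti i => exact analyticAt_coef_antiField (h i) s
  | holo i => exact analyticAt_coef_holoField (h i) s
  | br t t' h1 h2 => exact analyticAt_coef_bracketVF h1 h2 s

theorem analyticAt_gradFamily (hρ : AnalyticAt ℝ ρ q) (j : Fin d) (i : Fin N) :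
    AnalyticAt ℝ (gradFamily ρ j i) q := by
  have := analyticAt_pd (analyticAt_cpt hρ j) (.inl i)
  rwa [funext (pd_inl i _)] at this

theorem iterFamily_cons (l : Fin N) (w : List (Fin N)) (j : Fin d) (i : Fin N) :
    iterFamily ρ frame (l :: w, j) i
      = applyC (coef (antiField (frame l))) (iterFamily ρ frame (w, j) i) :=
  applyL_eq_applyC _ _

theorem analyticAt_iterFamily (hρ : AnalyticAt ℝ ρ q) (h : ∀ l, AnalyticAt ℝ (frame l) q)
    (t : List (Fin N) × Fin d) (i : Fin N) : AnalyticAt ℝ (iterFamily ρ frame t i) q := by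
  obtain ⟨w, j⟩ := t
  induction w with
  | nil => exact analyticAt_gradFamily hρ j i
  | cons l w ih =>
    rw [iterFamily_cons]
    exact analyticAt_applyC (analyticAt_coef_antiField (h l)) ih

theorem span_gradFamily_le (hρ : IsDefiningFun N d M q U ρ) :
    Submodule.span ℂ (Set.range fun j => fun i => gradFamily ρ j i q) ≤ gradSpace N d M q := by
  refine Submodule.span_mono ?_
  rintro _ ⟨j, rfl⟩
  exact ⟨U, ρ, j, hρ, rfl⟩

theorem span_iterFamily_le (hρ : IsDefiningFun N d M q U ρ)
    (h : ∀ l, ∃ W, IsCR01At N d M q W (frame l)) :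
    Submodule.span ℂ (Set.range fun t => fun i => iterFamily ρ frame t i q)
      ≤ Espace N d M q := by
  refine Submodule.span_mono ?_
  rintro _ ⟨⟨w, j⟩, rfl⟩
  refine ⟨U, ρ, j, w.map frame, hρ, fun a ha => ?_, rfl⟩
  obtain ⟨l, _, rfl⟩ := List.mem_map.1 ha
  exact h l

/-- The space `𝔤_M(q)` in terms of coefficients indexed by `∂/∂Z_i` and `∂/∂Z̄_i`. -/
def orbitSpan (N d : ℕ) (M : Set (Cn N)) (q : Cn N) : Submodule ℂ (Fin N ⊕ Fin N → ℂ) :=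
  Submodule.span ℂ {v | ∃ X : CVF N, InGenLie N d M q X ∧ v = fun s => coef X s q}

theorem finrank_orbitSpace :
    Module.finrank ℂ (orbitSpace N d M q) = Module.finrank ℂ (orbitSpan N d M q) := by
  let e := LinearEquiv.sumArrowLequivProdArrow (Fin N) (Fin N) ℂ ℂ
  have : orbitSpace N d M q = (orbitSpan N d M q).map (e : _ →ₗ[ℂ] _) := by
    rw [orbitSpan, Submodule.map_span, orbitSpace]
    congr 1
    ext v
    constructor
    · rintro ⟨X, hX, rfl⟩
      exact ⟨_, ⟨X, hX, rfl⟩, rfl⟩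
    · rintro ⟨_, ⟨X, hX, rfl⟩, rfl⟩
      exact ⟨X, hX, rfl⟩
  rw [this]
  exact LinearEquiv.finrank_map_eq e _

theorem span_lieFamily_le (h : ∀ l, ∃ W, IsCR01At N d M q W (frame l)) :
    Submodule.span ℂ (Set.range fun t => fun s => lieFamily frame t s q)
      ≤ orbitSpan N d M q := by
  refine Submodule.span_mono ?_
  rintro _ ⟨t, rfl⟩
  exact ⟨t.eval frame, t.inGenLie h, rfl⟩

/-- Vectors `R l` on which the differential of `ρ` near `q` is the identity. -/
def IsConstRightInverse (ρ : Cn N → Rn d) (q : Cn N) (R : Fin d → Cn N) : Prop :=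
  ∀ᶠ z in 𝓝 q, ∀ l, fderiv ℝ ρ z (R l) = Pi.single l 1

theorem genOver_gradFamily (hρ : IsDefiningFun N d M q U ρ) {R : Fin d → Cn N}
    (hR : IsConstRightInverse ρ q R) {U' : Set (Cn N)} {ρ' : Cn N → Rn d}
    (hρ' : IsDefiningFun N d M q U' ρ') (j : Fin d) :
    GenOver M q (gradFamily ρ) (gradFamily ρ' j) := by
  have hρ'a := hρ'.2.2.1 q hρ'.2.1
  have hc : AnalyticAt ℝ (cpt ρ' j) q := analyticAt_cpt hρ'a j
  have hA : ∀ l, AnalyticAt ℝ (fun z => fderiv ℝ (cpt ρ' j) z (R l)) q := fun l =>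
    ((ContinuousLinearMap.apply ℝ ℂ (R l)).analyticAt _).comp hc.fderiv
  refine (GenOver.sum Finset.univ fun l _ => (GenOver.mem l).smul (hA l)).congr
    (fun i => analyticAt_gradFamily hρ'a j i) ?_
  filter_upwards [hρ.1.mem_nhds hρ.2.1, hρ'.1.mem_nhds hρ'.2.1, hR] with z hU hU' hRz hm i
  have hz : ∀ᶠ y in 𝓝 z, y ∈ M → cpt ρ' j y = 0 := by
    filter_upwards [hρ'.1.mem_nhds hU'] with y hy hym
    simp [cpt, (hρ'.2.2.2.1 y hy).1 hym]
  obtain ⟨c, h1, h2⟩ := exists_multiplier (hρ.of_mem hU) hm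
    (analyticAt_cpt (hρ'.2.2.1 z hU') j) hz
  have h3 : ∀ l, fderiv ℝ (cpt ρ' j) z (R l) = c l := fun l => by
    rw [h2, hRz l]; simp [Pi.single_apply, apply_ite]
  simp only [h3, gradFamily, ← pd_inl, h1]

theorem gradSpace_le (hq : q ∈ M) (hρ : IsDefiningFun N d M q U ρ) {R : Fin d → Cn N}
    (hR : IsConstRightInverse ρ q R) :
    gradSpace N d M q ≤ Submodule.span ℂ (Set.range fun j => fun i => gradFamily ρ j i q) := by
  refine Submodule.span_le.2 ?_
  rintro _ ⟨U', ρ', j, hρ', rfl⟩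
  exact (genOver_gradFamily hρ hR hρ' j).value_mem hq

theorem genOver_antiField (hf : IsCRFrameAt N d M q frame) {W : Set (Cn N)} {a : Cn N → Cn N}
    (ha : IsCR01At N d M q W a) : GenOver M q (lieFamily frame) (coef (antiField a)) := by
  obtain ⟨b, hb, h⟩ := hf.2 W a ha
  refine (GenOver.sum Finset.univ fun l _ => (GenOver.mem (LieWord.anti l)).smul (hb l)).congr
    (analyticAt_coef_antiField ha.analyticAt) ?_
  filter_upwards [h] with z hz hm s
  cases s with
  | inl i => simp [lieFamily, LieWord.eval, antiField, coef]
  | inr i => simp [lieFamily, LieWord.eval, antiField, coef, hz hm i]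

theorem genOver_holoField (hf : IsCRFrameAt N d M q frame) {W : Set (Cn N)} {a : Cn N → Cn N}
    (ha : IsCR01At N d M q W a) : GenOver M q (lieFamily frame) (coef (holoField a)) := by
  obtain ⟨b, hb, h⟩ := hf.2 W a ha
  have hb' : ∀ l, AnalyticAt ℝ (fun z => (starRingEnd ℂ) (b l z)) q := fun l =>
    (conjCLE.toContinuousLinearMap.analyticAt _).comp (hb l)
  refine (GenOver.sum Finset.univ fun l _ => (GenOver.mem (LieWord.holo l)).smul (hb' l)).congr
    (analyticAt_coef_holoField ha.analyticAt) ?_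
  filter_upwards [h] with z hz hm s
  cases s with
  | inr i => simp [lieFamily, LieWord.eval, holoField, coef]
  | inl i => simp [lieFamily, LieWord.eval, holoField, coef, hz hm i]

theorem orbitSpan_le (hq : q ∈ M) (hρ : IsDefiningFun N d M q U ρ)
    (hf : IsCRFrameAt N d M q frame) :
    orbitSpan N d M q ≤ Submodule.span ℂ (Set.range fun t => fun s => lieFamily frame t s q) := by
  have hfa : ∀ l, AnalyticAt ℝ (frame l) q := fun l => (hf.1 l).choose_spec.analyticAt
  refine Submodule.span_le.2 ?_
  rintro _ ⟨X, hX, rfl⟩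
  refine GenOver.value_mem hq ?_
  induction hX with
  | of01 W a h => exact genOver_antiField hf h
  | conj01 W a h => exact genOver_holoField hf h
  | bracket X Y _ _ h1 h2 =>
    rw [coef_bracketVF_eq_commC]
    refine GenOver.commC hρ (analyticAt_lieFamily hfa)
      (fun t => (t.inGenLie hf.1).tangentNear hq hρ) (fun t t' => ?_) h1 h2
    have := GenOver.mem (M := M) (q := q) (F := lieFamily frame) (LieWord.br t t')
    rwa [lieFamily, LieWord.eval, coef_bracketVF_eq_commC] at this

theorem Espace_le (hq : q ∈ M) (hρ : IsDefiningFun N d M q U ρ) {R : Fin d → Cn N}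
    (hR : IsConstRightInverse ρ q R) (hf : IsCRFrameAt N d M q frame) :
    Espace N d M q
      ≤ Submodule.span ℂ (Set.range fun t => fun i => iterFamily ρ frame t i q) := by
  have hfa : ∀ l, AnalyticAt ℝ (frame l) q := fun l => (hf.1 l).choose_spec.analyticAt
  have han := analyticAt_iterFamily (hρ.2.2.1 q hρ.2.1) hfa
  refine Submodule.span_le.2 ?_
  rintro _ ⟨U', ρ', j, ls, hρ', hls, rfl⟩
  refine GenOver.value_mem (F := iterFamily ρ frame) hq
    (g := fun i => iterL N ls (gradFamily ρ' j i)) ?_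
  induction ls with
  | nil =>
    have : ∀ g, GenOver M q (gradFamily ρ) g → GenOver M q (iterFamily ρ frame) g := by
      intro g hg
      induction hg with
      | mem i => exact GenOver.mem (F := iterFamily ρ frame) ([], i)
      | zero => exact .zero
      | add _ _ h1 h2 => exact h1.add h2
      | smul hc _ h => exact h.smul hc
      | congr _ hg' h h1 => exact h1.congr hg' h
    exact this _ (genOver_gradFamily hρ hR hρ' j)
  | cons a ls ih =>
    obtain ⟨W, hW⟩ := hls a (by simp)
    have ih := ih fun b hb => hls b (by simp [hb])
    have hca := analyticAt_coef_antiField hW.analyticAt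
    obtain ⟨b, hb, h⟩ := hf.2 W a hW
    have := GenOver.derivation (B := fun _ _ _ => 0) han hca
      ⟨U, ρ, hρ, hW.tangent_anti hq hρ⟩ (fun _ _ => analyticAt_const) (fun t => ?_) ih
    · simpa [iterL, applyL_eq_applyC] using this
    · refine (GenOver.sum Finset.univ fun l _ =>
        (GenOver.mem (F := iterFamily ρ frame) (l :: t.1, t.2)).smul (hb l)).congr
        (fun k => by simpa using! analyticAt_applyC hca (han t k)) ?_
      filter_upwards [h] with z hz hm i
      simp only [iterFamily_cons, applyC, mul_zero, Finset.sum_const_zero, sub_zero,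
        Finset.mul_sum]
      rw [Finset.sum_comm]
      refine Finset.sum_congr rfl fun s _ => ?_
      cases s with
      | inl k => simp [coef, antiField]
      | inr k => simp [coef, antiField, hz hm k, Finset.sum_mul, mul_assoc]

end Families

section Frames

open Filter Topology Matrix
open scoped ComplexOrder

variable {N d : ℕ} {M : Set (Cn N)} {q : Cn N} {U : Set (Cn N)} {ρ : Cn N → Rn d}

theorem exists_reflexive_generalized_inverse {m n : Type*} [Fintype m] [Fintype n] [DecidableEq m]
    [DecidableEq n] (B : Matrix m n ℂ) :
    ∃ S : Matrix n m ℂ, B * S * B = B ∧ S * B * S = S := by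
  obtain ⟨g, hg⟩ := (Matrix.toLin' B).rangeRestrict.exists_rightInverse_of_surjective
    (LinearMap.range_rangeRestrict _)
  obtain ⟨g', hg'⟩ := LinearMap.exists_extend g
  have h1 : Matrix.toLin' B ∘ₗ g' ∘ₗ Matrix.toLin' B = Matrix.toLin' B := by
    refine LinearMap.ext fun v => ?_
    have e1 : g' (Matrix.toLin' B v) = g ((Matrix.toLin' B).rangeRestrict v) :=
      LinearMap.congr_fun hg' ((Matrix.toLin' B).rangeRestrict v)
    have e2 := LinearMap.congr_fun hg ((Matrix.toLin' B).rangeRestrict v)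
    have e3 := congrArg Subtype.val e2
    simp only [LinearMap.comp_apply] at e3 ⊢
    rw [e1]; exact e3
  set S := LinearMap.toMatrix' g' with hS
  have h2 : B * S * B = B := by
    have := congrArg LinearMap.toMatrix' h1
    rw [LinearMap.toMatrix'_comp, LinearMap.toMatrix'_comp, LinearMap.toMatrix'_toLin'] at this
    rw [Matrix.mul_assoc]; exact this
  refine ⟨S * B * S, ?_, ?_⟩
  · calc B * (S * B * S) * B = (B * S * B) * S * B := by simp only [Matrix.mul_assoc]
      _ = B := by rw [h2, h2]
  · calc S * B * S * B * (S * B * S) = S * (B * S * B) * (S * B * S) := by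
          simp only [Matrix.mul_assoc]
      _ = S * B * (S * B * S) := by rw [h2]
      _ = S * (B * S * B) * S := by simp only [Matrix.mul_assoc]
      _ = S * B * S := by rw [h2]

section MatrixAlgebra

variable {m n : Type*} [Fintype m] [Fintype n] [DecidableEq n] {B₀ B : Matrix m n ℂ}
  {S : Matrix n m ℂ}

/-- An interpolation between `S * B` and the identity. -/
def interp (S : Matrix n m ℂ) (B₀ B : Matrix m n ℂ) : Matrix n n ℂ := S * B + (1 - S * B₀)

/-- A matrix whose columns span the kernel of `B` when `B` is close to `B₀` and has the same
rank. -/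
def kernelMatrix (S : Matrix n m ℂ) (B₀ B : Matrix m n ℂ) : Matrix n n ℂ :=
  (interp S B₀ B).adjugate * (1 - S * B₀)

theorem interp_self {m n : Type*} [Fintype m] [DecidableEq n] (S : Matrix n m ℂ)
    (B₀ : Matrix m n ℂ) : interp S B₀ B₀ = 1 := by
  simp [interp]

theorem kernelMatrix_mulVec {v : n → ℂ} (hv : B *ᵥ v = 0) :
    kernelMatrix S B₀ B *ᵥ v = (interp S B₀ B).det • v := by
  have : (1 - S * B₀) *ᵥ v = interp S B₀ B *ᵥ v := by
    rw [interp, Matrix.add_mulVec, ← Matrix.mulVec_mulVec, hv, Matrix.mulVec_zero, zero_add]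
  rw [kernelMatrix, ← Matrix.mulVec_mulVec, this, Matrix.mulVec_mulVec, Matrix.adjugate_mul,
    Matrix.smul_mulVec, Matrix.one_mulVec]

theorem mul_kernelMatrix (h1 : B₀ * S * B₀ = B₀) (h2 : S * B₀ * S = S)
    (hdet : (interp S B₀ B).det ≠ 0) (hr : B.rank ≤ B₀.rank) : B * kernelMatrix S B₀ B = 0 := by
  have hE : (S * B₀) * (S * B₀) = S * B₀ := by
    rw [← Matrix.mul_assoc, h2]
  have hET : (S * B₀) * interp S B₀ B = S * B := by
    rw [interp, Matrix.mul_add, Matrix.mul_sub, hE, mul_one, sub_self, add_zero,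
      ← Matrix.mul_assoc, h2]
  have hSB : S * B * kernelMatrix S B₀ B = 0 := by
    rw [← hET, Matrix.mul_assoc, kernelMatrix, ← Matrix.mul_assoc (interp S B₀ B),
      Matrix.mul_adjugate, Matrix.smul_mul, Matrix.one_mul, Matrix.mul_smul, Matrix.mul_sub, hE,
      mul_one, sub_self, smul_zero]
  have hrank : B.rank ≤ (S * B).rank := by
    have e1 : (S * B).rank = (S * B₀).rank := by
      rw [← hET, Matrix.rank_mul_eq_left_of_isUnit_det _ _ (isUnit_iff_ne_zero.2 hdet)]
    have e2 : B₀.rank ≤ (S * B₀).rank := by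
      conv_lhs => rw [← h1, Matrix.mul_assoc]
      exact Matrix.rank_mul_le_right _ _
    exact hr.trans (e2.trans e1.ge)
  have hker : LinearMap.ker B.mulVecLin = LinearMap.ker (S * B).mulVecLin := by
    refine Submodule.eq_of_le_of_finrank_le (fun v hv => ?_) ?_
    · rw [LinearMap.mem_ker, Matrix.mulVecLin_apply] at hv ⊢
      rw [← Matrix.mulVec_mulVec, hv, Matrix.mulVec_zero]
    · have a1 := LinearMap.finrank_range_add_finrank_ker B.mulVecLin
      have a2 := LinearMap.finrank_range_add_finrank_ker (S * B).mulVecLin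
      simp only [Matrix.rank] at hrank
      omega
  ext i j
  have hcol : (kernelMatrix S B₀ B).col j ∈ LinearMap.ker (S * B).mulVecLin := by
    rw [LinearMap.mem_ker, Matrix.mulVecLin_apply]
    funext k
    exact congrFun (congrFun hSB k) j
  rw [← hker, LinearMap.mem_ker, Matrix.mulVecLin_apply] at hcol
  exact congrFun hcol i

end MatrixAlgebra

/-- The matrix of antiholomorphic derivatives of the components of `ρ`. -/
def dbarMatrix (ρ : Cn N → Rn d) (z : Cn N) : Matrix (Fin d) (Fin N) ℂ :=
  Matrix.of fun j i => wirtDbar N (cpt ρ j) z i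

/-- The candidate frame of `(0,1)` vector fields on `{ρ = 0}`. -/
def crFrame (S : Matrix (Fin N) (Fin d) ℂ) (B₀ : Matrix (Fin d) (Fin N) ℂ) (ρ : Cn N → Rn d)
    (l : Fin N) : Cn N → Cn N :=
  fun z i => kernelMatrix S B₀ (dbarMatrix ρ z) i l

theorem finrank_span_gradFamily (hρ : AnalyticAt ℝ ρ q) :
    Module.finrank ℂ (Submodule.span ℂ (Set.range fun j => fun i => gradFamily ρ j i q))
      = (dbarMatrix ρ q).rank := by
  have h1 : ∀ j, AnalyticAt ℝ (fun y => ρ y j) q := fun j =>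
    (ContinuousLinearMap.proj (R := ℝ) (φ := fun _ : Fin d => ℝ) j).analyticAt _ |>.comp hρ
  rw [← Matrix.rank_conjTranspose, ← Matrix.rank_transpose, Matrix.rank_eq_finrank_span_row]
  have : (fun j => fun i => gradFamily ρ j i q) = (dbarMatrix ρ q)ᴴᵀ.row := by
    funext j i
    exact wirtD_ofReal_eq_conj (fun y => ρ y j) q (h1 j) i
  rw [this]

theorem finrank_gradSpace (hq : q ∈ M) (hρ : IsDefiningFun N d M q U ρ) {R : Fin d → Cn N}
    (hR : IsConstRightInverse ρ q R) :
    Module.finrank ℂ (gradSpace N d M q) = (dbarMatrix ρ q).rank := by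
  rw [← finrank_span_gradFamily (hρ.2.2.1 q hρ.2.1),
    le_antisymm (gradSpace_le hq hρ hR) (span_gradFamily_le hρ)]

theorem analyticAt_det {n : Type*} [Fintype n] [DecidableEq n] {T : Cn N → Matrix n n ℂ}
    (hT : ∀ i j, AnalyticAt ℝ (fun z => T z i j) q) : AnalyticAt ℝ (fun z => (T z).det) q := by
  simp only [Matrix.det_apply']
  exact Finset.analyticAt_fun_sum _ fun σ _ => analyticAt_const.fun_mul
    (Finset.analyticAt_fun_prod _ fun i _ => hT _ _)

theorem analyticAt_adjugate {n : Type*} [Fintype n] [DecidableEq n] {T : Cn N → Matrix n n ℂ}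
    (hT : ∀ i j, AnalyticAt ℝ (fun z => T z i j) q) (i j : n) :
    AnalyticAt ℝ (fun z => (T z).adjugate i j) q := by
  simp only [Matrix.adjugate_apply]
  refine analyticAt_det fun k l => ?_
  by_cases h : k = j
  · subst h; simpa using analyticAt_const
  · simpa [Matrix.updateRow_ne h] using hT k l

theorem analyticAt_dbarMatrix (hρ : AnalyticAt ℝ ρ q) (j : Fin d) (i : Fin N) :
    AnalyticAt ℝ (fun z => dbarMatrix ρ z j i) q := by
  have := analyticAt_pd (analyticAt_cpt hρ j) (.inr i)
  rwa [funext (pd_inr i _)] at this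

variable {S : Matrix (Fin N) (Fin d) ℂ} {B₀ : Matrix (Fin d) (Fin N) ℂ}

theorem analyticAt_interp (hρ : AnalyticAt ℝ ρ q) (i l : Fin N) :
    AnalyticAt ℝ (fun z => interp S B₀ (dbarMatrix ρ z) i l) q := by
  simp only [interp, Matrix.add_apply, Matrix.mul_apply (N := dbarMatrix ρ _)]
  exact (Finset.analyticAt_fun_sum _ fun j _ => analyticAt_const.fun_mul
    (analyticAt_dbarMatrix hρ _ _)).fun_add analyticAt_const

theorem analyticAt_crFrame (hρ : AnalyticAt ℝ ρ q) (l : Fin N) :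
    AnalyticAt ℝ (crFrame S B₀ ρ l) q := by
  refine AnalyticAt.pi fun i => ?_
  simp only [crFrame, kernelMatrix, Matrix.mul_apply]
  exact Finset.analyticAt_fun_sum _ fun j _ =>
    (analyticAt_adjugate (fun i j => analyticAt_interp hρ i j) _ _).fun_mul analyticAt_const

/-- Near a point where the rank of `∂̄ρ` along `M` is at most that of `B₀`, the columns of the
kernel matrix form a frame of `(0,1)` vector fields. -/
theorem isCRFrameAt_crFrame (h1 : B₀ * S * B₀ = B₀) (h2 : S * B₀ * S = S)
    (hq : q ∈ M) (hρ : IsDefiningFun N d M q U ρ)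
    (hdet : (interp S B₀ (dbarMatrix ρ q)).det ≠ 0)
    (hr : ∀ᶠ z in 𝓝 q, z ∈ M → (dbarMatrix ρ z).rank ≤ B₀.rank) :
    IsCRFrameAt N d M q (crFrame S B₀ ρ) := by
  have hρa := hρ.2.2.1 q hρ.2.1
  have hda : AnalyticAt ℝ (fun z => (interp S B₀ (dbarMatrix ρ z)).det) q :=
    analyticAt_det fun i j => analyticAt_interp hρa i j
  have hdet' := hda.continuousAt.eventually_ne hdet
  constructor
  · intro l
    obtain ⟨W, hW, hWo, hqW⟩ := eventually_nhds_iff.1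
      (hdet'.and (hr.and (hρ.1.mem_nhds hρ.2.1)))
    refine ⟨W, hWo, hqW, fun z hz => analyticAt_crFrame (hρ.2.2.1 z (hW z hz).2.2) l, ?_⟩
    intro q' U' ρ' hq' hρ' z hz j
    obtain ⟨⟨hzM, hzW⟩, hzU'⟩ := hz
    have hzU := (hW z hzW).2.2
    have hmul := mul_kernelMatrix h1 h2 (hW z hzW).1 ((hW z hzW).2.1 hzM)
    have key : ∀ j, applyC (coef (antiField (crFrame S B₀ ρ l))) (cpt ρ j) z = 0 := by
      intro j
      have := congrFun (congrFun hmul j) l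
      rw [← applyL_eq_applyC]
      simp only [Matrix.mul_apply, Matrix.zero_apply] at this
      rw [← this]
      exact Finset.sum_congr rfl fun i _ => mul_comm _ _
    have h0 : ∀ᶠ y in 𝓝 z, y ∈ M → cpt ρ' j y = 0 := by
      filter_upwards [hρ'.1.mem_nhds hzU'] with y hy hym
      simp [cpt, (hρ'.2.2.2.1 y hy).1 hym]
    have := applyC_eq_zero_of_tangent (hρ.of_mem hzU) hzM key
      (analyticAt_cpt (hρ'.2.2.1 z hzU') j) h0
    rwa [← applyL_eq_applyC] at this
  · intro W a ha
    have haa : ∀ l, AnalyticAt ℝ (fun z => a z l) q := fun l =>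
      (ContinuousLinearMap.proj (R := ℝ) (φ := fun _ : Fin N => ℂ) l).analyticAt _ |>.comp
        ha.analyticAt
    refine ⟨fun l z => (interp S B₀ (dbarMatrix ρ z)).det⁻¹ * a z l,
      fun l => (hda.fun_inv hdet).fun_mul (haa l), ?_⟩
    filter_upwards [hdet', ha.tangent_anti hq hρ] with z hz ht hm i
    have hv : dbarMatrix ρ z *ᵥ a z = 0 := by
      funext j
      have := ht hm j
      rw [← applyL_eq_applyC] at this
      rw [Pi.zero_apply, ← this]
      change ∑ i, dbarMatrix ρ z j i * a z i = _
      exact Finset.sum_congr rfl fun i _ => mul_comm _ _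
    have := congrFun (kernelMatrix_mulVec (S := S) (B₀ := B₀) hv) i
    rw [Pi.smul_apply, smul_eq_mul] at this
    rw [← inv_mul_cancel_left₀ hz (a z i), ← this, Matrix.mulVec, dotProduct, Finset.mul_sum]
    exact Finset.sum_congr rfl fun l _ => by simp only [crFrame]; ring

end Frames

section Closeness

open Filter Topology Matrix

variable {N d : ℕ}

/-- Two functions analytic at the origin which agree there to order `k`. -/
structure CloseTo (k : ℕ) (f f' : Cn N → ℂ) : Prop where
  left : AnalyticAt ℝ f 0
  right : AnalyticAt ℝ f' 0
  diff : VanishesToOrder k fun z => f z - f' z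

namespace CloseTo

variable {k : ℕ} {f f' g g' : Cn N → ℂ}

theorem mono {j : ℕ} (h : CloseTo k f f') (hj : j ≤ k) : CloseTo j f f' :=
  ⟨h.1, h.2, h.3.mono hj⟩

theorem refl (hf : AnalyticAt ℝ f 0) : CloseTo k f f :=
  ⟨hf, hf, by simpa [VanishesToOrder] using Asymptotics.isBigO_zero _ _⟩

theorem const (c : ℂ) : CloseTo (N := N) k (fun _ => c) (fun _ => c) := refl analyticAt_const

theorem add (h : CloseTo k f f') (h' : CloseTo k g g') :
    CloseTo k (fun z => f z + g z) (fun z => f' z + g' z) :=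
  ⟨h.1.fun_add h'.1, h.2.fun_add h'.2, by simpa only [add_sub_add_comm] using h.3.add h'.3⟩

theorem mul (h : CloseTo k f f') (h' : CloseTo k g g') :
    CloseTo k (fun z => f z * g z) (fun z => f' z * g' z) :=
  ⟨h.1.fun_mul h'.1, h.2.fun_mul h'.2, h.3.mul_sub_mul h.1.continuousAt h'.2.continuousAt h'.3⟩

theorem sub (h : CloseTo k f f') (h' : CloseTo k g g') :
    CloseTo k (fun z => f z - g z) (fun z => f' z - g' z) := by
  simpa only [neg_one_mul, ← sub_eq_add_neg] using h.add ((const (-1)).mul h')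

theorem sum {ι : Type*} {t : Finset ι} {f f' : ι → Cn N → ℂ}
    (h : ∀ i ∈ t, CloseTo k (f i) (f' i)) :
    CloseTo k (fun z => ∑ i ∈ t, f i z) (fun z => ∑ i ∈ t, f' i z) := by
  classical
  induction t using Finset.induction_on with
  | empty => simpa using const 0
  | insert a t ha ih =>
    simp only [Finset.sum_insert ha]
    exact (h a (Finset.mem_insert_self a t)).add
      (ih fun i hi => h i (Finset.mem_insert_of_mem hi))

theorem prod {ι : Type*} {t : Finset ι} {f f' : ι → Cn N → ℂ}
    (h : ∀ i ∈ t, CloseTo k (f i) (f' i)) :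
    CloseTo k (fun z => ∏ i ∈ t, f i z) (fun z => ∏ i ∈ t, f' i z) := by
  classical
  induction t using Finset.induction_on with
  | empty => simpa using const 1
  | insert a t ha ih =>
    simp only [Finset.prod_insert ha]
    exact (h a (Finset.mem_insert_self a t)).mul
      (ih fun i hi => h i (Finset.mem_insert_of_mem hi))

theorem conj (h : CloseTo k f f') :
    CloseTo k (fun z => (starRingEnd ℂ) (f z)) (fun z => (starRingEnd ℂ) (f' z)) :=
  ⟨(conjCLE.toContinuousLinearMap.analyticAt _).comp h.1,
    (conjCLE.toContinuousLinearMap.analyticAt _).comp h.2,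
    by simpa using h.3.continuousLinearMap_comp conjCLE.toContinuousLinearMap⟩

theorem pd (h : CloseTo (k + 1) f f') (s : Fin N ⊕ Fin N) :
    CloseTo k (_root_.pd s f) (_root_.pd s f') :=
  ⟨analyticAt_pd h.1 s, analyticAt_pd h.2 s, h.3.pd_sub h.1 h.2 s⟩

theorem det {n : Type*} [Fintype n] [DecidableEq n] {T T' : Cn N → Matrix n n ℂ}
    (h : ∀ i j, CloseTo k (fun z => T z i j) fun z => T' z i j) :
    CloseTo k (fun z => (T z).det) fun z => (T' z).det := by
  simp only [Matrix.det_apply']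
  exact sum fun σ _ => (const _).mul (prod fun i _ => h _ _)

theorem adjugate {n : Type*} [Fintype n] [DecidableEq n] {T T' : Cn N → Matrix n n ℂ}
    (h : ∀ i j, CloseTo k (fun z => T z i j) fun z => T' z i j) (i j : n) :
    CloseTo k (fun z => (T z).adjugate i j) fun z => (T' z).adjugate i j := by
  simp only [Matrix.adjugate_apply]
  refine det fun a b => ?_
  by_cases hj : a = j
  · subst hj; simpa using const _
  · simpa [Matrix.updateRow_ne hj] using h a b

theorem applyC {c c' : Fin N ⊕ Fin N → Cn N → ℂ} (hc : ∀ s, CloseTo k (c s) (c' s))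
    (h : CloseTo (k + 1) f f') : CloseTo k (_root_.applyC c f) (_root_.applyC c' f') :=
  sum fun s _ => (hc s).mul (h.pd s)

theorem commC {c c' e e' : Fin N ⊕ Fin N → Cn N → ℂ} (hc : ∀ s, CloseTo (k + 1) (c s) (c' s))
    (he : ∀ s, CloseTo (k + 1) (e s) (e' s)) (s : Fin N ⊕ Fin N) :
    CloseTo k (_root_.commC c e s) (_root_.commC c' e' s) :=
  (applyC (fun s => (hc s).mono (Nat.le_succ k)) (he s)).sub
    (applyC (fun s => (he s).mono (Nat.le_succ k)) (hc s))

variable {ρ ρ' : Cn N → Rn d} {S : Matrix (Fin N) (Fin d) ℂ} {B₀ : Matrix (Fin d) (Fin N) ℂ}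

theorem dbarMatrix (h : ∀ j, CloseTo (k + 1) (cpt ρ j) (cpt ρ' j)) (j : Fin d) (i : Fin N) :
    CloseTo k (fun z => _root_.dbarMatrix ρ z j i) fun z => _root_.dbarMatrix ρ' z j i := by
  have := (h j).pd (.inr i)
  rwa [funext (pd_inr i _), funext (pd_inr i _)] at this

theorem gradFamily (h : ∀ j, CloseTo (k + 1) (cpt ρ j) (cpt ρ' j)) (j : Fin d) (i : Fin N) :
    CloseTo k (_root_.gradFamily ρ j i) (_root_.gradFamily ρ' j i) := by
  have := (h j).pd (.inl i)
  rwa [funext (pd_inl i _), funext (pd_inl i _)] at this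

theorem crFrame (h : ∀ j, CloseTo (k + 1) (cpt ρ j) (cpt ρ' j)) (l i : Fin N) :
    CloseTo k (fun z => _root_.crFrame S B₀ ρ l z i) fun z => _root_.crFrame S B₀ ρ' l z i := by
  simp only [_root_.crFrame, kernelMatrix, Matrix.mul_apply]
  refine sum fun j _ => (adjugate (fun a b => ?_) _ _).mul (const _)
  simp only [interp, Matrix.add_apply, Matrix.mul_apply (N := _root_.dbarMatrix _ _)]
  exact (sum fun j _ => (const _).mul (dbarMatrix h _ _)).add (const _)

theorem antiField (h : ∀ j, CloseTo (k + 1) (cpt ρ j) (cpt ρ' j)) (l : Fin N)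
    (s : Fin N ⊕ Fin N) : CloseTo k (coef (_root_.antiField (_root_.crFrame S B₀ ρ l)) s)
      (coef (_root_.antiField (_root_.crFrame S B₀ ρ' l)) s) := by
  cases s with
  | inl i => exact const 0
  | inr i => exact crFrame h l i

theorem holoField (h : ∀ j, CloseTo (k + 1) (cpt ρ j) (cpt ρ' j)) (l : Fin N)
    (s : Fin N ⊕ Fin N) : CloseTo k (coef (_root_.holoField (_root_.crFrame S B₀ ρ l)) s)
      (coef (_root_.holoField (_root_.crFrame S B₀ ρ' l)) s) := by
  cases s with
  | inr i => exact const 0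
  | inl i => exact (crFrame h l i).conj

theorem iterFamily (w : List (Fin N)) (h : ∀ j, CloseTo (k + 1 + w.length) (cpt ρ j) (cpt ρ' j))
    (j : Fin d) (i : Fin N) : CloseTo k (_root_.iterFamily ρ (_root_.crFrame S B₀ ρ) (w, j) i)
      (_root_.iterFamily ρ' (_root_.crFrame S B₀ ρ') (w, j) i) := by
  induction w generalizing k with
  | nil => exact gradFamily h j i
  | cons l w ih =>
    rw [iterFamily_cons, iterFamily_cons]
    refine applyC (antiField (fun j => (h j).mono (by omega)) l) (ih fun j => (h j).mono ?_)
    simp only [List.length_cons]; omega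

theorem exists_lieFamily (t : LieWord N) : ∃ n, ∀ (ρ ρ' : Cn N → Rn d) (k : ℕ),
    (∀ j, CloseTo (k + n) (cpt ρ j) (cpt ρ' j)) → ∀ s,
    CloseTo k (lieFamily (_root_.crFrame S B₀ ρ) t s)
      (lieFamily (_root_.crFrame S B₀ ρ') t s) := by
  induction t with
  | anti l => exact ⟨1, fun ρ ρ' k h s => antiField h l s⟩
  | holo l => exact ⟨1, fun ρ ρ' k h s => holoField h l s⟩
  | br t t' h1 h2 =>
    obtain ⟨n1, h1⟩ := h1
    obtain ⟨n2, h2⟩ := h2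
    refine ⟨n1 + n2 + 1, fun ρ ρ' k h s => ?_⟩
    simp only [lieFamily, LieWord.eval, coef_bracketVF_eq_commC]
    exact commC (h1 ρ ρ' (k + 1) fun j => (h j).mono (by omega))
      (h2 ρ ρ' (k + 1) fun j => (h j).mono (by omega)) s

end CloseTo

end Closeness

section Biholomorphisms

open Filter Topology

variable {N d : ℕ} {M Mt : Set (Cn N)} {q : Cn N} {H G : Cn N → Cn N}

theorem pd_conj {g : Cn N → ℂ} (hg : AnalyticAt ℝ g q) (s : Fin N ⊕ Fin N) :
    pd s (fun y => (starRingEnd ℂ) (g y)) q = (starRingEnd ℂ) (pd s.swap g q) := by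
  have : fderiv ℝ (fun y => (starRingEnd ℂ) (g y)) q
      = conjCLE.toContinuousLinearMap.comp (fderiv ℝ g q) :=
    (conjCLE.toContinuousLinearMap.hasFDerivAt.comp q hg.differentiableAt.hasFDerivAt).fderiv
  have h2 : (starRingEnd ℂ) 2 = 2 := map_ofNat _ 2
  cases s <;>
  simp [pd, pdFunctional, this, Sum.swap, h2, sub_eq_add_neg]

theorem pd_inr_holomorphic {g : Cn N → ℂ} (hg : AnalyticAt ℂ g q) (i : Fin N) :
    pd (.inr i) g q = 0 := by
  have hI : (Pi.single i I : Cn N) = I • Pi.single i (1 : ℂ) := by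
    rw [← Pi.single_smul]; simp
  have : fderiv ℝ g q = (fderiv ℂ g q).restrictScalars ℝ :=
    hg.differentiableAt.fderiv_restrictScalars ℝ
  rw [pd_inr, wirtDbar, this, ContinuousLinearMap.coe_restrictScalars', hI, map_smul, smul_eq_mul,
    ← mul_assoc, I_mul_I]
  ring

/-- Near `q`, the map `H` is a biholomorphism with inverse `G` taking `M` to `Mt`. -/
structure IsLocalBihol (H G : Cn N → Cn N) (M Mt : Set (Cn N)) (q : Cn N) : Prop where
  analyticAt : AnalyticAt ℂ H q
  analyticAt_inv : AnalyticAt ℂ G (H q)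
  left_inv : ∀ᶠ z in 𝓝 q, G (H z) = z
  right_inv : ∀ᶠ y in 𝓝 (H q), H (G y) = y
  mem_iff : ∀ᶠ z in 𝓝 q, z ∈ M ↔ H z ∈ Mt

namespace IsLocalBihol

theorem eventually (h : IsLocalBihol H G M Mt q) : ∀ᶠ z in 𝓝 q, IsLocalBihol H G M Mt z := by
  have ht : Tendsto H (𝓝 q) (𝓝 (H q)) := h.analyticAt.continuousAt
  filter_upwards [h.1.eventually_analyticAt, ht.eventually h.2.eventually_analyticAt,
    h.3.eventually_nhds, ht.eventually h.4.eventually_nhds, h.5.eventually_nhds]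
    with z h1 h2 h3 h4 h5 using ⟨h1, h2, h3, h4, h5⟩

theorem inv_apply (h : IsLocalBihol H G M Mt q) : G (H q) = q := h.3.self_of_nhds

theorem symm (h : IsLocalBihol H G M Mt q) : IsLocalBihol G H Mt M (H q) := by
  have ht : Tendsto G (𝓝 (H q)) (𝓝 q) := by
    simpa only [h.inv_apply] using h.2.continuousAt.tendsto
  refine ⟨h.2, by simpa only [h.inv_apply] using h.1, h.4,
    by simpa only [h.inv_apply] using h.3, ?_⟩
  filter_upwards [ht.eventually h.5, h.4] with y h1 h2
  rw [h1, h2]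

theorem analyticAt_real (h : IsLocalBihol H G M Mt q) : AnalyticAt ℝ H q :=
  h.1.restrictScalars

theorem tendsto (h : IsLocalBihol H G M Mt q) : Tendsto H (𝓝 q) (𝓝 (H q)) :=
  h.1.continuousAt

theorem analyticAt_coordFn_comp (h : IsLocalBihol H G M Mt q) (s : Fin N ⊕ Fin N) :
    AnalyticAt ℝ (fun y => coordFn s (H y)) q :=
  (analyticAt_coordFn s (H q)).comp h.analyticAt_real

theorem pd_inr_coordFn_inl (h : IsLocalBihol H G M Mt q) (i k : Fin N) :
    pd (.inr i) (fun y => coordFn (.inl k) (H y)) q = 0 :=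
  pd_inr_holomorphic ((ContinuousLinearMap.proj (R := ℂ) (φ := fun _ : Fin N => ℂ) k).analyticAt _
    |>.comp h.1) i

theorem pd_inl_coordFn_inr (h : IsLocalBihol H G M Mt q) (i k : Fin N) :
    pd (.inl i) (fun y => coordFn (.inr k) (H y)) q = 0 := by
  have := pd_conj (h.analyticAt_coordFn_comp (.inl k)) (.inl i)
  rw [Sum.swap_inl, h.pd_inr_coordFn_inl, map_zero] at this
  exact this

theorem comp_inv (h : IsLocalBihol H G M Mt q) {g : Cn N → ℂ} (hg : AnalyticAt ℝ g (H q))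
    (r : Fin N ⊕ Fin N) : pd r g (H q)
      = ∑ t, pd t (fun y => g (H y)) q * pd r (fun y => coordFn t (G y)) (H q) := by
  have h1 : AnalyticAt ℝ (fun y => g (H y)) (G (H q)) := by
    rw [h.inv_apply]; exact hg.comp h.analyticAt_real
  have := pd_comp h1 h.symm.analyticAt_real r
  rw [h.inv_apply] at this
  rw [← this]
  exact pd_congr (h.4.mono fun y hy => by simp only [hy]) r

theorem pd_coordFn (r s : Fin N ⊕ Fin N) (z : Cn N) :
    pd r (coordFn s) z = if s = r then 1 else 0 := by
  have key : ∀ i k : Fin N, pd (.inl i) (coordFn (.inl k)) z = if k = i then 1 else 0 := by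
    intro i k
    have : fderiv ℝ (coordFn (.inl k) : Cn N → ℂ) z
        = ContinuousLinearMap.proj (R := ℝ) (φ := fun _ : Fin N => ℂ) k :=
      (ContinuousLinearMap.proj (R := ℝ) (φ := fun _ : Fin N => ℂ) k).fderiv
    rw [pd_inl, wirtD, this]
    by_cases hk : k = i
    · subst hk; simp; norm_num
    · simp [hk]
  have hz : ∀ i k : Fin N, pd (.inr i) (coordFn (.inl k)) z = 0 := fun i k =>
    pd_inr_holomorphic
      ((ContinuousLinearMap.proj (R := ℂ) (φ := fun _ : Fin N => ℂ) k).analyticAt _) i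
  have hc : ∀ (r : Fin N ⊕ Fin N) (k : Fin N), pd r (coordFn (.inr k)) z
      = (starRingEnd ℂ) (pd r.swap (coordFn (.inl k)) z) := fun r k =>
    pd_conj (analyticAt_coordFn (.inl k) z) r
  rcases r with i | i <;> rcases s with k | k
  · simp [key]
  · simp [hc, hz]
  · simp [hz]
  · simp [hc, key, apply_ite]

/-- Coefficients transported to `q` by the inverse map are carried back by `H`. -/
theorem related (h : IsLocalBihol H G M Mt q) {c : Fin N ⊕ Fin N → Cn N → ℂ}
    {e : Fin N ⊕ Fin N → Cn N → ℂ}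
    (hc : ∀ t, c t q = applyC e (fun y => coordFn t (G y)) (H q)) (s : Fin N ⊕ Fin N) :
    applyC c (fun y => coordFn s (H y)) q = e s (H q) := by
  simp only [applyC, hc, Finset.sum_mul]
  rw [Finset.sum_comm]
  have : ∀ r, ∑ t, e r (H q) * pd r (fun y => coordFn t (G y)) (H q)
      * pd t (fun y => coordFn s (H y)) q = e r (H q) * if s = r then 1 else 0 := by
    intro r
    rw [← pd_coordFn r s (H q), h.comp_inv (analyticAt_coordFn s _), Finset.mul_sum]
    exact Finset.sum_congr rfl fun t _ => by ring
  simp [this]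

theorem applyC_comp (h : IsLocalBihol H G M Mt q) {c e : Fin N ⊕ Fin N → Cn N → ℂ}
    (hce : ∀ s, applyC c (fun y => coordFn s (H y)) q = e s (H q)) {g : Cn N → ℂ}
    (hg : AnalyticAt ℝ g (H q)) : applyC c (fun y => g (H y)) q = applyC e g (H q) := by
  simp only [applyC] at hce ⊢
  simp only [← hce, pd_comp hg h.analyticAt_real, Finset.mul_sum, Finset.sum_mul]
  rw [Finset.sum_comm]
  exact Finset.sum_congr rfl fun _ _ => Finset.sum_congr rfl fun _ _ => by ring

/-- The pullback of a `(0,1)` field. -/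
def pullField (H G : Cn N → Cn N) (a : Cn N → Cn N) : Cn N → Cn N :=
  fun z k => applyC (coef (antiField a)) (fun y => coordFn (.inr k) (G y)) (H z)

theorem coef_pullField (h : IsLocalBihol H G M Mt q) (a : Cn N → Cn N) (t : Fin N ⊕ Fin N) :
    coef (antiField (pullField H G a)) t q
      = applyC (coef (antiField a)) (fun y => coordFn t (G y)) (H q) := by
  cases t with
  | inr k => rfl
  | inl k =>
    simp [coef, antiField, applyC, h.symm.pd_inr_coordFn_inl]

theorem related_anti (h : IsLocalBihol H G M Mt q) (a : Cn N → Cn N) (s : Fin N ⊕ Fin N) :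
    applyC (coef (antiField (pullField H G a))) (fun y => coordFn s (H y)) q
      = coef (antiField a) s (H q) :=
  h.related (h.coef_pullField a) s

theorem related_holo (h : IsLocalBihol H G M Mt q) (a : Cn N → Cn N) (s : Fin N ⊕ Fin N) :
    applyC (coef (holoField (pullField H G a))) (fun y => coordFn s (H y)) q
      = coef (holoField a) s (H q) := by
  refine h.related (fun t => ?_) s
  cases t with
  | inr k => simp [coef, holoField, applyC, h.symm.pd_inl_coordFn_inr]
  | inl k =>
    have : ∀ i, pd (.inl i) (fun y => coordFn (.inl k) (G y)) (H q)
        = (starRingEnd ℂ) (pd (.inr i) (fun y => coordFn (.inr k) (G y)) (H q)) := fun i => by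
      rw [show (Sum.inr i : Fin N ⊕ Fin N) = (Sum.inl i).swap from rfl,
        ← pd_conj (h.symm.analyticAt_coordFn_comp (.inr k))]
      simp [coordFn]
    simp [coef, holoField, antiField, applyC, pullField, this]

theorem analyticAt_pullField (h : IsLocalBihol H G M Mt q) {a : Cn N → Cn N}
    (ha : AnalyticAt ℝ a (H q)) : AnalyticAt ℝ (pullField H G a) q := by
  refine AnalyticAt.pi fun k => ?_
  exact (analyticAt_applyC (analyticAt_coef_antiField ha)
    (h.symm.analyticAt_coordFn_comp (.inr k))).comp h.analyticAt_real

theorem fderiv_surjective (h : IsLocalBihol H G M Mt q) :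
    Function.Surjective (fderiv ℝ H q) := by
  have hG := h.symm.analyticAt_real.differentiableAt.hasFDerivAt
  have hH : HasFDerivAt H (fderiv ℝ H q) (G (H q)) := by
    rw [h.inv_apply]; exact h.analyticAt_real.differentiableAt.hasFDerivAt
  have h1 := hH.comp (H q) hG
  have h2 : HasFDerivAt (H ∘ G) (ContinuousLinearMap.id ℝ (Cn N)) (H q) :=
    (hasFDerivAt_id (𝕜 := ℝ) (H q)).congr_of_eventuallyEq (h.4.mono fun y hy => hy)
  intro v
  exact ⟨fderiv ℝ G (H q) v, congrArg (· v) (h1.unique h2)⟩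

theorem isDefiningFun_comp (h : IsLocalBihol H G M Mt q) {U : Set (Cn N)} {ρ : Cn N → Rn d}
    (hρ : IsDefiningFun N d Mt (H q) U ρ) :
    ∃ U', IsDefiningFun N d M q U' (fun z => ρ (H z)) := by
  obtain ⟨W, hW, hWo, hqW⟩ := eventually_nhds_iff.1
    (h.eventually.and (h.tendsto.eventually (hρ.1.mem_nhds hρ.2.1)))
  refine ⟨W, hWo, hqW, fun z hz => ?_, fun z hz => ?_, fun z hz => ?_⟩
  · exact (hρ.2.2.1 _ (hW z hz).2).comp (hW z hz).1.analyticAt_real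
  · rw [(hW z hz).1.mem_iff.self_of_nhds, hρ.2.2.2.1 _ (hW z hz).2]
  · have := ((hρ.2.2.1 _ (hW z hz).2).differentiableAt.hasFDerivAt.comp z
      (hW z hz).1.analyticAt_real.differentiableAt.hasFDerivAt).fderiv
    rw [show (fun z => ρ (H z)) = ρ ∘ H from rfl, this]
    exact (hρ.2.2.2.2 _ (hW z hz).2).comp (hW z hz).1.fderiv_surjective

theorem isCR01At_pullField (h : IsLocalBihol H G M Mt q) (hq : q ∈ M) {U : Set (Cn N)}
    {ρ : Cn N → Rn d} (hρ : IsDefiningFun N d Mt (H q) U ρ) {W : Set (Cn N)} {a : Cn N → Cn N}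
    (ha : IsCR01At N d Mt (H q) W a) : ∃ W', IsCR01At N d M q W' (pullField H G a) := by
  have hHq : H q ∈ Mt := h.mem_iff.self_of_nhds.1 hq
  obtain ⟨V, hV, hVo, hqV⟩ := eventually_nhds_iff.1 (h.eventually.and
    ((h.tendsto.eventually (hρ.1.mem_nhds hρ.2.1)).and
      (h.tendsto.eventually (ha.1.mem_nhds ha.2.1))))
  refine ⟨V, hVo, hqV, fun z hz => (hV z hz).1.analyticAt_pullField (ha.2.2.1 _ (hV z hz).2.2), ?_⟩
  rintro q' U' ρ' - hρ' z ⟨⟨hzM, hzV⟩, hzU'⟩ j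
  obtain ⟨hz, hzU, hzW⟩ := hV z hzV
  have hHz : H z ∈ Mt := hz.mem_iff.self_of_nhds.1 hzM
  have hρ'a := hρ'.2.2.1 z hzU'
  have hg : AnalyticAt ℝ (fun y => cpt ρ' j (G y)) (H z) := by
    refine AnalyticAt.comp (g := cpt ρ' j) ?_ hz.symm.analyticAt_real
    rw [hz.inv_apply]; exact analyticAt_cpt hρ'a j
  have h0 : ∀ᶠ y in 𝓝 (H z), y ∈ Mt → cpt ρ' j (G y) = 0 := by
    have hGz : G (H z) ∈ U' := by rwa [hz.inv_apply]
    filter_upwards [hz.symm.tendsto.eventually (hρ'.1.mem_nhds hGz), hz.symm.mem_iff]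
      with y h1 h2 hm
    simp [cpt, (hρ'.2.2.2.1 _ h1).1 (h2.1 hm)]
  have h1 : applyC (coef (antiField a)) (fun y => cpt ρ' j (G y)) (H z) = 0 := by
    refine applyC_eq_zero_of_tangent (hρ.of_mem hzU) hHz (fun i => ?_) hg h0
    rw [← applyL_eq_applyC]
    exact ha.2.2.2 _ U ρ hHq hρ _ ⟨⟨hHz, hzW⟩, hzU⟩ i
  rw [← hz.applyC_comp (hz.related_anti a) hg, ← applyL_eq_applyC, applyL_eq_applyVF] at h1
  rw [applyVF_congr (g' := cpt ρ' j) (hz.3.mono fun y hy => by simp only [hy]),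
    ← applyL_eq_applyVF] at h1
  exact h1

theorem finrank_orbitSpan_le (h : IsLocalBihol H G M Mt q) (hq : q ∈ M) {U : Set (Cn N)}
    {ρ : Cn N → Rn d} (hρ : IsDefiningFun N d Mt (H q) U ρ) :
    Module.finrank ℂ (orbitSpan N d Mt (H q)) ≤ Module.finrank ℂ (orbitSpan N d M q) := by
  have key : ∀ Y, InGenLie N d Mt (H q) Y → ∃ X, InGenLie N d M q X ∧
      ∀ᶠ z in 𝓝 q, ∀ s, applyC (coef X) (fun y => coordFn s (H y)) z = coef Y s (H z) := by
    intro Y hY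
    induction hY with
    | of01 W a ha =>
      obtain ⟨W', hW'⟩ := h.isCR01At_pullField hq hρ ha
      exact ⟨_, .of01 W' _ hW', h.eventually.mono fun z hz => hz.related_anti a⟩
    | conj01 W a ha =>
      obtain ⟨W', hW'⟩ := h.isCR01At_pullField hq hρ ha
      exact ⟨_, .conj01 W' _ hW', h.eventually.mono fun z hz => hz.related_holo a⟩
    | bracket Y Y' hY hY' ih ih' =>
      obtain ⟨X, hX, e⟩ := ih
      obtain ⟨X', hX', e'⟩ := ih'
      refine ⟨_, .bracket X X' hX hX', ?_⟩
      have a1 : ∀ᶠ z in 𝓝 q, ∀ s, AnalyticAt ℝ (coef X s) z :=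
        eventually_all.2 fun s => (hX.analyticAt_coef s).eventually_analyticAt
      have a2 : ∀ᶠ z in 𝓝 q, ∀ s, AnalyticAt ℝ (coef X' s) z :=
        eventually_all.2 fun s => (hX'.analyticAt_coef s).eventually_analyticAt
      have b1 : ∀ᶠ z in 𝓝 q, ∀ s, AnalyticAt ℝ (coef Y s) (H z) :=
        h.tendsto.eventually
          (eventually_all.2 fun s => (hY.analyticAt_coef s).eventually_analyticAt)
      have b2 : ∀ᶠ z in 𝓝 q, ∀ s, AnalyticAt ℝ (coef Y' s) (H z) :=
        h.tendsto.eventually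
          (eventually_all.2 fun s => (hY'.analyticAt_coef s).eventually_analyticAt)
      filter_upwards [e.eventually_nhds, e'.eventually_nhds, h.eventually, a1, a2, b1, b2]
        with z ez ez' hz az az' bz bz' s
      have hs := hz.analyticAt_coordFn_comp s
      rw [← applyVF_eq_applyC, applyVF_bracketVF az az' hs, coef_bracketVF_eq_commC, commC,
        applyVF_congr (g := applyVF N X' _) (g' := fun y => coef Y' s (H y)),
        applyVF_congr (g := applyVF N X _) (g' := fun y => coef Y s (H y)),
        applyVF_eq_applyC, applyVF_eq_applyC, hz.applyC_comp ez.self_of_nhds (bz' s),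
        hz.applyC_comp ez'.self_of_nhds (bz s)]
      · filter_upwards [ez] with y hy using by rw [applyVF_eq_applyC, hy s]
      · filter_upwards [ez'] with y hy using by rw [applyVF_eq_applyC, hy s]
  let K : (Fin N ⊕ Fin N → ℂ) →ₗ[ℂ] (Fin N ⊕ Fin N → ℂ) := Matrix.mulVecLin
    (Matrix.of fun s t => pd t (fun y => coordFn s (H y)) q)
  have hle : orbitSpan N d Mt (H q) ≤ (orbitSpan N d M q).map K := by
    refine Submodule.span_le.2 ?_
    rintro _ ⟨Y, hY, rfl⟩
    obtain ⟨X, hX, e⟩ := key Y hY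
    refine ⟨_, Submodule.subset_span ⟨X, hX, rfl⟩, ?_⟩
    funext s
    rw [← e.self_of_nhds s]
    change ∑ t, pd t (fun y => coordFn s (H y)) q * coef X t q
      = ∑ t, coef X t q * pd t (fun y => coordFn s (H y)) q
    exact Finset.sum_congr rfl fun t _ => mul_comm _ _
  exact (Submodule.finrank_mono hle).trans (Submodule.finrank_map_le _ _)

theorem gradFamily_comp (h : IsLocalBihol H G M Mt q) {ρ : Cn N → Rn d}
    (hρ : AnalyticAt ℝ ρ (H q)) (j : Fin d) (l : Fin N) :
    gradFamily ρ j l (H q) = ∑ i, gradFamily (fun z => ρ (H z)) j i q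
      * pd (.inl l) (fun y => coordFn (.inl i) (G y)) (H q) := by
  rw [gradFamily, ← pd_inl, h.comp_inv (analyticAt_cpt hρ j), Fintype.sum_sum_type]
  simp only [h.symm.pd_inl_coordFn_inr, mul_zero, Finset.sum_const_zero, add_zero]
  exact Finset.sum_congr rfl fun i _ => by rw [pd_inl]; rfl

/-- The transition map between complex gradients at `q` and at `H q`. -/
def gradTransition (H G : Cn N → Cn N) (q : Cn N) : (Fin N → ℂ) →ₗ[ℂ] (Fin N → ℂ) :=
  Matrix.mulVecLin
    (Matrix.of fun l i => pd (.inl l) (fun y => coordFn (.inl i) (G y)) (H q))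

theorem finrank_gradSpace_le (h : IsLocalBihol H G M Mt q) :
    Module.finrank ℂ (gradSpace N d Mt (H q)) ≤ Module.finrank ℂ (gradSpace N d M q) := by
  have hle : gradSpace N d Mt (H q) ≤ (gradSpace N d M q).map (gradTransition H G q) := by
    refine Submodule.span_le.2 ?_
    rintro _ ⟨U, ρ, j, hρ, rfl⟩
    obtain ⟨U', hU'⟩ := h.isDefiningFun_comp hρ
    refine ⟨_, Submodule.subset_span ⟨U', _, j, hU', rfl⟩, ?_⟩
    funext l
    have := h.gradFamily_comp (hρ.2.2.1 _ hρ.2.1) j l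
    refine Eq.trans ?_ this.symm
    change ∑ i : Fin N, (_ : ℂ) * (_ : ℂ) = ∑ i : Fin N, (_ : ℂ) * (_ : ℂ)
    exact Finset.sum_congr rfl fun t _ => mul_comm _ _
  exact (Submodule.finrank_mono hle).trans (Submodule.finrank_map_le _ _)

theorem analyticAt_transition (h : IsLocalBihol H G M Mt q) (l i : Fin N) :
    AnalyticAt ℂ (fun z => pd (.inl l) (fun y => coordFn (.inl i) (G y)) (H z)) q := by
  have hproj : ∀ {y}, AnalyticAt ℂ G y → AnalyticAt ℂ (fun y => coordFn (.inl i) (G y)) y :=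
    fun hy => (ContinuousLinearMap.proj (R := ℂ) (φ := fun _ : Fin N => ℂ) i).analyticAt _
      |>.comp hy
  have h1 : AnalyticAt ℂ (fun z => fderiv ℂ (fun y => coordFn (.inl i) (G y)) (H z)
      (Pi.single l 1)) q :=
    ((ContinuousLinearMap.apply ℂ ℂ (Pi.single l (1 : ℂ) : Cn N)).analyticAt _).comp
      ((hproj h.2).fderiv.comp h.1)
  refine h1.congr ?_
  filter_upwards [h.eventually] with z hz
  have hI : (Pi.single l I : Cn N) = I • Pi.single l (1 : ℂ) := by
    rw [← Pi.single_smul]; simp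
  rw [pd_inl, wirtD, (hproj hz.2).differentiableAt.fderiv_restrictScalars ℝ,
    ContinuousLinearMap.coe_restrictScalars', hI, map_smul, smul_eq_mul, ← mul_assoc, I_mul_I]
  ring

theorem finrank_Espace_le (h : IsLocalBihol H G M Mt q) (hq : q ∈ M) :
    Module.finrank ℂ (Espace N d Mt (H q)) ≤ Module.finrank ℂ (Espace N d M q) := by
  have key : ∀ (U : Set (Cn N)) (ρ : Cn N → Rn d) (j : Fin d) (ls : List (Cn N → Cn N)),
      IsDefiningFun N d Mt (H q) U ρ → (∀ a ∈ ls, ∃ W, IsCR01At N d Mt (H q) W a) →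
      (∀ l, AnalyticAt ℝ (iterL N ls (gradFamily ρ j l)) (H q)) ∧
      (∀ i, AnalyticAt ℝ (iterL N (ls.map (pullField H G)) (gradFamily (fun z => ρ (H z)) j i)) q) ∧
      ∀ᶠ z in 𝓝 q, ∀ l, iterL N ls (gradFamily ρ j l) (H z)
        = ∑ i, iterL N (ls.map (pullField H G)) (gradFamily (fun z => ρ (H z)) j i) z
          * pd (.inl l) (fun y => coordFn (.inl i) (G y)) (H z) := by
    intro U ρ j ls hρ hls
    induction ls with
    | nil =>
      refine ⟨fun l => analyticAt_gradFamily (hρ.2.2.1 _ hρ.2.1) j l, fun i =>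
        analyticAt_gradFamily ((hρ.2.2.1 _ hρ.2.1).comp h.analyticAt_real) j i, ?_⟩
      filter_upwards [h.eventually, h.tendsto.eventually (hρ.1.mem_nhds hρ.2.1)] with z hz hU l
      exact hz.gradFamily_comp (hρ.2.2.1 _ hU) j l
    | cons a ls ih =>
      obtain ⟨i1, i2, i3⟩ := ih fun b hb => hls b (by simp [hb])
      obtain ⟨W, hW⟩ := hls a (by simp)
      have ha := hW.analyticAt
      simp only [List.map_cons, iterL, applyL_eq_applyC]
      refine ⟨fun l => analyticAt_applyC (analyticAt_coef_antiField ha) (i1 l), fun i =>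
        analyticAt_applyC (analyticAt_coef_antiField (h.analyticAt_pullField ha)) (i2 i), ?_⟩
      have e1 : ∀ᶠ z in 𝓝 q, ∀ l, AnalyticAt ℝ (iterL N ls (gradFamily ρ j l)) (H z) :=
        h.tendsto.eventually (eventually_all.2 fun l => (i1 l).eventually_analyticAt)
      have e2 : ∀ᶠ z in 𝓝 q, ∀ i, AnalyticAt ℝ
          (iterL N (ls.map (pullField H G)) (gradFamily (fun z => ρ (H z)) j i)) z :=
        eventually_all.2 fun i => (i2 i).eventually_analyticAt
      filter_upwards [i3.eventually_nhds, h.eventually, e1, e2] with z hz hb z1 z2 l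
      have hT : ∀ i, AnalyticAt ℂ
          (fun z => pd (.inl l) (fun y => coordFn (.inl i) (G y)) (H z)) z :=
        fun i => hb.analyticAt_transition l i
      rw [← hb.applyC_comp (hb.related_anti a) (z1 l), ← applyVF_eq_applyC,
        applyVF_congr (hz.mono fun y hy => hy l),
        applyVF_sum fun i _ => (z2 i).fun_mul (hT i).restrictScalars]
      refine Finset.sum_congr rfl fun i _ => ?_
      rw [applyVF_mul (z2 i) (hT i).restrictScalars]
      have : applyVF N (antiField (pullField H G a))
          (fun z => pd (.inl l) (fun y => coordFn (.inl i) (G y)) (H z)) z = 0 := by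
        rw [applyVF_eq_applyC]
        simp [applyC, coef, antiField, pd_inr_holomorphic (hT i)]
      rw [this, mul_zero, add_zero, applyVF_eq_applyC]
  have hle : Espace N d Mt (H q) ≤ (Espace N d M q).map (gradTransition H G q) := by
    refine Submodule.span_le.2 ?_
    rintro _ ⟨U, ρ, j, ls, hρ, hls, rfl⟩
    obtain ⟨U', hU'⟩ := h.isDefiningFun_comp hρ
    refine ⟨_, Submodule.subset_span ⟨U', _, j, ls.map (pullField H G), hU', ?_, rfl⟩, ?_⟩
    · intro b hb
      obtain ⟨a, ha, rfl⟩ := List.mem_map.1 hb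
      obtain ⟨W, hW⟩ := hls a ha
      exact h.isCR01At_pullField hq hρ hW
    · funext l
      refine Eq.trans ?_ ((key U ρ j ls hρ hls).2.2.self_of_nhds l).symm
      change ∑ i : Fin N, (_ : ℂ) * (_ : ℂ) = ∑ i : Fin N, (_ : ℂ) * (_ : ℂ)
      exact Finset.sum_congr rfl fun t _ => mul_comm _ _
  exact (Submodule.finrank_mono hle).trans (Submodule.finrank_map_le _ _)

end IsLocalBihol

end Biholomorphisms

section Charts

open Filter Topology Asymptotics

/-- An analytic map with injective derivative between spaces of the same finite dimension has an
analytic local inverse. -/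
theorem exists_analyticAt_local_inverse {𝕜 E F : Type*} [RCLike 𝕜] [NormedAddCommGroup E]
    [NormedSpace 𝕜 E] [FiniteDimensional 𝕜 E] [NormedAddCommGroup F] [NormedSpace 𝕜 F]
    [FiniteDimensional 𝕜 F] {f : E → F} {a : E} (hf : AnalyticAt 𝕜 f a)
    (hinj : Function.Injective (fderiv 𝕜 f a))
    (hdim : Module.finrank 𝕜 E = Module.finrank 𝕜 F) :
    ∃ g : F → E, AnalyticAt 𝕜 g (f a) ∧ g (f a) = a ∧ (∀ᶠ x in 𝓝 a, g (f x) = x) ∧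
      ∀ᶠ y in 𝓝 (f a), f (g y) = y := by
  have : CompleteSpace E := FiniteDimensional.complete 𝕜 E
  have : CompleteSpace F := FiniteDimensional.complete 𝕜 F
  let e : E ≃L[𝕜] F := (LinearEquiv.ofInjectiveOfFinrankEq
    (fderiv 𝕜 f a : E →ₗ[𝕜] F) hinj hdim).toContinuousLinearEquiv
  have he : fderiv 𝕜 f a = (e : E →L[𝕜] F) := by ext v; rfl
  have hs : HasStrictFDerivAt f (e : E →L[𝕜] F) a := he ▸ hf.hasStrictFDerivAt
  exact ⟨_, (hs.toOpenPartialHomeomorph f).analyticAt_symm'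
    hs.mem_toOpenPartialHomeomorph_source hf he, hs.localInverse_apply_image,
    hs.eventually_left_inverse, hs.eventually_right_inverse⟩

variable {N d m : ℕ} {M : Set (Cn N)} {U : Set (Cn N)} {ρ : Cn N → Rn d}

theorem finrank_real_Cn : Module.finrank ℝ (Cn N) = 2 * N := by
  rw [← Module.finrank_mul_finrank ℝ ℂ (Cn N), Complex.finrank_real_complex,
    Module.finrank_fin_fun]

/-- Near the origin, `M` is the graph of `h` in the linear coordinates `Φ`. -/
structure IsGraphOver (Φ : Cn N ≃L[ℝ] Rn m × Rn d) (h : Rn m → Rn d) (M : Set (Cn N)) :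
    Prop where
  analyticAt : AnalyticAt ℝ h 0
  apply_zero : h 0 = 0
  mem_iff : ∀ᶠ z in 𝓝 0, z ∈ M ↔ (Φ z).2 = h (Φ z).1

theorem IsDefiningFun.le_two_mul (hρ : IsDefiningFun N d M 0 U ρ) : d ≤ 2 * N := by
  have := LinearMap.finrank_le_finrank_of_surjective
    (f := (fderiv ℝ ρ 0 : Cn N →ₗ[ℝ] Rn d)) (hρ.2.2.2.2 0 hρ.2.1)
  rwa [finrank_real_Cn, Module.finrank_fin_fun] at this

theorem IsDefiningFun.finrank_ker (hρ : IsDefiningFun N d M 0 U ρ) :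
    Module.finrank ℝ (LinearMap.ker (fderiv ℝ ρ 0 : Cn N →ₗ[ℝ] Rn d)) = 2 * N - d := by
  have := LinearMap.finrank_range_add_finrank_ker (fderiv ℝ ρ 0 : Cn N →ₗ[ℝ] Rn d)
  rw [LinearMap.range_eq_top.2 (hρ.2.2.2.2 0 hρ.2.1), finrank_top, finrank_real_Cn,
    Module.finrank_fin_fun] at this
  omega

/-- Linear coordinates in which the kernel of the differential of a defining function at the
origin is a graph. -/
theorem IsDefiningFun.exists_chart (hρ : IsDefiningFun N d M 0 U ρ) :
    ∃ Φ : Cn N ≃L[ℝ] Rn (2 * N - d) × Rn d,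
      ∀ v, (Φ v).1 = 0 → fderiv ℝ ρ 0 v = 0 → v = 0 := by
  let L : Cn N →ₗ[ℝ] Rn d := fderiv ℝ ρ 0
  obtain ⟨p, hp⟩ := (LinearMap.ker L).subtype.exists_leftInverse_of_injective
    (Submodule.ker_subtype _)
  let e : LinearMap.ker L ≃ₗ[ℝ] Rn (2 * N - d) := LinearEquiv.ofFinrankEq _ _ (by
    rw [Module.finrank_fin_fun]; exact hρ.finrank_ker)
  let T : Cn N →ₗ[ℝ] Rn (2 * N - d) × Rn d := ((e : _ →ₗ[ℝ] _) ∘ₗ p).prod L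
  have key : ∀ v, (e (p v)) = 0 → L v = 0 → v = 0 := by
    intro v h1 h2
    have h3 : p v = ⟨v, h2⟩ := LinearMap.congr_fun hp ⟨v, h2⟩
    rw [h3, e.map_eq_zero_iff] at h1
    exact congrArg Subtype.val h1
  have hT : Function.Injective T := by
    refine (injective_iff_map_eq_zero T).2 fun v hv => ?_
    exact key v (congrArg Prod.fst hv) (congrArg Prod.snd hv)
  have hle := hρ.le_two_mul
  refine ⟨(LinearEquiv.ofInjectiveOfFinrankEq T hT ?_).toContinuousLinearEquiv, key⟩
  rw [finrank_real_Cn, Module.finrank_prod, Module.finrank_fin_fun, Module.finrank_fin_fun]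
  omega

theorem IsDefiningFun.exists_graph (hρ : IsDefiningFun N d M 0 U ρ) (h0 : 0 ∈ M)
    (Φ : Cn N ≃L[ℝ] Rn m × Rn d)
    (hker : ∀ v, (Φ v).1 = 0 → fderiv ℝ ρ 0 v = 0 → v = 0) : ∃ h, IsGraphOver Φ h M := by
  have hρa := hρ.2.2.1 0 hρ.2.1
  have hρ0 : ρ 0 = 0 := (hρ.2.2.2.1 0 hρ.2.1).1 h0
  let T : Cn N →L[ℝ] Rn m := (ContinuousLinearMap.fst ℝ _ _).comp (Φ : Cn N →L[ℝ] Rn m × Rn d)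
  let F : Cn N → Rn m × Rn d := fun z => (T z, ρ z)
  have hF : AnalyticAt ℝ F 0 := (T.analyticAt 0).prod hρa
  have hF' : fderiv ℝ F 0 = T.prod (fderiv ℝ ρ 0) :=
    (T.hasFDerivAt.prodMk hρa.differentiableAt.hasFDerivAt).fderiv
  have hF0 : F 0 = 0 := by simp [F, hρ0]
  obtain ⟨g, hg, hg0, hgl, hgr⟩ := exists_analyticAt_local_inverse hF (by
    rw [hF']
    refine (injective_iff_map_eq_zero _).2 fun v hv => ?_
    exact hker v (congrArg Prod.fst hv) (congrArg Prod.snd hv))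
    Φ.toLinearEquiv.finrank_eq
  rw [hF0] at hg hg0 hgr
  let P : Rn m →L[ℝ] Rn m × Rn d := ContinuousLinearMap.inl ℝ _ _
  have hP : AnalyticAt ℝ P 0 := P.analyticAt 0
  have hP0 : P 0 = 0 := map_zero P
  let Q : Cn N →L[ℝ] Rn d := (ContinuousLinearMap.snd ℝ _ _).comp (Φ : Cn N →L[ℝ] Rn m × Rn d)
  refine ⟨fun x => Q (g (P x)), (Q.analyticAt _).comp (AnalyticAt.comp (by rwa [hP0]) hP), ?_, ?_⟩
  · rw [hP0, hg0, map_zero]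
  · have hT : Tendsto (fun z => P (T z)) (𝓝 0) (𝓝 0) := by
      have := (P.comp T).continuous.tendsto 0
      rwa [map_zero] at this
    filter_upwards [hgl, hT.eventually hgr, hρ.1.mem_nhds hρ.2.1] with z h1 h2 hz
    rw [hρ.2.2.2.1 z hz]
    constructor
    · intro h
      have : P (T z) = F z := by simp [P, F, h]
      change Q z = Q (g (P (T z)))
      rw [this, h1]
    · intro h
      have e1 : g (P (T z)) = z := by
        apply Φ.injective
        refine Prod.ext ?_ h.symm
        have := congrArg Prod.fst h2
        exact this
      rw [e1] at h2
      exact congrArg Prod.snd h2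

variable {Φ : Cn N ≃L[ℝ] Rn m × Rn d} {h h' : Rn m → Rn d}

/-- The defining function of a graph. -/
def graphDef (Φ : Cn N ≃L[ℝ] Rn m × Rn d) (h : Rn m → Rn d) : Cn N → Rn d :=
  fun z => (Φ z).2 - h (Φ z).1

/-- The parametrization of a graph. -/
def graphPar (Φ : Cn N ≃L[ℝ] Rn m × Rn d) (h : Rn m → Rn d) : Rn m → Cn N :=
  fun x => Φ.symm (x, h x)

theorem tendsto_chart_fst (Φ : Cn N ≃L[ℝ] Rn m × Rn d) :
    Tendsto (fun z => (Φ z).1) (𝓝 0) (𝓝 0) := by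
  have : Continuous fun z => (Φ z).1 := continuous_fst.comp Φ.continuous
  simpa using this.tendsto 0

theorem analyticAt_graphDef {z : Cn N} (hh : AnalyticAt ℝ h (Φ z).1) :
    AnalyticAt ℝ (graphDef Φ h) z := by
  have h1 : AnalyticAt ℝ (fun z => Φ z) z := (Φ : Cn N →L[ℝ] Rn m × Rn d).analyticAt z
  exact (((ContinuousLinearMap.snd ℝ (Rn m) (Rn d)).analyticAt _).comp h1).sub
    (hh.comp (f := fun z => (Φ z).1)
      (((ContinuousLinearMap.fst ℝ (Rn m) (Rn d)).analyticAt _).comp h1))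

theorem fderiv_graphDef {z : Cn N} (hh : AnalyticAt ℝ h (Φ z).1) (v : Cn N) :
    fderiv ℝ (graphDef Φ h) z v = (Φ v).2 - fderiv ℝ h (Φ z).1 (Φ v).1 := by
  have h1 : HasFDerivAt (fun z => Φ z) (Φ : Cn N →L[ℝ] Rn m × Rn d) z := Φ.hasFDerivAt
  have h2 := h1.snd.sub (hh.differentiableAt.hasFDerivAt.comp z h1.fst)
  exact congrArg (· v) h2.fderiv

theorem analyticAt_graphPar {x : Rn m} (hh : AnalyticAt ℝ h x) :
    AnalyticAt ℝ (graphPar Φ h) x :=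
  ((Φ.symm : Rn m × Rn d →L[ℝ] Cn N).analyticAt _).comp (analyticAt_id.prod hh)

theorem chart_graphPar (x : Rn m) : Φ (graphPar Φ h x) = (x, h x) := Φ.apply_symm_apply _

theorem fderiv_graphDef_right {z : Cn N} (hh : AnalyticAt ℝ h (Φ z).1) (y : Rn d) :
    fderiv ℝ (graphDef Φ h) z (Φ.symm (0, y)) = y := by
  simp [fderiv_graphDef hh]

theorem isConstRightInverse_graphDef {z : Cn N} (hh : AnalyticAt ℝ h (Φ z).1) :
    IsConstRightInverse (graphDef Φ h) z fun l => Φ.symm (0, Pi.single l 1) := by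
  have : ContinuousAt (fun z => (Φ z).1) z := (continuous_fst.comp Φ.continuous).continuousAt
  filter_upwards [this.eventually hh.eventually_analyticAt] with y hy l
  exact fderiv_graphDef_right hy _

namespace IsGraphOver

theorem eventually_analyticAt (hM : IsGraphOver Φ h M) :
    ∀ᶠ z in 𝓝 0, AnalyticAt ℝ h (Φ z).1 :=
  (tendsto_chart_fst Φ).eventually hM.1.eventually_analyticAt

theorem exists_isDefiningFun (hM : IsGraphOver Φ h M) :
    ∃ U, IsDefiningFun N d M 0 U (graphDef Φ h) := by
  obtain ⟨W, hW, hWo, hW0⟩ := eventually_nhds_iff.1 (hM.mem_iff.and hM.eventually_analyticAt)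
  refine ⟨W, hWo, hW0, fun z hz => analyticAt_graphDef (hW z hz).2, fun z hz => ?_,
    fun z hz y => ⟨_, fderiv_graphDef_right (hW z hz).2 y⟩⟩
  rw [(hW z hz).1, graphDef, sub_eq_zero]

theorem graphPar_zero (hM : IsGraphOver Φ h M) : graphPar Φ h 0 = 0 := by
  simp [graphPar, hM.apply_zero]

theorem zero_mem (hM : IsGraphOver Φ h M) : (0 : Cn N) ∈ M := by
  rw [hM.mem_iff.self_of_nhds]
  simp [hM.apply_zero]

theorem tendsto_graphPar (hM : IsGraphOver Φ h M) : Tendsto (graphPar Φ h) (𝓝 0) (𝓝 0) := by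
  have := (analyticAt_graphPar (Φ := Φ) hM.1).continuousAt.tendsto
  rwa [hM.graphPar_zero] at this

theorem eventually_graphPar_mem (hM : IsGraphOver Φ h M) : ∀ᶠ x in 𝓝 0, graphPar Φ h x ∈ M := by
  filter_upwards [hM.tendsto_graphPar.eventually hM.mem_iff] with x hx
  rw [hx, chart_graphPar]

theorem eventually_eq_graphPar (hM : IsGraphOver Φ h M) :
    ∀ᶠ z in 𝓝 0, z ∈ M → z = graphPar Φ h (Φ z).1 := by
  filter_upwards [hM.mem_iff] with z hz hzM
  rw [graphPar, ← hz.1 hzM, Prod.mk.eta, Φ.symm_apply_apply]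

theorem injective_fderiv_graphPar (hM : IsGraphOver Φ h M) :
    Function.Injective (fderiv ℝ (graphPar Φ h) 0) := by
  have h1 : HasFDerivAt (fun x => (Φ (graphPar Φ h x)).1)
      ((ContinuousLinearMap.fst ℝ _ _).comp ((Φ : Cn N →L[ℝ] Rn m × Rn d).comp
        (fderiv ℝ (graphPar Φ h) 0))) 0 :=
    (Φ.hasFDerivAt.comp 0
      (analyticAt_graphPar hM.1).differentiableAt.hasFDerivAt).fst
  simp only [chart_graphPar] at h1
  have h2 := h1.unique (hasFDerivAt_id (𝕜 := ℝ) (0 : Rn m))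
  refine (injective_iff_map_eq_zero _).2 fun v hv => ?_
  have := congrArg (· v) h2
  simpa [hv] using this.symm

/-- Defining functions of graphs which agree to order `k` agree to order `k`. -/
theorem closeTo_graphDef (hM : IsGraphOver Φ h M) {M' : Set (Cn N)} (hM' : IsGraphOver Φ h' M')
    {k : ℕ} (hk : VanishesToOrder k fun x => h x - h' x) (j : Fin d) :
    CloseTo k (cpt (graphDef Φ h) j) (cpt (graphDef Φ h') j) := by
  refine ⟨analyticAt_cpt (analyticAt_graphDef hM.eventually_analyticAt.self_of_nhds) j,
    analyticAt_cpt (analyticAt_graphDef hM'.eventually_analyticAt.self_of_nhds) j, ?_⟩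
  have h1 : (fun z : Cn N => h (Φ z).1 - h' (Φ z).1) =O[𝓝 0] fun z => ‖z‖ ^ k := by
    refine (hk.comp_tendsto (tendsto_chart_fst Φ)).trans ?_
    refine IsBigO.pow (IsBigO.norm_norm ?_) k
    exact ((ContinuousLinearMap.fst ℝ _ _).comp
      (Φ : Cn N →L[ℝ] Rn m × Rn d)).isBigO_id _
  have h2 := VanishesToOrder.continuousLinearMap_comp h1
    (-(Complex.ofRealCLM.comp (ContinuousLinearMap.proj (R := ℝ) (φ := fun _ : Fin d => ℝ) j)))
  refine h2.congr_left fun z => ?_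
  simp [cpt, graphDef]

end IsGraphOver

end Charts

section Approximation

open Filter Topology Asymptotics

variable {N d m k : ℕ} {M M' : Set (Cn N)}

/-- `H` is a local biholomorphism with inverse `G` fixing the origin and mapping the submanifold
`M`, parametrized by `Z`, to `M'` up to order `k`. -/
structure IsApproxEquiv (d k : ℕ) (M M' : Set (Cn N)) (H G : Cn N → Cn N) (Z : Rn m → Cn N) :
    Prop where
  analyticAt : AnalyticAt ℂ H 0
  analyticAt_inv : AnalyticAt ℂ G 0
  apply_zero : H 0 = 0
  left_inv : ∀ᶠ z in 𝓝 0, G (H z) = z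
  right_inv : ∀ᶠ y in 𝓝 0, H (G y) = y
  analyticAt_param : AnalyticAt ℝ Z 0
  param_zero : Z 0 = 0
  injective_param : Function.Injective (fderiv ℝ Z 0)
  mem : ∀ᶠ x in 𝓝 0, Z x ∈ M
  vanishes : ∀ U ρ, IsDefiningFun N d M' 0 U ρ → VanishesToOrder k fun x => ρ (H (Z x))

theorem IsKEquivalence.exists_isApproxEquiv {H : Cn N → Cn N}
    (h : IsKEquivalence N d M M' 0 0 k H) :
    ∃ (G : Cn N → Cn N) (Z : Rn (2 * N - d) → Cn N), IsApproxEquiv d k M M' H G Z := by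
  obtain ⟨hH, hH0, hb, Ω, Z, ⟨hΩ, h0Ω, hZ0, hZa, -, hZi, U, hU, h0U, hZU⟩, hv⟩ := h
  obtain ⟨G, hG, -, hGl, hGr⟩ := exists_analyticAt_local_inverse hH hb.1 rfl
  rw [hH0] at hG hGr
  refine ⟨G, Z, hH, hG, hH0, hGl, hGr, hZa 0 h0Ω, hZ0, hZi 0 h0Ω, ?_, fun U' ρ' hρ' => ?_⟩
  · filter_upwards [hΩ.mem_nhds h0Ω] with x hx
    exact (hZU ▸ Set.mem_image_of_mem Z hx : Z x ∈ M ∩ U).1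
  · obtain ⟨C, ε, hε, hC⟩ := hv U' ρ' hρ'
    refine IsBigO.of_bound C ?_
    filter_upwards [Metric.ball_mem_nhds 0 hε] with x hx
    simpa using hC x (mem_ball_zero_iff.1 hx)

theorem VanishesToOrder.fderiv_eq_zero {E F : Type*} [NormedAddCommGroup E] [NormedSpace ℝ E]
    [NormedAddCommGroup F] [NormedSpace ℝ F] [CompleteSpace F] {f : E → F}
    (h : VanishesToOrder k f) (hk : 1 < k) (hf : AnalyticAt ℝ f 0) : fderiv ℝ f 0 = 0 :=
  VanishesToOrder.apply_zero (k := 1) (VanishesToOrder.fderiv hf (h.mono hk)) one_pos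

namespace IsApproxEquiv

variable {H G : Cn N → Cn N} {Z : Rn m → Cn N} {Φ : Cn N ≃L[ℝ] Rn m × Rn d} {h' : Rn m → Rn d}

theorem inv_zero (h : IsApproxEquiv d k M M' H G Z) : G 0 = 0 := by
  simpa [h.apply_zero] using h.left_inv.self_of_nhds

theorem isLocalBihol (h : IsApproxEquiv d k M M' H G Z) : IsLocalBihol H G M (G ⁻¹' M) 0 := by
  refine ⟨h.analyticAt, by rw [h.apply_zero]; exact h.analyticAt_inv, h.left_inv,
    by rw [h.apply_zero]; exact h.right_inv, ?_⟩
  filter_upwards [h.left_inv] with z hz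
  rw [Set.mem_preimage, hz]

theorem tendsto_param (h : IsApproxEquiv d k M M' H G Z) : Tendsto Z (𝓝 0) (𝓝 0) := by
  simpa only [h.param_zero] using h.analyticAt_param.continuousAt.tendsto

/-- The image of `M` is a graph in every chart in which `M'` is a graph, and the two graphs agree
to order `k`. -/
theorem exists_graph (h : IsApproxEquiv d k M M' H G Z) (hk : 1 < k) {U : Set (Cn N)}
    {ρ : Cn N → Rn d} (hρ : IsDefiningFun N d M 0 U ρ) (h0 : 0 ∈ M)
    (hM' : IsGraphOver Φ h' M') :
    ∃ ht, IsGraphOver Φ ht (G ⁻¹' M) ∧ VanishesToOrder k fun x => ht x - h' x := by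
  have hG0 := h.inv_zero
  have hdim : m + d = 2 * N := by
    have := Φ.toLinearEquiv.finrank_eq
    rw [finrank_real_Cn, Module.finrank_prod, Module.finrank_fin_fun,
      Module.finrank_fin_fun] at this
    exact this.symm
  let Y : Rn m → Cn N := fun x => H (Z x)
  have hY0 : Y 0 = 0 := by simp only [Y, h.param_zero, h.apply_zero]
  have hHr : AnalyticAt ℝ H 0 := h.analyticAt.restrictScalars
  have hGr : AnalyticAt ℝ G 0 := h.analyticAt_inv.restrictScalars
  have hY : AnalyticAt ℝ Y 0 :=
    AnalyticAt.comp (g := H) (by rwa [h.param_zero]) h.analyticAt_param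
  have hYt : Tendsto Y (𝓝 0) (𝓝 0) := by
    simpa only [hY0] using hY.continuousAt.tendsto
  have hGY : ∀ᶠ x in 𝓝 0, G (Y x) = Z x := h.tendsto_param.eventually h.left_inv
  have hcomp : ∀ {F : Type} [NormedAddCommGroup F] [NormedSpace ℝ F] {f : Cn N → F},
      AnalyticAt ℝ f 0 → HasFDerivAt (fun x => f (Y x))
        ((fderiv ℝ f 0).comp (fderiv ℝ Y 0)) 0 := fun {F} _ _ {f} hf =>
    HasFDerivAt.comp (g := f) 0 (by rw [hY0]; exact hf.differentiableAt.hasFDerivAt)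
      hY.differentiableAt.hasFDerivAt
  have hYi : Function.Injective (fderiv ℝ Y 0) := by
    have e : fderiv ℝ Z 0 = (fderiv ℝ G 0).comp (fderiv ℝ Y 0) :=
      ((hcomp hGr).congr_of_eventuallyEq (hGY.mono fun x hx => hx.symm)).fderiv
    have := h.injective_param
    rw [e] at this
    exact Function.Injective.of_comp (f := fderiv ℝ G 0) this
  obtain ⟨Ut, hρt⟩ := h.isLocalBihol.symm.isDefiningFun_comp (U := U) (ρ := ρ)
    (by rwa [h.apply_zero, hG0])
  rw [h.apply_zero] at hρt
  have hYM : ∀ᶠ x in 𝓝 0, Y x ∈ G ⁻¹' M := by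
    filter_upwards [hGY, h.mem] with x h1 h2
    rwa [Set.mem_preimage, h1]
  obtain ⟨U', hρ'⟩ := hM'.exists_isDefiningFun
  have hρ'a := hρ'.2.2.1 0 hρ'.2.1
  have htan : ∀ x, (Φ (fderiv ℝ Y 0 x)).1 = 0 → fderiv ℝ Y 0 x = 0 := by
    intro x hx
    have h1 : fderiv ℝ (fun x => graphDef Φ h' (Y x)) 0 = 0 :=
      (h.vanishes _ _ hρ').fderiv_eq_zero hk
        (AnalyticAt.comp (g := graphDef Φ h') (f := Y) (by rwa [hY0]) hY)
    rw [(hcomp hρ'a).fderiv] at h1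
    have h2 := congrArg (· x) h1
    have h3 : fderiv ℝ (graphDef Φ h') 0 (fderiv ℝ Y 0 x) = 0 := h2
    rw [fderiv_graphDef hM'.eventually_analyticAt.self_of_nhds, hx, map_zero, sub_zero] at h3
    exact Φ.map_eq_zero_iff.1 (Prod.ext hx h3)
  obtain ⟨ht, hht⟩ := hρt.exists_graph (by rwa [Set.mem_preimage, hG0]) Φ (by
    intro v hv1 hv2
    have hle : LinearMap.range (fderiv ℝ Y 0 : Rn m →ₗ[ℝ] Cn N)
        ≤ LinearMap.ker (fderiv ℝ (fun z => ρ (G z)) 0 : Cn N →ₗ[ℝ] Rn d) := by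
      rintro _ ⟨x, rfl⟩
      have h1 := hcomp (hρt.2.2.1 0 hρt.2.1)
      have h2 : HasFDerivAt (fun x => ρ (G (Y x))) (0 : Rn m →L[ℝ] Rn d) 0 := by
        refine (hasFDerivAt_const 0 0).congr_of_eventuallyEq ?_
        filter_upwards [hYM, hYt.eventually (hρt.1.mem_nhds hρt.2.1)] with x h3 h4
        exact (hρt.2.2.2.1 _ h4).1 h3
      exact congrArg (· x) (h1.unique h2)
    have heq := Submodule.eq_of_le_of_finrank_eq hle (by
      rw [hρt.finrank_ker, LinearMap.finrank_range_of_inj hYi, Module.finrank_fin_fun]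
      omega)
    have hv : v ∈ LinearMap.range (fderiv ℝ Y 0 : Rn m →ₗ[ℝ] Cn N) := heq ▸ hv2
    obtain ⟨x, rfl⟩ := hv
    exact htan x hv1)
  refine ⟨ht, hht, ?_⟩
  let T : Cn N →L[ℝ] Rn m := (ContinuousLinearMap.fst ℝ _ _).comp (Φ : Cn N →L[ℝ] Rn m × Rn d)
  let φ : Rn m → Rn m := fun x => T (Y x)
  have hφ : AnalyticAt ℝ φ 0 := (T.analyticAt _).comp hY
  have hφ0 : φ 0 = 0 := by simp only [φ, hY0, map_zero]
  obtain ⟨χ, hχ, hχ0, -, hφχ⟩ := exists_analyticAt_local_inverse hφ (by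
    refine (injective_iff_map_eq_zero _).2 fun x hx => ?_
    rw [(hcomp (T.analyticAt 0)).fderiv, T.fderiv] at hx
    exact (injective_iff_map_eq_zero _).1 hYi x (htan x hx)) rfl
  rw [hφ0] at hχ hχ0 hφχ
  have hχt : Tendsto χ (𝓝 0) (𝓝 0) := by
    simpa only [hχ0] using hχ.continuousAt.tendsto
  have hO : χ =O[𝓝 0] fun y => y := by
    have := hχ.differentiableAt.isBigO_sub
    simpa [hχ0] using this
  have h1 : (fun y => graphDef Φ h' (Y (χ y))) =O[𝓝 0] fun y => ‖y‖ ^ k :=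
    ((h.vanishes _ _ hρ').comp_tendsto hχt).trans (hO.norm_norm.pow k)
  refine h1.congr' ?_ .rfl
  filter_upwards [hφχ, hχt.eventually hYM, hχt.eventually (hYt.eventually hht.mem_iff)]
    with y h2 h3 h4
  have h5 : (Φ (Y (χ y))).1 = y := h2
  rw [graphDef, h4.1 h3, h5]

theorem _root_.vanishesToOrder_graphPar_sub {h h' : Rn m → Rn d}
    (hv : VanishesToOrder k fun x => h x - h' x) :
    VanishesToOrder k fun x => graphPar Φ h x - graphPar Φ h' x := by
  refine (hv.continuousLinearMap_comp ((Φ.symm : Rn m × Rn d →L[ℝ] Cn N).comp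
    (ContinuousLinearMap.inr ℝ _ _))).congr_left fun x => ?_
  simp [graphPar, ← map_sub]

theorem exists_symm (h : IsApproxEquiv d k M M' H G Z) (hk : 1 < k) {U : Set (Cn N)}
    {ρ : Cn N → Rn d} (hρ : IsDefiningFun N d M 0 U ρ) (h0 : 0 ∈ M)
    (hM' : IsGraphOver Φ h' M') : IsApproxEquiv d k M' M G H (graphPar Φ h') := by
  obtain ⟨ht, hht, hv⟩ := h.exists_graph hk hρ h0 hM'
  refine ⟨h.analyticAt_inv, h.analyticAt, h.inv_zero, h.right_inv, h.left_inv,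
    analyticAt_graphPar hM'.1, hM'.graphPar_zero, hM'.injective_fderiv_graphPar,
    hM'.eventually_graphPar_mem, fun U₁ ρ₁ hρ₁ => ?_⟩
  have hGr : AnalyticAt ℝ G 0 := h.analyticAt_inv.restrictScalars
  have hf : AnalyticAt ℝ (fun z => ρ₁ (G z)) 0 :=
    AnalyticAt.comp (g := ρ₁) (by rw [h.inv_zero]; exact hρ₁.2.2.1 0 hρ₁.2.1) hGr
  have hlip := hf.hasStrictFDerivAt.isBigO_sub
  have htend : Tendsto (fun x => (graphPar Φ h' x, graphPar Φ ht x)) (𝓝 0) (𝓝 (0, 0)) :=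
    hM'.tendsto_graphPar.prodMk_nhds hht.tendsto_graphPar
  have h1 : (fun x => ρ₁ (G (graphPar Φ h' x)) - ρ₁ (G (graphPar Φ ht x))) =O[𝓝 0]
      fun x => graphPar Φ h' x - graphPar Φ ht x := hlip.comp_tendsto htend
  have h2 : VanishesToOrder k fun x => graphPar Φ ht x - graphPar Φ h' x :=
    vanishesToOrder_graphPar_sub hv
  refine (h1.trans (h2.neg_left.congr_left fun x => neg_sub _ _)).congr' ?_ .rfl
  have hGt : Tendsto G (𝓝 0) (𝓝 0) := by
    simpa only [h.inv_zero] using hGr.continuousAt.tendsto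
  filter_upwards [hht.eventually_graphPar_mem,
    hht.tendsto_graphPar.eventually (hGt.eventually (hρ₁.1.mem_nhds hρ₁.2.1))] with x h3 h4
  rw [(hρ₁.2.2.2.1 _ h4).1 h3, sub_zero]

end IsApproxEquiv

end Approximation

section RankPrinciple

open Filter Topology Asymptotics

variable {ι n : Type*} [Fintype n] {R : ℕ}

theorem exists_mul_eq_one_of_lt_finrank (v : ι → n → ℂ)
    (hR : R < Module.finrank ℂ (Submodule.span ℂ (Set.range v))) :
    ∃ (a : Fin (R + 1) → ι) (P : Matrix n (Fin (R + 1)) ℂ),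
      (Matrix.of fun b => v (a b)) * P = 1 := by
  classical
  obtain ⟨f, hf, -, hli⟩ := Submodule.exists_fun_fin_finrank_span_eq ℂ (Set.range v)
  choose a ha using hf
  let A : Matrix (Fin (R + 1)) n ℂ := Matrix.of fun b => v (a (Fin.castLE hR b))
  have hA : LinearIndependent ℂ A.row := by
    have : A.row = f ∘ Fin.castLE hR := funext fun b => ha _
    rw [this]
    exact hli.comp _ (Fin.castLE_injective hR)
  refine ⟨fun b => a (Fin.castLE hR b), ?_⟩
  obtain ⟨g, hg⟩ := (Matrix.mulVecLin A).exists_rightInverse_of_surjective (by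
    rw [LinearMap.range_eq_top]
    apply LinearMap.range_eq_top.1
    apply Submodule.eq_top_of_finrank_eq
    rw [Module.finrank_fin_fun]
    exact hA.rank_matrix.trans (Fintype.card_fin _))
  refine ⟨LinearMap.toMatrix' g, ?_⟩
  apply Matrix.toLin'.injective
  rw [Matrix.toLin'_mul, Matrix.toLin'_toMatrix', Matrix.toLin'_one]
  exact hg

theorem det_mul_eq_zero_of_finrank_le (v : ι → n → ℂ)
    (hR : Module.finrank ℂ (Submodule.span ℂ (Set.range v)) ≤ R) (a : Fin (R + 1) → ι)
    (P : Matrix n (Fin (R + 1)) ℂ) : ((Matrix.of fun b => v (a b)) * P).det = 0 := by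
  by_contra hne
  have h1 := Matrix.rank_of_isUnit _ ((Matrix.isUnit_iff_isUnit_det _).2 (isUnit_iff_ne_zero.2 hne))
  have h2 := Matrix.rank_mul_le_left (Matrix.of fun b => v (a b)) P
  have h3 : (Matrix.of fun b => v (a b)).rank ≤ R := by
    rw [Matrix.rank_eq_finrank_span_row]
    refine (Submodule.finrank_mono (Submodule.span_mono ?_)).trans hR
    rintro _ ⟨b, rfl⟩
    exact ⟨a b, rfl⟩
  rw [Fintype.card_fin] at h1
  omega

/-- A family of functions near the origin which is approximated to arbitrary order by families of
rank at most `R` along approximations of a submanifold has rank at most `R` there. -/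
theorem eventually_finrank_le_of_approx {N m : ℕ} {F' : ι → n → Cn N → ℂ} {Z' : Rn m → Cn N}
    (hZ' : AnalyticAt ℝ Z' 0) (hZ0 : Z' 0 = 0)
    (hF' : ∀ᶠ z in 𝓝 0, ∀ s i, AnalyticAt ℝ (F' s i) z)
    (happ : ∀ (t : Finset ι) (k : ℕ), ∃ (Z : Rn m → Cn N) (F : ι → n → Cn N → ℂ),
      VanishesToOrder k (fun x => Z x - Z' x) ∧ AnalyticAt ℝ Z 0 ∧ Z 0 = 0 ∧
      (∀ s ∈ t, ∀ i, CloseTo k (F s i) (F' s i)) ∧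
      ∀ᶠ x in 𝓝 0, Module.finrank ℂ
        (Submodule.span ℂ (Set.range fun s => fun i => F s i (Z x))) ≤ R) :
    ∀ᶠ x in 𝓝 0, Module.finrank ℂ
      (Submodule.span ℂ (Set.range fun s => fun i => F' s i (Z' x))) ≤ R := by
  classical
  have hZt : Tendsto Z' (𝓝 0) (𝓝 0) := by simpa only [hZ0] using hZ'.continuousAt.tendsto
  obtain ⟨r, hr, hball⟩ := Metric.eventually_nhds_iff_ball.1
    (hZ'.eventually_analyticAt.and (hZt.eventually hF'))
  filter_upwards [Metric.ball_mem_nhds 0 hr] with x₀ hx₀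
  by_contra! hlt
  obtain ⟨a, P, haP⟩ := exists_mul_eq_one_of_lt_finrank _ hlt
  let D : (ι → n → Cn N → ℂ) → Cn N → ℂ := fun F z =>
    ((Matrix.of fun b i => F (a b) i z) * P).det
  have hDa : ∀ z, (∀ s i, AnalyticAt ℝ (F' s i) z) → AnalyticAt ℝ (D F') z := by
    intro z hz
    refine analyticAt_det fun b c => ?_
    simp only [Matrix.mul_apply]
    exact Finset.analyticAt_fun_sum _ fun i _ => (hz _ _).fun_mul analyticAt_const
  have hana : AnalyticOnNhd ℝ (fun x => D F' (Z' x)) (Metric.ball 0 r) := fun x hx =>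
    (hDa _ (hball x hx).2).comp (hball x hx).1
  have hz : ∀ᶠ x in 𝓝 0, D F' (Z' x) = 0 := by
    refine eventually_eq_zero_of_vanishesToOrder (hana 0 (Metric.mem_ball_self hr)) fun k => ?_
    obtain ⟨Z, F, hZZ, hZ, hZ00, hFF, hrank⟩ := happ (Finset.univ.image a) k
    have hcl : CloseTo k (D F) (D F') := by
      refine CloseTo.det fun b c => ?_
      simp only [Matrix.mul_apply]
      exact CloseTo.sum fun i _ => (hFF _ (by simp) i).mul (CloseTo.const _)
    have htZ : Tendsto Z (𝓝 0) (𝓝 0) := by simpa only [hZ00] using hZ.continuousAt.tendsto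
    have hO : Z =O[𝓝 0] fun x => x := by
      simpa [hZ00] using hZ.differentiableAt.isBigO_sub
    have hDF : ∀ᶠ x in 𝓝 0, D F (Z x) = 0 :=
      hrank.mono fun x hx => det_mul_eq_zero_of_finrank_le _ hx a P
    clear_value D
    have h1 : (fun x => D F (Z x) - D F' (Z x)) =O[𝓝 0] fun x => ‖x‖ ^ k :=
      (Asymptotics.IsBigO.comp_tendsto hcl.diff htZ).trans (hO.norm_norm.pow k)
    have h2 : (fun x => D F' (Z x) - D F' (Z' x)) =O[𝓝 0] fun x => Z x - Z' x :=
      hcl.right.hasStrictFDerivAt.isBigO_sub.comp_tendsto (htZ.prodMk_nhds hZt)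
    have h3 := h1.add (h2.trans hZZ)
    refine (h3.neg_left).congr' ?_ .rfl
    filter_upwards [hDF] with x hx
    simp [hx]
  have : D F' (Z' x₀) = 0 := hana.eqOn_zero_of_preconnected_of_eventuallyEq_zero
    (convex_ball _ _).isPreconnected (Metric.mem_ball_self hr) hz hx₀
  have hone : D F' (Z' x₀) = 1 := by
    simp only [D]
    rw [haP, Matrix.det_one]
  rw [hone] at this
  exact one_ne_zero this

/-- Rank at a point under approximation by families of rank at most `R` at that point. -/
theorem finrank_le_of_forall_finset {v : ι → n → ℂ}
    (happ : ∀ t : Finset ι, ∃ w : ι → n → ℂ, (∀ s ∈ t, w s = v s) ∧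
      Module.finrank ℂ (Submodule.span ℂ (Set.range w)) ≤ R) :
    Module.finrank ℂ (Submodule.span ℂ (Set.range v)) ≤ R := by
  classical
  by_contra! hlt
  obtain ⟨a, P, haP⟩ := exists_mul_eq_one_of_lt_finrank _ hlt
  obtain ⟨w, hw, hR⟩ := happ (Finset.univ.image a)
  have h1 := det_mul_eq_zero_of_finrank_le w hR a P
  have h2 : (fun b => w (a b)) = fun b => v (a b) := funext fun b => hw _ (by simp)
  rw [h2, haP, Matrix.det_one] at h1
  exact one_ne_zero h1

end RankPrinciple

section Transfer

open Filter Topology Asymptotics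

variable {N d m : ℕ} {M M' : Set (Cn N)} {U : Set (Cn N)} {ρ : Cn N → Rn d}
  {Φ : Cn N ≃L[ℝ] Rn m × Rn d} {h' : Rn m → Rn d}

/-- Upper bounds near the origin for the function `δ₁` on `M` are inherited by `δ₂` on `M'`. -/
def BoundsTransfer (M M' : Set (Cn N)) (δ₁ δ₂ : Cn N → ℕ) : Prop :=
  δ₂ 0 ≤ δ₁ 0 ∧
    ∀ R, (∀ᶠ q in 𝓝 0, q ∈ M → δ₁ q ≤ R) → ∀ᶠ q in 𝓝 0, q ∈ M' → δ₂ q ≤ R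

/-- `M` and `M'` are equivalent to every finite order at the origin, by maps modelled on a
parametrization with parameter space of dimension `m`. -/
def IsApproxEquivAllOrders (d : ℕ) (M M' : Set (Cn N)) (m : ℕ) : Prop :=
  ∀ k, 1 < k → ∃ (H G : Cn N → Cn N) (Z : Rn m → Cn N), IsApproxEquiv d k M M' H G Z

theorem IsApproxEquivAllOrders.symm (h : IsApproxEquivAllOrders d M M' m)
    (hρ : IsDefiningFun N d M 0 U ρ) (h0 : 0 ∈ M) (hM' : IsGraphOver Φ h' M') :
    IsApproxEquivAllOrders d M' M m := by
  intro k hk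
  obtain ⟨H, G, Z, hA⟩ := h k hk
  exact ⟨G, H, _, hA.exists_symm hk hρ h0 hM'⟩

/-- Invariants computed by the rank of a family of functions built from a defining function are
transferred between submanifolds equivalent to every finite order. -/
theorem IsApproxEquivAllOrders.boundsTransfer {ι n : Type*} [Fintype n]
    (h : IsApproxEquivAllOrders d M M' m) (hρ : IsDefiningFun N d M 0 U ρ) (h0 : 0 ∈ M)
    (hM' : IsGraphOver Φ h' M') (δ : Set (Cn N) → Cn N → ℕ)
    (F : (Cn N → Rn d) → ι → n → Cn N → ℂ)
    (hF : ∀ ρ z, AnalyticAt ℝ ρ z → ∀ s i, AnalyticAt ℝ (F ρ s i) z)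
    (hclose : ∀ s k, ∃ l, ∀ ρ ρ', (∀ j, CloseTo l (cpt ρ j) (cpt ρ' j)) →
      ∀ i, CloseTo k (F ρ s i) (F ρ' s i))
    (hmono : ∀ {H G Mt q}, IsLocalBihol H G M Mt q → q ∈ M →
      (∃ U ρ, IsDefiningFun N d Mt (H q) U ρ) → δ Mt (H q) ≤ δ M q)
    (hδ : ∀ᶠ z in 𝓝 0, z ∈ M' → δ M' z
      = Module.finrank ℂ (Submodule.span ℂ (Set.range fun s i => F (graphDef Φ h') s i z)))
    (hδt : ∀ (H G : Cn N → Cn N) ht, IsLocalBihol H G M (G ⁻¹' M) 0 → H 0 = 0 → G 0 = 0 →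
      IsGraphOver Φ ht (G ⁻¹' M) →
      (∀ j, CloseTo 2 (cpt (graphDef Φ ht) j) (cpt (graphDef Φ h') j)) →
      ∀ᶠ z in 𝓝 0, z ∈ G ⁻¹' M →
        Module.finrank ℂ (Submodule.span ℂ (Set.range fun s i => F (graphDef Φ ht) s i z))
          ≤ δ (G ⁻¹' M) z) :
    BoundsTransfer M M' (δ M) (δ M') := by
  have key : ∀ (t : Finset ι) (k : ℕ), ∃ (G : Cn N → Cn N) (ht : Rn m → Rn d),
      Tendsto G (𝓝 0) (𝓝 0) ∧ G 0 = 0 ∧ IsGraphOver Φ ht (G ⁻¹' M) ∧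
      VanishesToOrder k (fun x => ht x - h' x) ∧
      (∀ s ∈ t, ∀ i, CloseTo k (F (graphDef Φ ht) s i) (F (graphDef Φ h') s i)) ∧
      ∀ᶠ z in 𝓝 0, z ∈ G ⁻¹' M →
        Module.finrank ℂ (Submodule.span ℂ (Set.range fun s i => F (graphDef Φ ht) s i z))
          ≤ δ M (G z) := by
    intro t k
    choose l hl using fun s => hclose s k
    obtain ⟨H, G, Z, hA⟩ := h (t.sup l + k + 2) (by omega)
    obtain ⟨ht, hgr, hv⟩ := hA.exists_graph (by omega) hρ h0 hM'
    have hc : ∀ j, CloseTo (t.sup l + k + 2) (cpt (graphDef Φ ht) j) (cpt (graphDef Φ h') j) :=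
      hgr.closeTo_graphDef hM' hv
    have hG0 := hA.inv_zero
    have hB := hA.isLocalBihol
    have hGt : Tendsto G (𝓝 0) (𝓝 0) := by
      simpa only [hG0] using hA.analyticAt_inv.continuousAt.tendsto
    refine ⟨G, ht, hGt, hG0, hgr, hv.mono (by omega), fun s hs => hl s _ _ fun j =>
      (hc j).mono (by have := Finset.le_sup (f := l) hs; omega), ?_⟩
    obtain ⟨Ut, hUt⟩ := hgr.exists_isDefiningFun
    filter_upwards [hδt H G ht hB hA.apply_zero hG0 hgr fun j => (hc j).mono (by omega),
      hGt.eventually hB.eventually, hA.right_inv, hUt.1.mem_nhds hUt.2.1] with z h1 h2 h3 h4 hz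
    refine (h1 hz).trans ?_
    have := hmono h2 hz ⟨Ut, _, by rw [h3]; exact hUt.of_mem h4⟩
    rwa [h3] at this
  constructor
  · rw [hδ.self_of_nhds hM'.zero_mem]
    refine finrank_le_of_forall_finset fun t => ?_
    obtain ⟨G, ht, -, hG0, hgr, -, hc, hle⟩ := key t 1
    refine ⟨fun s i => F (graphDef Φ ht) s i 0, fun s hs => funext fun i => ?_, ?_⟩
    · exact sub_eq_zero.1 ((hc s hs i).diff.apply_zero one_pos)
    · have := hle.self_of_nhds hgr.zero_mem
      rwa [hG0] at this
  · intro R hR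
    obtain ⟨U', hU'⟩ := hM'.exists_isDefiningFun
    have := eventually_finrank_le_of_approx (R := R) (F' := F (graphDef Φ h'))
      (analyticAt_graphPar hM'.1) hM'.graphPar_zero
      (Filter.mem_of_superset (hU'.1.mem_nhds hU'.2.1) fun z hz => hF _ _ (hU'.2.2.1 z hz))
      (by
        intro t k
        obtain ⟨G, ht, hGt, -, hgr, hv, hc, hle⟩ := key t k
        refine ⟨graphPar Φ ht, F (graphDef Φ ht), ?_, analyticAt_graphPar hgr.1,
          hgr.graphPar_zero, hc, ?_⟩
        · exact vanishesToOrder_graphPar_sub hv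
        · filter_upwards [hgr.eventually_graphPar_mem, hgr.tendsto_graphPar.eventually hle,
            hgr.tendsto_graphPar.eventually (hGt.eventually hR)] with x h1 h2 h3
          exact (h2 h1).trans (h3 h1))
    filter_upwards [hδ, hM'.eventually_eq_graphPar, (tendsto_chart_fst Φ).eventually this]
      with z h1 h2 h3 hz
    rw [h1 hz]
    rwa [← h2 hz] at h3

end Transfer

section Invariants

open Filter Topology Matrix

variable {N d m : ℕ} {M M' : Set (Cn N)} {U : Set (Cn N)} {ρ : Cn N → Rn d}
  {Φ : Cn N ≃L[ℝ] Rn m × Rn d} {h h' : Rn m → Rn d}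

theorem rank_le_rank_of_det_interp_ne_zero {m n : Type*} [Fintype m] [Fintype n] [DecidableEq n]
    {B₀ B : Matrix m n ℂ} {S : Matrix n m ℂ} (h1 : B₀ * S * B₀ = B₀)
    (hdet : (interp S B₀ B).det ≠ 0) : B₀.rank ≤ B.rank := by
  have h2 : B₀ * interp S B₀ B = B₀ * S * B := by
    rw [interp, Matrix.mul_add, Matrix.mul_sub, Matrix.mul_one, ← Matrix.mul_assoc,
      ← Matrix.mul_assoc, h1, sub_self, add_zero]
  have h3 : B₀ = B₀ * S * B * (interp S B₀ B)⁻¹ := by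
    rw [← h2, Matrix.mul_assoc, Matrix.mul_nonsing_inv _ (isUnit_iff_ne_zero.2 hdet),
      Matrix.mul_one]
  calc B₀.rank = (B₀ * S * B * (interp S B₀ B)⁻¹).rank := congrArg _ h3
    _ ≤ (B₀ * S * B).rank := Matrix.rank_mul_le_left _ _
    _ ≤ B.rank := Matrix.rank_mul_le_right _ _

theorem eventually_det_interp_ne_zero {q : Cn N} (hρ : AnalyticAt ℝ ρ q)
    (S : Matrix (Fin N) (Fin d) ℂ) :
    ∀ᶠ z in 𝓝 q, (interp S (dbarMatrix ρ q) (dbarMatrix ρ z)).det ≠ 0 :=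
  (analyticAt_det fun i j => analyticAt_interp hρ i j).continuousAt.eventually_ne (by
    rw [interp_self, Matrix.det_one]; exact one_ne_zero)

/-- The coefficient vectors of tangent fields lie in a space of dimension `2 * N - d`. -/
theorem finrank_orbitSpan_le_of_isConstRightInverse {q : Cn N} (hq : q ∈ M)
    (hρ : IsDefiningFun N d M q U ρ) {R : Fin d → Cn N} (hR : IsConstRightInverse ρ q R) :
    Module.finrank ℂ (orbitSpan N d M q) ≤ 2 * N - d := by
  let T : (Fin N ⊕ Fin N → ℂ) →ₗ[ℂ] (Fin d → ℂ) :=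
    Matrix.mulVecLin (Matrix.of fun j s => pd s (cpt ρ j) q)
  have hT : ∀ v j, T v j = ∑ s, pd s (cpt ρ j) q * v s := fun v j => rfl
  have hsurj : LinearMap.range T = ⊤ := by
    rw [eq_top_iff, ← (Pi.basisFun ℂ (Fin d)).span_eq, Submodule.span_le]
    rintro _ ⟨l, rfl⟩
    refine ⟨fun s => coordFn s (R l), funext fun j => ?_⟩
    rw [hT, ← fderiv_apply_eq_sum_pd, fderiv_cpt (hρ.2.2.1 q hρ.2.1), hR.self_of_nhds l]
    by_cases hj : j = l
    · subst hj; simp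
    · simp [hj]
  have hle : orbitSpan N d M q ≤ LinearMap.ker T := by
    rw [orbitSpan, Submodule.span_le]
    rintro _ ⟨X, hX, rfl⟩
    refine LinearMap.mem_ker.2 (funext fun j => ?_)
    have := ((hX.tangentNear hq hρ).applyC_cpt hρ).self_of_nhds hq j
    rw [hT, Pi.zero_apply, ← this]
    exact Finset.sum_congr rfl fun s _ => mul_comm _ _
  have h1 := Submodule.finrank_mono hle
  have h2 := T.finrank_range_add_finrank_ker
  rw [hsurj, finrank_top, Module.finrank_fin_fun, Module.finrank_fintype_fun_eq_card,
    Fintype.card_sum, Fintype.card_fin] at h2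
  omega

namespace IsGraphOver

theorem eventually_isDefiningFun (hM : IsGraphOver Φ h M) :
    ∀ᶠ z in 𝓝 0, ∃ U, IsDefiningFun N d M z U (graphDef Φ h) := by
  obtain ⟨U, hU⟩ := hM.exists_isDefiningFun
  filter_upwards [hU.1.mem_nhds hU.2.1] with z hz using ⟨U, hU.of_mem hz⟩

theorem eventually_finrank_gradSpace (hM : IsGraphOver Φ h M) :
    ∀ᶠ z in 𝓝 0, z ∈ M →
      Module.finrank ℂ (gradSpace N d M z) = (dbarMatrix (graphDef Φ h) z).rank := by
  filter_upwards [hM.eventually_isDefiningFun, hM.eventually_analyticAt] with z ⟨U, hU⟩ hz hm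
  exact finrank_gradSpace hm hU (isConstRightInverse_graphDef hz)

theorem eventually_finrank_gradSpace_le (hM : IsGraphOver Φ h M) :
    ∀ᶠ z in 𝓝 0, z ∈ M → Module.finrank ℂ (gradSpace N d M z) ≤ d := by
  filter_upwards [hM.eventually_finrank_gradSpace] with z hz hm
  rw [hz hm]
  exact (Matrix.rank_le_card_height _).trans_eq (Fintype.card_fin d)

theorem eventually_le_finrank_gradSpace (hM : IsGraphOver Φ h M) :
    ∀ᶠ z in 𝓝 0, z ∈ M →
      Module.finrank ℂ (gradSpace N d M 0) ≤ Module.finrank ℂ (gradSpace N d M z) := by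
  obtain ⟨U, hU⟩ := hM.exists_isDefiningFun
  obtain ⟨S, h1, -⟩ := exists_reflexive_generalized_inverse (dbarMatrix (graphDef Φ h) 0)
  filter_upwards [hM.eventually_finrank_gradSpace,
    eventually_det_interp_ne_zero (hU.2.2.1 0 hU.2.1) S] with z h2 h3 hm
  rw [h2 hm, hM.eventually_finrank_gradSpace.self_of_nhds hM.zero_mem]
  exact rank_le_rank_of_det_interp_ne_zero h1 h3

theorem eventually_finrank_orbitSpan_le (hM : IsGraphOver Φ h M) :
    ∀ᶠ z in 𝓝 0, z ∈ M → Module.finrank ℂ (orbitSpan N d M z) ≤ 2 * N - d := by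
  filter_upwards [hM.eventually_isDefiningFun, hM.eventually_analyticAt] with z ⟨U, hU⟩ hz hm
  exact finrank_orbitSpan_le_of_isConstRightInverse hm hU (isConstRightInverse_graphDef hz)

/-- Near the origin, `crFrame` is a frame of `(0,1)` fields as soon as the dimension of the
span of the complex gradients does not jump. -/
theorem eventually_isCRFrameAt (hM : IsGraphOver Φ h M) {B₀ : Matrix (Fin d) (Fin N) ℂ}
    {S : Matrix (Fin N) (Fin d) ℂ} (h1 : B₀ * S * B₀ = B₀) (h2 : S * B₀ * S = S)
    (hB : dbarMatrix (graphDef Φ h) 0 = B₀)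
    (hr : ∀ᶠ z in 𝓝 0, z ∈ M → Module.finrank ℂ (gradSpace N d M z) ≤ B₀.rank) :
    ∀ᶠ z in 𝓝 0, z ∈ M → IsCRFrameAt N d M z (crFrame S B₀ (graphDef Φ h)) := by
  subst hB
  obtain ⟨U, hU⟩ := hM.exists_isDefiningFun
  filter_upwards [(hM.eventually_finrank_gradSpace.and hr).eventually_nhds,
    eventually_det_interp_ne_zero (hU.2.2.1 0 hU.2.1) S, hM.eventually_isDefiningFun]
    with z h3 h4 ⟨U', hU'⟩ hm
  exact isCRFrameAt_crFrame h1 h2 hm hU' h4 (h3.mono fun y hy hym => (hy.1 hym).symm.trans_le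
    (hy.2 hym))

end IsGraphOver

namespace IsApproxEquivAllOrders

theorem boundsTransfer_gradSpace (hA : IsApproxEquivAllOrders d M M' m)
    (hρ : IsDefiningFun N d M 0 U ρ) (h0 : 0 ∈ M) (hM' : IsGraphOver Φ h' M') :
    BoundsTransfer M M' (fun q => Module.finrank ℂ (gradSpace N d M q))
      fun q => Module.finrank ℂ (gradSpace N d M' q) := by
  refine hA.boundsTransfer hρ h0 hM' (fun M q => Module.finrank ℂ (gradSpace N d M q))
    gradFamily (fun ρ z hz s i => analyticAt_gradFamily hz s i)
    (fun s k => ⟨k + 1, fun ρ ρ' hc i => CloseTo.gradFamily hc s i⟩)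
    (fun hB _ _ => hB.finrank_gradSpace_le) ?_ ?_
  · filter_upwards [hM'.eventually_isDefiningFun, hM'.eventually_analyticAt] with z ⟨U, hU⟩ hz hm
    rw [le_antisymm (gradSpace_le hm hU (isConstRightInverse_graphDef hz))
      (span_gradFamily_le hU)]
  · intro H G ht _ _ _ hgr _
    filter_upwards [hgr.eventually_isDefiningFun] with z ⟨U, hU⟩ _
    exact Submodule.finrank_mono (span_gradFamily_le hU)

/-- The frames `crFrame` built from a fixed generalized inverse are frames on the submanifolds
approximating `M'`, provided the dimension of the span of the complex gradients of `M` does not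
jump at the origin. -/
theorem eventually_isCRFrameAt_preimage {H G : Cn N → Cn N} {ht : Rn m → Rn d}
    (hM : ∀ᶠ q in 𝓝 0, q ∈ M →
      Module.finrank ℂ (gradSpace N d M q) ≤ (dbarMatrix (graphDef Φ h') 0).rank)
    {S : Matrix (Fin N) (Fin d) ℂ}
    (h1 : dbarMatrix (graphDef Φ h') 0 * S * dbarMatrix (graphDef Φ h') 0
      = dbarMatrix (graphDef Φ h') 0)
    (h2 : S * dbarMatrix (graphDef Φ h') 0 * S = S)
    (hB : IsLocalBihol H G M (G ⁻¹' M) 0) (hH0 : H 0 = 0) (hG0 : G 0 = 0)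
    (hgr : IsGraphOver Φ ht (G ⁻¹' M))
    (hc : ∀ j, CloseTo 2 (cpt (graphDef Φ ht) j) (cpt (graphDef Φ h') j)) :
    ∀ᶠ z in 𝓝 0, z ∈ G ⁻¹' M → IsCRFrameAt N d (G ⁻¹' M) z
      (crFrame S (dbarMatrix (graphDef Φ h') 0) (graphDef Φ ht)) := by
  refine hgr.eventually_isCRFrameAt h1 h2 ?_ ?_
  · ext j i
    exact sub_eq_zero.1 ((CloseTo.dbarMatrix (k := 1) hc j i).diff.apply_zero one_pos)
  · have hGt : Tendsto G (𝓝 0) (𝓝 0) := by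
      have := hB.symm.tendsto
      rwa [hH0, hG0] at this
    have hr := hB.right_inv
    rw [hH0] at hr
    filter_upwards [hGt.eventually hB.eventually, hr, hGt.eventually hM] with z h3 h4 h5 hz
    have := h3.finrank_gradSpace_le (d := d)
    rw [h4] at this
    exact this.trans (h5 hz)

theorem boundsTransfer_Espace (hA : IsApproxEquivAllOrders d M M' m)
    (hρ : IsDefiningFun N d M 0 U ρ) (h0 : 0 ∈ M) (hM' : IsGraphOver Φ h' M')
    (hM : ∀ᶠ q in 𝓝 0, q ∈ M →
      Module.finrank ℂ (gradSpace N d M q) ≤ Module.finrank ℂ (gradSpace N d M' 0))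
    (hcr : ∀ᶠ q in 𝓝 0, q ∈ M' →
      Module.finrank ℂ (gradSpace N d M' q) ≤ Module.finrank ℂ (gradSpace N d M' 0)) :
    BoundsTransfer M M' (fun q => Module.finrank ℂ (Espace N d M q))
      fun q => Module.finrank ℂ (Espace N d M' q) := by
  rw [hM'.eventually_finrank_gradSpace.self_of_nhds hM'.zero_mem] at hM hcr
  obtain ⟨S, h1, h2⟩ := exists_reflexive_generalized_inverse (dbarMatrix (graphDef Φ h') 0)
  refine hA.boundsTransfer hρ h0 hM' (fun M q => Module.finrank ℂ (Espace N d M q))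
    (fun ρ => iterFamily ρ (crFrame S (dbarMatrix (graphDef Φ h') 0) ρ))
    (fun ρ z hz s i => analyticAt_iterFamily hz (fun l => analyticAt_crFrame hz l) s i)
    (fun s k => ⟨k + 1 + s.1.length, fun ρ ρ' hc i => CloseTo.iterFamily s.1 hc s.2 i⟩)
    (fun hB hq _ => hB.finrank_Espace_le hq) ?_ ?_
  · filter_upwards [hM'.eventually_isDefiningFun, hM'.eventually_analyticAt,
      hM'.eventually_isCRFrameAt h1 h2 rfl hcr] with z ⟨U, hU⟩ hz hf hm
    rw [le_antisymm (Espace_le hm hU (isConstRightInverse_graphDef hz) (hf hm))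
      (span_iterFamily_le hU (hf hm).1)]
  · intro H G ht hB hH0 hG0 hgr hc
    filter_upwards [hgr.eventually_isDefiningFun,
      eventually_isCRFrameAt_preimage hM h1 h2 hB hH0 hG0 hgr hc] with z ⟨U, hU⟩ hf hm
    exact Submodule.finrank_mono (span_iterFamily_le hU (hf hm).1)

theorem boundsTransfer_orbitSpan (hA : IsApproxEquivAllOrders d M M' m)
    (hρ : IsDefiningFun N d M 0 U ρ) (h0 : 0 ∈ M) (hM' : IsGraphOver Φ h' M')
    (hM : ∀ᶠ q in 𝓝 0, q ∈ M →
      Module.finrank ℂ (gradSpace N d M q) ≤ Module.finrank ℂ (gradSpace N d M' 0))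
    (hcr : ∀ᶠ q in 𝓝 0, q ∈ M' →
      Module.finrank ℂ (gradSpace N d M' q) ≤ Module.finrank ℂ (gradSpace N d M' 0)) :
    BoundsTransfer M M' (fun q => Module.finrank ℂ (orbitSpan N d M q))
      fun q => Module.finrank ℂ (orbitSpan N d M' q) := by
  rw [hM'.eventually_finrank_gradSpace.self_of_nhds hM'.zero_mem] at hM hcr
  obtain ⟨S, h1, h2⟩ := exists_reflexive_generalized_inverse (dbarMatrix (graphDef Φ h') 0)
  refine hA.boundsTransfer hρ h0 hM' (fun M q => Module.finrank ℂ (orbitSpan N d M q))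
    (fun ρ => lieFamily (crFrame S (dbarMatrix (graphDef Φ h') 0) ρ))
    (fun ρ z hz s i => analyticAt_lieFamily (fun l => analyticAt_crFrame hz l) s i)
    (fun s k => ?_) (fun hB hq ⟨_, _, hρ⟩ => hB.finrank_orbitSpan_le hq hρ) ?_ ?_
  · obtain ⟨n, hn⟩ := CloseTo.exists_lieFamily (N := N) (d := d) (S := S)
      (B₀ := dbarMatrix (graphDef Φ h') 0) s
    exact ⟨k + n, fun ρ ρ' hc i => hn ρ ρ' k hc i⟩
  · filter_upwards [hM'.eventually_isDefiningFun,
      hM'.eventually_isCRFrameAt h1 h2 rfl hcr] with z ⟨U, hU⟩ hf hm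
    rw [le_antisymm (orbitSpan_le hm hU (hf hm)) (span_lieFamily_le (hf hm).1)]
  · intro H G ht hB hH0 hG0 hgr hc
    filter_upwards [eventually_isCRFrameAt_preimage hM h1 h2 hB hH0 hG0 hgr hc] with z hf hm
    exact Submodule.finrank_mono (span_lieFamily_le (hf hm).1)

end IsApproxEquivAllOrders

/-- The function `δ` on `M` has a local maximum at the origin. -/
def IsMaximalAtZero (M : Set (Cn N)) (δ : Cn N → ℕ) : Prop :=
  ∀ᶠ q in 𝓝 0, q ∈ M → δ q ≤ δ 0

theorem BoundsTransfer.apply_zero_eq {δ δ' : Cn N → ℕ} (h1 : BoundsTransfer M M' δ δ')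
    (h2 : BoundsTransfer M' M δ' δ) : δ 0 = δ' 0 := le_antisymm h2.1 h1.1

theorem BoundsTransfer.isMaximalAtZero_iff {δ δ' : Cn N → ℕ} (h1 : BoundsTransfer M M' δ δ')
    (h2 : BoundsTransfer M' M δ' δ) : IsMaximalAtZero M δ ↔ IsMaximalAtZero M' δ' := by
  refine ⟨fun h => ?_, fun h => ?_⟩
  · have := h1.2 _ h
    rwa [h1.apply_zero_eq h2] at this
  · have := h2.2 _ h
    rwa [← h1.apply_zero_eq h2] at this

theorem exists_isOpen_forall_mem_inter_iff {P : Cn N → Prop} :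
    (∃ U : Set (Cn N), IsOpen U ∧ 0 ∈ U ∧ ∀ q ∈ M ∩ U, P q) ↔ ∀ᶠ q in 𝓝 0, q ∈ M → P q := by
  rw [eventually_nhds_iff]
  exact ⟨fun ⟨U, h1, h2, h3⟩ => ⟨U, fun q hq hm => h3 q ⟨hm, hq⟩, h1, h2⟩,
    fun ⟨U, h1, h2, h3⟩ => ⟨U, h2, h3, fun q hq => h1 q hq.2 hq.1⟩⟩

theorem eventually_sub_le_sub_iff {δ : Cn N → ℕ} {c : ℕ}
    (hc : ∀ᶠ q in 𝓝 0, q ∈ M → δ q ≤ c) :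
    (∀ᶠ q in 𝓝 0, q ∈ M → c - δ 0 ≤ c - δ q) ↔ IsMaximalAtZero M δ := by
  refine eventually_congr (hc.mono fun q hq => imp_congr_right fun hm => ?_)
  have := hq hm
  omega

theorem isCRAt_iff (hM : IsGraphOver Φ h M) : IsCRAt N d M 0 ↔
    IsMaximalAtZero M fun q => Module.finrank ℂ (gradSpace N d M q) := by
  have h0 := hM.eventually_finrank_gradSpace_le.self_of_nhds hM.zero_mem
  rw [IsCRAt, exists_isOpen_forall_mem_inter_iff]
  refine eventually_congr ?_
  filter_upwards [hM.eventually_finrank_gradSpace_le, hM.eventually_le_finrank_gradSpace]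
    with q h1 h2
  refine imp_congr_right fun hm => ?_
  have := h1 hm
  have := h2 hm
  rw [excessCodim, excessCodim]
  omega

theorem isMinDegeneracyAt_iff : IsMinDegeneracyAt N d M 0 ↔
    IsMaximalAtZero M fun q => Module.finrank ℂ (Espace N d M q) := by
  rw [IsMinDegeneracyAt, exists_isOpen_forall_mem_inter_iff]
  exact eventually_sub_le_sub_iff (.of_forall fun q _ =>
    (Submodule.finrank_le _).trans_eq (Module.finrank_fin_fun ℂ))

theorem orbitCodim_eq {q : Cn N} :
    orbitCodim N d M q = 2 * N - d - Module.finrank ℂ (orbitSpan N d M q) := by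
  rw [orbitCodim, finrank_orbitSpace]

theorem isMinOrbitCodimAt_iff (hM : IsGraphOver Φ h M) : IsMinOrbitCodimAt N d M 0 ↔
    IsMaximalAtZero M fun q => Module.finrank ℂ (orbitSpan N d M q) := by
  simp only [IsMinOrbitCodimAt, exists_isOpen_forall_mem_inter_iff, orbitCodim_eq]
  exact eventually_sub_le_sub_iff hM.eventually_finrank_orbitSpan_le

end Invariants

theorem statement3 (N d : ℕ) (M M' : Set (Cn N))
    (hM : IsRASubmanifold N d M) (hM' : IsRASubmanifold N d M')
    (h0 : (0 : Cn N) ∈ M) (h0' : (0 : Cn N) ∈ M')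
    (hequiv : ∀ k : ℕ, 1 < k → ∃ H : Cn N → Cn N, IsKEquivalence N d M M' 0 0 k H) :
    (excessCodim N d M 0 = excessCodim N d M' 0 ∧
      (IsCRAt N d M 0 ↔ IsCRAt N d M' 0)) ∧
    (IsCRAt N d M 0 →
      (degeneracy N d M 0 = degeneracy N d M' 0 ∧
        (IsMinDegeneracyAt N d M 0 ↔ IsMinDegeneracyAt N d M' 0))) ∧
    (IsCRAt N d M 0 →
      (orbitCodim N d M 0 = orbitCodim N d M' 0 ∧
        (IsMinOrbitCodimAt N d M 0 ↔ IsMinOrbitCodimAt N d M' 0))) := by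
  obtain ⟨U, ρ, hρ⟩ := hM 0 h0
  obtain ⟨U', ρ', hρ'⟩ := hM' 0 h0'
  obtain ⟨Φ, hΦ⟩ := hρ.exists_chart
  obtain ⟨Φ', hΦ'⟩ := hρ'.exists_chart
  obtain ⟨h, hgr⟩ := hρ.exists_graph h0 Φ hΦ
  obtain ⟨h', hgr'⟩ := hρ'.exists_graph h0' Φ' hΦ'
  have hA : IsApproxEquivAllOrders d M M' (2 * N - d) := fun k hk =>
    let ⟨H, hH⟩ := hequiv k hk
    ⟨H, hH.exists_isApproxEquiv⟩
  have hA' := hA.symm hρ h0 hgr'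
  have hg := hA.boundsTransfer_gradSpace hρ h0 hgr'
  have hg' := hA'.boundsTransfer_gradSpace hρ' h0' hgr
  have heq := hg.apply_zero_eq hg'
  refine ⟨⟨by rw [excessCodim, excessCodim, heq], ?_⟩, fun hCR => ?_, fun hCR => ?_⟩
  · rw [isCRAt_iff hgr, isCRAt_iff hgr']
    exact hg.isMaximalAtZero_iff hg'
  all_goals
    rw [isCRAt_iff hgr] at hCR
    have hCR' := (hg.isMaximalAtZero_iff hg').1 hCR
    have hb : ∀ᶠ q in nhds 0, q ∈ M →
        Module.finrank ℂ (gradSpace N d M q) ≤ Module.finrank ℂ (gradSpace N d M' 0) :=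
      hCR.mono fun q hq hm => (hq hm).trans_eq heq
    have hb' : ∀ᶠ q in nhds 0, q ∈ M' →
        Module.finrank ℂ (gradSpace N d M' q) ≤ Module.finrank ℂ (gradSpace N d M 0) :=
      hCR'.mono fun q hq hm => (hq hm).trans_eq heq.symm
  · have he := hA.boundsTransfer_Espace hρ h0 hgr' hb hCR'
    have he' := hA'.boundsTransfer_Espace hρ' h0' hgr hb' hCR
    have := he.apply_zero_eq he'
    exact ⟨by rw [degeneracy, degeneracy, this], by
      rw [isMinDegeneracyAt_iff, isMinDegeneracyAt_iff]
      exact he.isMaximalAtZero_iff he'⟩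
  · have he := hA.boundsTransfer_orbitSpan hρ h0 hgr' hb hCR'
    have he' := hA'.boundsTransfer_orbitSpan hρ' h0' hgr hb' hCR
    have := he.apply_zero_eq he'
    exact ⟨by rw [orbitCodim_eq, orbitCodim_eq, this], by
      rw [isMinOrbitCodimAt_iff hgr, isMinOrbitCodimAt_iff hgr']
      exact he.isMaximalAtZero_iff he'⟩
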